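/- Let n ≥ 2 and let μ be a finite even Borel measure on S^{n-1} that is not concentrated in any great subsphere (i.e., the support of μ is not contained in S^{n-1} ∩ v^⊥ for any v ∈ S^{n-1}) and whose total mass satisfies μ(S^{n-1}) < 1/√(2π). Then there exists a unique origin-symmetric convex body K in ℝⁿ with γ_n(K) > 1/2 such that S_{γ_n,K}(η) = μ(η) for every Borel set η ⊆ S^{n-1}. -/

import Mathlib

open MeasureTheory Metric Set Filter
open scoped RealInnerProductSpace Topology Pointwise NNReal ENNReal

noncomputable section

/-- `ℝⁿ` as Euclidean space. -/
abbrev Eu (n : ℕ) := EuclideanSpace ℝ (Fin n)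

/-- The Gaussian measure `γₙ(A) = (2π)^{-n/2} ∫_A e^{-|x|²/2} dx`. -/
def gaussVol (n : ℕ) (A : Set (Eu n)) : ℝ :=
  (Real.sqrt (2 * Real.pi))⁻¹ ^ n * ∫ x in A, Real.exp (-‖x‖ ^ 2 / 2)

/-- A convex body: a compact convex set with nonempty interior. -/
def IsConvexBody {n : ℕ} (K : Set (Eu n)) : Prop :=
  Convex ℝ K ∧ IsCompact K ∧ (interior K).Nonempty

/-- The support function `h_K(v) = max_{y ∈ K} ⟪y, v⟫`. -/
def suppFun {n : ℕ} (K : Set (Eu n)) (v : Eu n) : ℝ :=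
  sSup ((fun y => ⟪y, v⟫) '' K)

/-- The Gaussian surface area measure of `K`, as a set function:
`S_{γₙ,K}(η) = (2π)^{-n/2} ∫_{ν_K⁻¹(η)} e^{-|x|²/2} dH^{n-1}(x)`, where
`ν_K⁻¹(η)` is the set of boundary points of `K` having an outer unit normal in `η`. -/
def gaussSurf (n : ℕ) (K : Set (Eu n)) (η : Set (Eu n)) : ℝ :=
  (Real.sqrt (2 * Real.pi))⁻¹ ^ n *
    ∫ x in {x | x ∈ frontier K ∧ ∃ v ∈ η, ⟪x, v⟫ = suppFun K v},
      Real.exp (-‖x‖ ^ 2 / 2) ∂μH[(n : ℝ) - 1]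

open Classical in
/-- (A choice of) Gauss map of `K`: to a boundary point `x` it assigns an outer unit
normal of `K` at `x` (for a convex body `K`, this is unique for `H^{n-1}`-a.e. `x ∈ ∂K`). -/
def gaussMap {n : ℕ} (K : Set (Eu n)) (x : Eu n) : Eu n :=
  if h : ∃ v : Eu n, ‖v‖ = 1 ∧ ⟪x, v⟫ = suppFun K v then h.choose else 0

/-- The Wulff shape `[g] = {x : x·v ≤ g v for all unit v}`. -/
def wulff {n : ℕ} (g : Eu n → ℝ) : Set (Eu n) :=
  {x | ∀ v : Eu n, ‖v‖ = 1 → ⟪x, v⟫ ≤ g v}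

/-- The radial function `ρ_K(u) = max {r : r • u ∈ K}`. -/
def radialFun {n : ℕ} (K : Set (Eu n)) (u : Eu n) : ℝ :=
  sSup {r : ℝ | r • u ∈ K}

/-- The standard Gaussian distribution function `Φ`. -/
def Phi (x : ℝ) : ℝ :=
  (Real.sqrt (2 * Real.pi))⁻¹ * ∫ t in Iic x, Real.exp (-t ^ 2 / 2)

/-- The inverse `Φ⁻¹` of the standard Gaussian distribution function. -/
def PhiInv : ℝ → ℝ := Function.invFun Phi

open MeasureTheory Metric Set Filter
open scoped RealInnerProductSpace Topology Pointwise NNReal ENNReal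

noncomputable section

/-- Standard Gaussian density. -/
def ph (x : ℝ) : ℝ := (Real.sqrt (2 * Real.pi))⁻¹ * Real.exp (-x ^ 2 / 2)

lemma sqrt2pi_pos : 0 < Real.sqrt (2 * Real.pi) := Real.sqrt_pos.2 (by positivity)

lemma ph_pos (x : ℝ) : 0 < ph x := by
  unfold ph; have := sqrt2pi_pos; positivity

lemma ph_cont : Continuous ph := by unfold ph; fun_prop

lemma ph_eq_pdf (x : ℝ) : ph x = ProbabilityTheory.gaussianPDFReal 0 1 x := by
  simp [ph, ProbabilityTheory.gaussianPDFReal]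

lemma ph_integrable : Integrable ph := by
  have := ProbabilityTheory.integrable_gaussianPDFReal 0 1
  refine this.congr (Eventually.of_forall fun x => (ph_eq_pdf x).symm)

lemma ph_integral : ∫ x, ph x = 1 := by
  have := ProbabilityTheory.integral_gaussianPDFReal_eq_one 0 (v := 1) one_ne_zero
  rw [← this]; exact integral_congr_ae (Eventually.of_forall fun x => ph_eq_pdf x)

lemma Phi_eq (x : ℝ) : Phi x = ∫ t in Iic x, ph t := by
  unfold Phi ph; rw [integral_const_mul]

lemma Phi_hasDerivAt (x : ℝ) : HasDerivAt Phi (ph x) x := by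
  have h : Phi = fun x => (∫ t in Iic (0 : ℝ), ph t) + ∫ t in (0 : ℝ)..x, ph t := by
    funext y
    rw [Phi_eq, ← intervalIntegral.integral_Iic_sub_Iic (ph_integrable.integrableOn)
      (ph_integrable.integrableOn)]
    ring
  rw [h]
  exact (intervalIntegral.integral_hasDerivAt_right (ph_cont.intervalIntegrable _ _)
    (ph_cont.stronglyMeasurableAtFilter _ _) ph_cont.continuousAt).const_add _

lemma Phi_strictMono : StrictMono Phi := by
  apply strictMono_of_deriv_pos
  intro x; rw [(Phi_hasDerivAt x).deriv]; exact ph_pos x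

lemma Phi_cont : Continuous Phi :=
  continuous_iff_continuousAt.2 fun x => (Phi_hasDerivAt x).continuousAt

lemma Phi_tendsto_top : Tendsto Phi atTop (𝓝 1) := by
  have h := (aecover_Iic (μ := volume) (tendsto_id (α := ℝ) (x := atTop))).integral_tendsto_of_countably_generated ph_integrable
  rw [ph_integral] at h
  exact h.congr fun x => (Phi_eq x).symm

lemma Phi_neg (x : ℝ) : Phi (-x) = 1 - Phi x := by
  have h1 : ∫ t in Iic (-x), ph t = ∫ t in Ioi x, ph t := by
    have := integral_comp_neg_Iic (-x) ph
    rw [neg_neg] at this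
    rw [← this]
    congr 1; funext t; simp [ph]
  have h2 : (∫ t in Iic x, ph t) + ∫ t in Ioi x, ph t = 1 := by
    rw [← ph_integral, ← compl_Iic]
    exact integral_add_compl measurableSet_Iic ph_integrable
  rw [Phi_eq, Phi_eq, h1]; linarith

lemma Phi_tendsto_bot : Tendsto Phi atBot (𝓝 0) := by
  have h : Tendsto (fun x => 1 - Phi (-x)) atBot (𝓝 (1 - 1)) :=
    (Phi_tendsto_top.comp tendsto_neg_atBot_atTop).const_sub 1
  simp only [sub_self] at h
  refine h.congr fun x => ?_
  have := Phi_neg (-x); rw [neg_neg] at this; rw [this]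

lemma Phi_zero : Phi 0 = 1 / 2 := by
  have := Phi_neg 0; rw [neg_zero] at this; linarith

lemma Phi_pos (x : ℝ) : 0 < Phi x := by
  have h0 : 0 ≤ Phi (x - 1) := by
    rw [Phi_eq]; exact integral_nonneg fun t => (ph_pos t).le
  exact lt_of_le_of_lt h0 (Phi_strictMono (by linarith))

lemma Phi_lt_one (x : ℝ) : Phi x < 1 := by
  have := Phi_pos (-x); rw [Phi_neg] at this; linarith

lemma Phi_surj {p : ℝ} (h0 : 0 < p) (h1 : p < 1) : ∃ x, Phi x = p := by
  obtain ⟨a, ha⟩ := (Phi_tendsto_bot.eventually (gt_mem_nhds h0)).exists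
  obtain ⟨b, hb⟩ := (Phi_tendsto_top.eventually (lt_mem_nhds h1)).exists
  exact mem_range_of_exists_le_of_exists_ge Phi_cont ⟨a, ha.le⟩ ⟨b, hb.le⟩

lemma PhiInv_Phi (x : ℝ) : PhiInv (Phi x) = x :=
  Function.leftInverse_invFun Phi_strictMono.injective x

lemma Phi_PhiInv {p : ℝ} (h0 : 0 < p) (h1 : p < 1) : Phi (PhiInv p) = p :=
  Function.invFun_eq (Phi_surj h0 h1)

lemma PhiInv_contAt {p : ℝ} (h0 : 0 < p) (h1 : p < 1) : ContinuousAt PhiInv p := by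
  have hm : StrictMonoOn PhiInv (Ioo 0 1) := by
    intro a ha b hb hab
    by_contra h
    push Not at h
    have := Phi_strictMono.monotone h
    rw [Phi_PhiInv ha.1 ha.2, Phi_PhiInv hb.1 hb.2] at this
    linarith
  refine hm.continuousAt_of_image_mem_nhds (Ioo_mem_nhds h0 h1) ?_
  have : PhiInv '' Ioo 0 1 = univ := by
    apply eq_univ_of_forall
    intro x; exact ⟨Phi x, ⟨Phi_pos x, Phi_lt_one x⟩, PhiInv_Phi x⟩
  rw [this]; exact univ_mem

lemma PhiInv_hasDerivAt {p : ℝ} (h0 : 0 < p) (h1 : p < 1) :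
    HasDerivAt PhiInv (ph (PhiInv p))⁻¹ p := by
  refine HasDerivAt.of_local_left_inverse (f := Phi) (PhiInv_contAt h0 h1)
    (Phi_hasDerivAt _) (ph_pos _).ne' ?_
  filter_upwards [Ioo_mem_nhds h0 h1] with y hy
  exact Phi_PhiInv hy.1 hy.2

lemma ph_hasDerivAt (x : ℝ) : HasDerivAt ph (-x * ph x) x := by
  unfold ph
  have h : HasDerivAt (fun x : ℝ => -x ^ 2 / 2) (-x) x := by
    have := ((hasDerivAt_pow 2 x).neg).div_const 2
    have e : -((2:ℕ) * x ^ (2 - 1)) / 2 = -x := by norm_num; ring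
    rw [e] at this; exact this
  have := (h.exp).const_mul ((Real.sqrt (2 * Real.pi))⁻¹)
  exact this.congr_deriv (by ring)

lemma Phi_strictConcave : StrictConcaveOn ℝ (Ici 0) Phi := by
  refine StrictAntiOn.strictConcaveOn_of_deriv (convex_Ici 0) Phi_cont.continuousOn ?_
  rw [interior_Ici]
  intro x hx y hy hxy
  rw [(Phi_hasDerivAt x).deriv, (Phi_hasDerivAt y).deriv]
  unfold ph
  have := sqrt2pi_pos
  have hx' : 0 < x := hx
  refine mul_lt_mul_of_pos_left (Real.exp_lt_exp.2 ?_) (by positivity)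
  nlinarith

lemma PhiInv_le_iff {p a : ℝ} (h0 : 0 < p) (h1 : p < 1) : a ≤ PhiInv p ↔ Phi a ≤ p := by
  rw [← Phi_strictMono.le_iff_le (a := a), Phi_PhiInv h0 h1]

end

open MeasureTheory Metric Set Filter
open scoped RealInnerProductSpace Topology Pointwise NNReal ENNReal

noncomputable section

/-- Bounded and Lipschitz with the same constant. -/
structure BL (K : ℝ) (f : ℝ → ℝ) : Prop where
  bd : ∀ x, |f x| ≤ K
  lip : ∀ x y, |f x - f y| ≤ K * |x - y|

lemma BL.nonneg {K : ℝ} {f : ℝ → ℝ} (h : BL K f) : 0 ≤ K := (abs_nonneg _).trans (h.bd 0)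

lemma BL.mono {K L : ℝ} {f : ℝ → ℝ} (h : BL K f) (hKL : K ≤ L) : BL L f :=
  ⟨fun x => (h.bd x).trans hKL, fun x y => (h.lip x y).trans
    (mul_le_mul_of_nonneg_right hKL (abs_nonneg _))⟩

lemma BL.add {K L : ℝ} {f g : ℝ → ℝ} (hf : BL K f) (hg : BL L g) :
    BL (K + L) (fun x => f x + g x) := by
  constructor
  · intro x; exact (abs_add_le _ _).trans (add_le_add (hf.bd x) (hg.bd x))
  · intro x y
    have : f x + g x - (f y + g y) = (f x - f y) + (g x - g y) := by ring
    rw [this]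
    have := abs_add_le (f x - f y) (g x - g y)
    have := hf.lip x y; have := hg.lip x y
    linarith

lemma BL.neg {K : ℝ} {f : ℝ → ℝ} (hf : BL K f) : BL K (fun x => - f x) := by
  constructor
  · intro x; rw [abs_neg]; exact hf.bd x
  · intro x y
    have : -f x - -f y = -(f x - f y) := by ring
    rw [this, abs_neg]; exact hf.lip x y

lemma BL.mul {K L : ℝ} {f g : ℝ → ℝ} (hf : BL K f) (hg : BL L g) :
    BL (2 * K * L + K * L) (fun x => f x * g x) := by
  have hK := hf.nonneg
  have hL := hg.nonneg
  constructor
  · intro x; rw [abs_mul]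
    have := mul_le_mul (hf.bd x) (hg.bd x) (abs_nonneg _) hK
    nlinarith [mul_nonneg hK hL]
  · intro x y
    have : f x * g x - f y * g y = f x * (g x - g y) + (f x - f y) * g y := by ring
    rw [this]
    have h1 : |f x * (g x - g y)| ≤ K * (L * |x - y|) := by
      rw [abs_mul]; exact mul_le_mul (hf.bd x) (hg.lip x y) (abs_nonneg _) hK
    have h2 : |(f x - f y) * g y| ≤ (K * |x - y|) * L := by
      rw [abs_mul]; exact mul_le_mul (hf.lip x y) (hg.bd y) (abs_nonneg _) (by positivity)
    have h3 := abs_add_le (f x * (g x - g y)) ((f x - f y) * g y)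
    have h4 : 0 ≤ K * L * |x - y| := by positivity
    nlinarith

lemma BL_of_deriv {K L : ℝ} {f f' : ℝ → ℝ} (hd : ∀ x, HasDerivAt f (f' x) x)
    (h0 : ∀ x, |f x| ≤ K) (h1 : ∀ x, |f' x| ≤ L) : BL (max K L) f := by
  constructor
  · intro x; exact (h0 x).trans (le_max_left _ _)
  · intro x y
    have := (convex_univ (𝕜 := ℝ) (E := ℝ)).norm_image_sub_le_of_norm_hasDerivWithin_le
      (f := f) (f' := f') (C := L) (fun x _ => (hd x).hasDerivWithinAt)
      (fun x _ => h1 x) (mem_univ y) (mem_univ x)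
    refine this.trans (mul_le_mul_of_nonneg_right (le_max_right _ _) (abs_nonneg _))

/-- `C²` functions with uniform bounds. -/
structure C2 (K : ℝ) (u u1 u2 : ℝ → ℝ) : Prop where
  d1 : ∀ x, HasDerivAt u (u1 x) x
  d2 : ∀ x, HasDerivAt u1 (u2 x) x
  b0 : BL K u
  b1 : BL K u1
  b2 : BL K u2

lemma C2.mono {K L : ℝ} {u u1 u2 : ℝ → ℝ} (h : C2 K u u1 u2) (hKL : K ≤ L) : C2 L u u1 u2 :=
  ⟨h.d1, h.d2, h.b0.mono hKL, h.b1.mono hKL, h.b2.mono hKL⟩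

lemma growth {g g' : ℝ → ℝ} {C : ℝ} {k : ℕ} (hd : ∀ t, HasDerivAt g (g' t) t) (h0 : g 0 = 0)
    (hC : 0 ≤ C) (hb : ∀ t, |g' t| ≤ C * |t| ^ k) (t : ℝ) : |g t| ≤ C * |t| ^ (k + 1) := by
  have := (convex_uIcc (𝕜 := ℝ) 0 t).norm_image_sub_le_of_norm_hasDerivWithin_le
      (f := g) (f' := g') (C := C * |t| ^ k) (fun x _ => (hd x).hasDerivWithinAt)
      (fun x hx => by
        have hxt : |x| ≤ |t| := by
          have := abs_sub_left_of_mem_uIcc hx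
          simpa using this
        exact (hb x).trans (by gcongr)) left_mem_uIcc right_mem_uIcc
  rw [h0] at this
  simp only [sub_zero, Real.norm_eq_abs] at this
  rw [pow_succ]; linarith

lemma C2.taylor1 {K : ℝ} {u u1 u2 : ℝ → ℝ} (h : C2 K u u1 u2) (x t : ℝ) :
    |u (x + t) - u x - t * u1 x| ≤ K * |t| ^ 2 := by
  have := growth (g := fun t => u (x + t) - u x - t * u1 x) (g' := fun t => u1 (x + t) - u1 x)
    (C := K) (k := 1) (fun t => ?_) (by simp) h.b0.nonneg (fun t => ?_) t
  · simpa using this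
  · have h1 := ((h.d1 (x + t)).comp_const_add x t).sub_const (u x)
    have h2 := (hasDerivAt_id t).mul_const (u1 x)
    exact (h1.sub h2).congr_deriv (by simp)
  · have := h.b1.lip (x + t) x
    simpa using this

lemma C2.taylor2 {K : ℝ} {u u1 u2 : ℝ → ℝ} (h : C2 K u u1 u2) (x t : ℝ) :
    |u (x + t) - u x - t * u1 x - t ^ 2 / 2 * u2 x| ≤ K * |t| ^ 3 := by
  have h' : ∀ t, |u1 (x + t) - u1 x - t * u2 x| ≤ K * |t| ^ 2 := by
    intro t
    have := growth (g := fun t => u1 (x + t) - u1 x - t * u2 x)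
      (g' := fun t => u2 (x + t) - u2 x)
      (C := K) (k := 1) (fun t => ?_) (by simp) h.b0.nonneg (fun t => ?_) t
    · simpa using this
    · have h1 := ((h.d2 (x + t)).comp_const_add x t).sub_const (u1 x)
      have h2 := (hasDerivAt_id t).mul_const (u2 x)
      exact (h1.sub h2).congr_deriv (by simp)
    · have := h.b2.lip (x + t) x
      simpa using this
  refine growth (g := fun t => u (x + t) - u x - t * u1 x - t ^ 2 / 2 * u2 x)
      (g' := fun t => u1 (x + t) - u1 x - t * u2 x)
      (C := K) (k := 2) (fun t => ?_) (by simp) h.b0.nonneg h' t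
  have h1 := ((h.d1 (x + t)).comp_const_add x t).sub_const (u x)
  have h2 := (hasDerivAt_id t).mul_const (u1 x)
  have h3 := ((hasDerivAt_pow 2 t).div_const 2).mul_const (u2 x)
  refine ((h1.sub h2).sub h3).congr_deriv ?_
  norm_num

/-- Two-point average. -/
def avg (ε : ℝ) (u : ℝ → ℝ) : ℝ → ℝ := fun x => (u (x + ε) + u (x - ε)) / 2

lemma BL.avg {K : ℝ} {f : ℝ → ℝ} (h : BL K f) (ε : ℝ) : BL K (avg ε f) := by
  constructor
  · intro x
    have h1 := h.bd (x + ε); have h2 := h.bd (x - ε)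
    rw [abs_le] at *; unfold _root_.avg; constructor <;> linarith [h1.1, h1.2, h2.1, h2.2]
  · intro x y
    have h1 := h.lip (x + ε) (y + ε)
    have h2 := h.lip (x - ε) (y - ε)
    simp only [add_sub_add_right_eq_sub, sub_sub_sub_cancel_right] at h1 h2
    rw [abs_le] at *; unfold _root_.avg; constructor <;> linarith [h1.1, h1.2, h2.1, h2.2]

lemma hasDerivAt_avg {u u1 : ℝ → ℝ} (h : ∀ x, HasDerivAt u (u1 x) x) (ε x : ℝ) :
    HasDerivAt (avg ε u) (avg ε u1 x) x := by
  have h1 := (h (x + ε)).comp_add_const x ε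
  have h2 := (h (x - ε)).comp_sub_const x ε
  exact (h1.add h2).div_const 2

lemma C2.avg {K : ℝ} {u u1 u2 : ℝ → ℝ} (h : C2 K u u1 u2) (ε : ℝ) :
    C2 K (avg ε u) (avg ε u1) (avg ε u2) :=
  ⟨hasDerivAt_avg h.d1 ε, hasDerivAt_avg h.d2 ε, h.b0.avg ε, h.b1.avg ε, h.b2.avg ε⟩

lemma ph_le_one (x : ℝ) : ph x ≤ 1 := by
  unfold ph
  have h1 : (Real.sqrt (2 * Real.pi))⁻¹ ≤ 1 := by
    apply inv_le_one_of_one_le₀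
    rw [Real.one_le_sqrt]; nlinarith [Real.pi_gt_three]
  have h2 : Real.exp (-x ^ 2 / 2) ≤ 1 := by
    rw [Real.exp_le_one_iff]; nlinarith [sq_nonneg x]
  have := sqrt2pi_pos
  exact mul_le_one₀ h1 (Real.exp_pos _).le h2

lemma ph_abs (x : ℝ) : |ph x| ≤ 1 := by rw [abs_of_pos (ph_pos x)]; exact ph_le_one x

lemma abs_mul_ph_le_one (x : ℝ) : |x * ph x| ≤ 1 := by
  have h1 : (Real.sqrt (2 * Real.pi))⁻¹ ≤ 1 := by
    apply inv_le_one_of_one_le₀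
    rw [Real.one_le_sqrt]; nlinarith [Real.pi_gt_three]
  have h2 : |x| * Real.exp (-x ^ 2 / 2) ≤ 1 := by
    have h3 : |x| ≤ Real.exp (x ^ 2 / 2) := by
      have := Real.add_one_le_exp (x ^ 2 / 2)
      have h4 := sq_abs x
      nlinarith [sq_nonneg (|x| - 1)]
    have : Real.exp (-x ^ 2 / 2) = (Real.exp (x ^ 2 / 2))⁻¹ := by
      rw [← Real.exp_neg]; congr 1; ring
    rw [this]
    rw [← div_eq_mul_inv, div_le_one (Real.exp_pos _)]; exact h3
  rw [abs_mul, abs_of_pos (ph_pos x)]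
  unfold ph
  have h5 : 0 < (Real.sqrt (2 * Real.pi))⁻¹ := inv_pos.2 sqrt2pi_pos
  have h6 : 0 ≤ |x| * Real.exp (-x ^ 2 / 2) := by positivity
  nlinarith

lemma ph_ge {a x : ℝ} (h : |x| ≤ a) : ph a ≤ ph x := by
  unfold ph
  have := sqrt2pi_pos
  refine mul_le_mul_of_nonneg_left (Real.exp_le_exp.2 ?_) (by positivity)
  have : x ^ 2 ≤ a ^ 2 := by rw [← sq_abs x]; gcongr
  linarith

lemma Phi_taylor (x y : ℝ) : |Phi y - Phi x - ph x * (y - x)| ≤ (y - x) ^ 2 := by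
  have hl : ∀ s, |ph (x + s) - ph x| ≤ 1 * |s| ^ 1 := by
    intro s
    refine growth (g := fun s => ph (x + s) - ph x) (g' := fun s => -(x + s) * ph (x + s))
      (C := 1) (k := 0) (fun t => ?_) (by simp) zero_le_one (fun t => ?_) s
    · exact ((ph_hasDerivAt (x + t)).comp_const_add x t).sub_const _
    · rw [neg_mul, abs_neg]; simpa using abs_mul_ph_le_one (x + t)
  have := growth (g := fun s => Phi (x + s) - Phi x - s * ph x)
    (g' := fun s => ph (x + s) - ph x) (C := 1) (k := 1) (fun t => ?_) (by simp) zero_le_one hl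
    (y - x)
  · simp only [one_mul, add_sub_cancel] at this
    norm_num at this
    rw [mul_comm]; exact this
  · have h1 := ((Phi_hasDerivAt (x + t)).comp_const_add x t).sub_const (Phi x)
    have h2 := (hasDerivAt_id t).mul_const (ph x)
    exact (h1.sub h2).congr_deriv (by simp)

lemma C2.Phi_comp (K : ℝ) : ∃ L, ∀ u u1 u2 : ℝ → ℝ, C2 K u u1 u2 →
    C2 L (fun x => Phi (u x)) (fun x => ph (u x) * u1 x)
      (fun x => ph (u x) * (u2 x + -(u x * (u1 x * u1 x)))) := by
  have key : ∃ A B D, ∀ u u1 u2 : ℝ → ℝ, C2 K u u1 u2 →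
     BL A (fun x => Phi (u x)) ∧ BL B (fun x => ph (u x) * u1 x) ∧
     BL D (fun x => ph (u x) * (u2 x + -(u x * (u1 x * u1 x)))) := by
    refine ⟨max 1 (1 * K), 2 * max 1 (1 * K) * K + max 1 (1 * K) * K,
      2 * max 1 (1 * K) * (K + (2 * K * (2 * K * K + K * K) + K * (2 * K * K + K * K))) +
      max 1 (1 * K) * (K + (2 * K * (2 * K * K + K * K) + K * (2 * K * K + K * K))),
      fun u u1 u2 h => ⟨?_, ?_, ?_⟩⟩
    · refine BL_of_deriv (f' := fun x => ph (u x) * u1 x) (K := 1) (L := 1 * K)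
        (fun x => (Phi_hasDerivAt (u x)).comp x (h.d1 x)) (fun x => ?_) (fun x => ?_)
      · rw [abs_of_pos (Phi_pos _)]; exact (Phi_lt_one _).le
      · rw [abs_mul]; exact mul_le_mul (ph_abs _) (h.b1.bd x) (abs_nonneg _) zero_le_one
    · refine BL.mul (K := max 1 (1 * K)) ?_ h.b1
      refine BL_of_deriv (f' := fun x => (-u x * ph (u x)) * u1 x)
        (fun x => (ph_hasDerivAt (u x)).comp x (h.d1 x)) (fun x => ph_abs _) (fun x => ?_)
      rw [abs_mul, neg_mul, abs_neg]
      exact mul_le_mul (abs_mul_ph_le_one _) (h.b1.bd x) (abs_nonneg _) zero_le_one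
    · refine BL.mul (K := max 1 (1 * K)) ?_ (h.b2.add ((h.b0.mul (h.b1.mul h.b1)).neg))
      refine BL_of_deriv (f' := fun x => (-u x * ph (u x)) * u1 x)
        (fun x => (ph_hasDerivAt (u x)).comp x (h.d1 x)) (fun x => ph_abs _) (fun x => ?_)
      rw [abs_mul, neg_mul, abs_neg]
      exact mul_le_mul (abs_mul_ph_le_one _) (h.b1.bd x) (abs_nonneg _) zero_le_one
  obtain ⟨A, B, D, hk⟩ := key
  refine ⟨max A (max B D), fun u u1 u2 h => ?_⟩
  obtain ⟨h0, h1, h2⟩ := hk u u1 u2 h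
  refine ⟨fun x => (Phi_hasDerivAt (u x)).comp x (h.d1 x), fun x => ?_,
    h0.mono (le_max_left _ _), h1.mono ((le_max_left _ _).trans (le_max_right _ _)),
    h2.mono ((le_max_right _ _).trans (le_max_right _ _))⟩
  have := ((ph_hasDerivAt (u x)).comp x (h.d1 x)).mul (h.d2 x)
  refine this.congr_deriv ?_
  simp only [Function.comp]
  ring

/-- Range condition. -/
def Rng (a : ℝ) (w : ℝ → ℝ) : Prop := ∀ x, Phi (-a) ≤ w x ∧ w x ≤ Phi a

lemma Rng.pos {a : ℝ} {w : ℝ → ℝ} (h : Rng a w) (x : ℝ) : 0 < w x := (Phi_pos _).trans_le (h x).1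
lemma Rng.lt_one {a : ℝ} {w : ℝ → ℝ} (h : Rng a w) (x : ℝ) : w x < 1 :=
  (h x).2.trans_lt (Phi_lt_one _)

lemma Rng.abs_le {a : ℝ} {w : ℝ → ℝ} (h : Rng a w) (x : ℝ) : |PhiInv (w x)| ≤ a := by
  rw [_root_.abs_le]
  constructor
  · rw [PhiInv_le_iff (h.pos x) (h.lt_one x)]; exact (h x).1
  · rw [← Phi_strictMono.le_iff_le, Phi_PhiInv (h.pos x) (h.lt_one x)]; exact (h x).2

lemma Rng.avg {a : ℝ} {w : ℝ → ℝ} (h : Rng a w) (ε : ℝ) : Rng a (avg ε w) := by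
  intro x
  have h1 := h (x + ε); have h2 := h (x - ε)
  unfold _root_.avg
  constructor <;> linarith [h1.1, h1.2, h2.1, h2.2]

lemma Rng_of_abs {a : ℝ} {u : ℝ → ℝ} (h : ∀ x, |u x| ≤ a) : Rng a (fun x => Phi (u x)) := by
  intro x
  have := _root_.abs_le.1 (h x)
  exact ⟨Phi_strictMono.monotone this.1, Phi_strictMono.monotone this.2⟩

lemma C2.PhiInv_comp (K a : ℝ) : ∃ L, ∀ w w1 w2 : ℝ → ℝ, C2 K w w1 w2 → Rng a w →
    ∃ u1 u2, C2 L (fun x => PhiInv (w x)) u1 u2 := by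
  have key : ∃ A B D, ∀ w w1 w2 u u1 ip : ℝ → ℝ, C2 K w w1 w2 → Rng a w →
     (∀ x, u x = PhiInv (w x)) → (∀ x, ip x = (ph (u x))⁻¹) → (∀ x, u1 x = w1 x * ip x) →
     (∀ x, HasDerivAt u (u1 x) x) → (∀ x, HasDerivAt ip (u x * u1 x * ip x) x) →
     BL A u ∧ BL B u1 ∧ BL D (fun x => w2 x * ip x + u x * (u1 x * u1 x)) := by
    let U := max a (K * (ph a)⁻¹)
    let I := max ((ph a)⁻¹) (a * (K * (ph a)⁻¹) * (ph a)⁻¹)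
    let B := 2 * K * I + K * I
    let B2 := 2 * B * B + B * B
    refine ⟨U, B, B + (2 * U * B2 + U * B2),
      fun w w1 w2 u u1 ip h hr hu hi hu1 hdu hdi => ?_⟩
    have b0 : ∀ x, |u x| ≤ a := fun x => by rw [hu]; exact hr.abs_le x
    have ha : 0 ≤ a := (abs_nonneg _).trans (b0 0)
    have bi : ∀ x, |ip x| ≤ (ph a)⁻¹ := by
      intro x
      rw [hi, abs_of_pos (inv_pos.2 (ph_pos _))]
      exact inv_anti₀ (ph_pos _) (ph_ge (b0 x))
    have hia : 0 < (ph a)⁻¹ := inv_pos.2 (ph_pos _)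
    have b1 : ∀ x, |u1 x| ≤ K * (ph a)⁻¹ := by
      intro x
      rw [hu1, abs_mul]
      exact mul_le_mul (h.b1.bd x) (bi x) (abs_nonneg _) h.b0.nonneg
    have hK := h.b0.nonneg
    have Bu : BL (max a (K * (ph a)⁻¹)) u := BL_of_deriv hdu b0 b1
    have Bi : BL (max ((ph a)⁻¹) (a * (K * (ph a)⁻¹) * (ph a)⁻¹)) ip := by
      refine BL_of_deriv hdi bi (fun x => ?_)
      rw [abs_mul, abs_mul]
      have := b0 x; have := b1 x; have := bi x
      gcongr
    have hu1' : u1 = fun x => w1 x * ip x := funext hu1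
    have B1 := h.b1.mul Bi
    rw [← hu1'] at B1
    exact ⟨Bu, B1, (h.b2.mul Bi).add (Bu.mul (B1.mul B1))⟩
  obtain ⟨A, B, D, hk⟩ := key
  refine ⟨max A (max B D), fun w w1 w2 h hr => ?_⟩
  let u : ℝ → ℝ := fun x => PhiInv (w x)
  let ip : ℝ → ℝ := fun x => (ph (u x))⁻¹
  let u1 : ℝ → ℝ := fun x => w1 x * ip x
  have hdu : ∀ x, HasDerivAt u (u1 x) x := fun x => by
    have := (PhiInv_hasDerivAt (hr.pos x) (hr.lt_one x)).comp x (h.d1 x)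
    refine this.congr_deriv ?_
    simp only [u1, ip, u]; ring
  have hdi : ∀ x, HasDerivAt ip (u x * u1 x * ip x) x := fun x => by
    have := ((ph_hasDerivAt (u x)).comp x (hdu x)).inv (ph_pos _).ne'
    refine this.congr_deriv ?_
    have hp := (ph_pos (u x)).ne'
    simp only [ip, Function.comp]
    field_simp
  obtain ⟨h0, h1, h2⟩ := hk w w1 w2 u u1 ip h hr (fun x => rfl) (fun x => rfl) (fun x => rfl)
    hdu hdi
  refine ⟨u1, fun x => w2 x * ip x + u x * (u1 x * u1 x), hdu, fun x => ?_,
    h0.mono (le_max_left _ _), h1.mono ((le_max_left _ _).trans (le_max_right _ _)),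
    h2.mono ((le_max_right _ _).trans (le_max_right _ _))⟩
  refine ((h.d2 x).mul (hdi x)).congr_deriv ?_
  simp only [u1]; ring

lemma Phi_lower {K u v : ℝ} (hu : |u| ≤ K) (hv : |v| ≤ K) :
    ph K * |v - u| ≤ |Phi v - Phi u| := by
  wlog huv : u ≤ v generalizing u v
  · have := this hv hu (le_of_not_ge huv)
    rwa [abs_sub_comm, abs_sub_comm (Phi v)]
  rw [abs_of_nonneg (sub_nonneg.2 huv), abs_of_nonneg (sub_nonneg.2 (Phi_strictMono.monotone huv))]
  refine (convex_Icc (-K) K).mul_sub_le_image_sub_of_le_deriv Phi_cont.continuousOn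
    (fun x _ => (Phi_hasDerivAt x).differentiableAt.differentiableWithinAt) ?_ u (abs_le.1 hu)
    v (abs_le.1 hv) huv
  intro x hx
  rw [(Phi_hasDerivAt x).deriv]
  exact ph_ge (abs_le.2 (mem_Icc.1 (interior_subset hx)))

/-- One step of the flow. -/
lemma step_expand (K : ℝ) : ∃ M, 0 ≤ M ∧ ∀ u u1 u2 : ℝ → ℝ, C2 K u u1 u2 → ∀ ε, 0 < ε → ε ≤ 1 →
    ∀ x, |PhiInv (avg ε (fun x => Phi (u x)) x) - u x - ε ^ 2 / 2 * (u2 x - u x * u1 x ^ 2)|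
      ≤ M * ε ^ 3 := by
  obtain ⟨L0, hL0⟩ := C2.Phi_comp K
  obtain ⟨L, hLn, hL⟩ : ∃ L, 0 ≤ L ∧ ∀ u u1 u2 : ℝ → ℝ, C2 K u u1 u2 →
    C2 L (fun x => Phi (u x)) (fun x => ph (u x) * u1 x)
      (fun x => ph (u x) * (u2 x + -(u x * (u1 x * u1 x)))) :=
    ⟨|L0|, abs_nonneg _, fun u u1 u2 h => (hL0 u u1 u2 h).mono (le_abs_self _)⟩
  have hpK := ph_pos K
  refine ⟨((L / ph K) ^ 2 + L) / ph K, by positivity, ?_⟩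
  intro u u1 u2 h ε hε hε1 x
  have hw := hL u u1 u2 h
  have hr : Rng K (fun x => Phi (u x)) := Rng_of_abs h.b0.bd
  have hr' := hr.avg ε
  set w' := avg ε (fun x => Phi (u x)) x with hw'
  set v := PhiInv w' with hv
  have hvK : |v| ≤ K := hr'.abs_le x
  have hPv : Phi v = w' := Phi_PhiInv (hr'.pos x) (hr'.lt_one x)
  have t1 := hw.taylor1 x ε
  have t1' := hw.taylor1 x (-ε)
  have t2 := hw.taylor2 x ε
  have t2' := hw.taylor2 x (-ε)
  simp only [abs_neg, abs_of_pos hε, ← sub_eq_add_neg] at t1 t1' t2 t2'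
  have e1 : |w' - Phi (u x)| ≤ L * ε ^ 2 := by
    rw [abs_le] at *
    rw [hw']; unfold avg
    constructor <;> linarith [t1.1, t1.2, t1'.1, t1'.2]
  have e2 : |w' - Phi (u x) - ε ^ 2 / 2 * (ph (u x) * (u2 x - (u x * (u1 x * u1 x))))|
      ≤ L * ε ^ 3 := by
    rw [abs_le] at *
    rw [hw']; unfold avg
    constructor <;> linarith [t2.1, t2.2, t2'.1, t2'.2]
  have e3 : |v - u x| ≤ L / ph K * ε ^ 2 := by
    have := (Phi_lower (h.b0.bd x) hvK)
    rw [hPv] at this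
    rw [div_mul_eq_mul_div, le_div_iff₀ hpK]
    linarith
  have e4 := Phi_taylor (u x) v
  rw [hPv] at e4
  have e5 : (v - u x) ^ 2 ≤ (L / ph K) ^ 2 * ε ^ 3 := by
    have : (v - u x) ^ 2 ≤ (L / ph K * ε ^ 2) ^ 2 := by rw [← sq_abs]; gcongr
    refine this.trans ?_
    rw [mul_pow, ← pow_mul]
    refine mul_le_mul_of_nonneg_left ?_ (by positivity)
    exact pow_le_pow_of_le_one hε.le hε1 (by norm_num)
  have e6 : ph (u x) * |v - u x - ε ^ 2 / 2 * (u2 x - u x * u1 x ^ 2)| ≤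
      ((L / ph K) ^ 2 + L) * ε ^ 3 := by
    rw [← abs_of_pos (ph_pos (u x)), ← abs_mul]
    rw [abs_le] at e2 e4 ⊢
    constructor <;> nlinarith [e2.1, e2.2, e4.1, e4.2]
  have e7 := ph_ge (h.b0.bd x)
  rw [div_mul_eq_mul_div (((L / ph K) ^ 2 + L)), le_div_iff₀ hpK]
  have := mul_le_mul_of_nonneg_right e7 (abs_nonneg (v - u x - ε ^ 2 / 2 * (u2 x - u x * u1 x ^ 2)))
  linarith

set_option maxHeartbeats 2000000 in
/-- Maximum principle for one step. -/
lemma step_max {a b : ℝ} (ha : 0 < a) (hb : 0 < b) (hab : a + b = 1) {K M : ℝ} (hK : 0 ≤ K)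
    (hM : 0 ≤ M) : ∃ M', 0 ≤ M' ∧ ∀ f f1 f2 g g1 g2 h h1 h2 fn gn hn : ℝ → ℝ,
    C2 K f f1 f2 → C2 K g g1 g2 → C2 K h h1 h2 → ∀ ε, 0 < ε → ε ≤ 1 →
    (∀ x, |fn x - f x - ε ^ 2 / 2 * (f2 x - f x * f1 x ^ 2)| ≤ M * ε ^ 3) →
    (∀ x, |gn x - g x - ε ^ 2 / 2 * (g2 x - g x * g1 x ^ 2)| ≤ M * ε ^ 3) →
    (∀ x, |hn x - h x - ε ^ 2 / 2 * (h2 x - h x * h1 x ^ 2)| ≤ M * ε ^ 3) →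
    ∀ m ≤ 0, (∀ x y, m ≤ h (a * x + b * y) - a * f x - b * g y) →
      ∀ x y, m - M' * ε ^ 3 ≤ hn (a * x + b * y) - a * fn x - b * gn y := by
  set K1 := K + K ^ 3 + 2 * M with hK1
  have hK1n : 0 ≤ K1 := by positivity
  set K2 := K ^ 2 * K1 + 2 * K ^ 2 * (K1 + 2 * K) + 2 * K ^ 2 * (K1 + 2 * K) with hK2
  refine ⟨2 * K + 2 * M + K2, by positivity, ?_⟩
  intro f f1 f2 g g1 g2 h h1 h2 fn gn hn hf hg hh ε hε hε1 ef eg eh m hm hC x y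
  set z := a * x + b * y with hz
  have ef := abs_le.1 (ef x)
  have eg := abs_le.1 (eg y)
  have eh := abs_le.1 (eh z)
  have ha1 : a ≤ 1 := by linarith
  have hb1 : b ≤ 1 := by linarith
  have hε2 : 0 < ε ^ 2 := by positivity
  have hε3 : 0 < ε ^ 3 := by positivity
  have hε32 : ε ^ 3 ≤ ε ^ 2 := pow_le_pow_of_le_one hε.le hε1 (by norm_num)
  have hM3 : 0 ≤ M * ε ^ 3 := by positivity
  -- basic lower bound
  have low : h z - a * f x - b * g y + ε ^ 2 / 2 * ((h2 z - a * f2 x - b * g2 y) -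
      (h z * h1 z ^ 2 - a * (f x * f1 x ^ 2) - b * (g y * g1 y ^ 2))) - 2 * (M * ε ^ 3)
      ≤ hn z - a * fn x - b * gn y := by
    have q1 : a * (fn x - f x - ε ^ 2 / 2 * (f2 x - f x * f1 x ^ 2)) ≤ a * (M * ε ^ 3) :=
      mul_le_mul_of_nonneg_left ef.2 ha.le
    have q2 : b * (gn y - g y - ε ^ 2 / 2 * (g2 y - g y * g1 y ^ 2)) ≤ b * (M * ε ^ 3) :=
      mul_le_mul_of_nonneg_left eg.2 hb.le
    have q3 : a * (M * ε ^ 3) + b * (M * ε ^ 3) = M * ε ^ 3 := by rw [← add_mul, hab, one_mul]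
    linarith [eh.1]
  have bf := hf.b0.bd x
  have bg := hg.b0.bd y
  have bh := hh.b0.bd z
  have bf1 := hf.b1.bd x
  have bg1 := hg.b1.bd y
  have bh1 := hh.b1.bd z
  have cub : ∀ s t : ℝ, |s| ≤ K → |t| ≤ K → |s * t ^ 2| ≤ K ^ 3 := by
    intro s t hs ht
    rw [abs_mul, abs_pow]
    calc |s| * |t| ^ 2 ≤ K * K ^ 2 := by gcongr
      _ = K ^ 3 := by ring
  have conv : ∀ {s t B : ℝ}, |s| ≤ B → |t| ≤ B → |a * s + b * t| ≤ B := by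
    intro s t B hs ht
    rw [abs_le] at *
    constructor
    · have e : a * B + b * B = B := by rw [← add_mul, hab, one_mul]
      linarith [mul_le_mul_of_nonneg_left hs.1 ha.le, mul_le_mul_of_nonneg_left ht.1 hb.le]
    · have e : a * B + b * B = B := by rw [← add_mul, hab, one_mul]
      linarith [mul_le_mul_of_nonneg_left hs.2 ha.le, mul_le_mul_of_nonneg_left ht.2 hb.le]
  rcases lt_or_ge (m + K1 * ε ^ 2) (h z - a * f x - b * g y) with hd | hd
  · have c1 := abs_le.1 (conv (hf.b2.bd x) (hg.b2.bd y))
    have c2 := abs_le.1 (hh.b2.bd z)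
    have c3 := abs_le.1 (conv (cub _ _ bf bf1) (cub _ _ bg bg1))
    have c4 := abs_le.1 (cub _ _ bh bh1)
    have c5 : -(2 * K + 2 * K ^ 3) ≤ (h2 z - a * f2 x - b * g2 y) -
      (h z * h1 z ^ 2 - a * (f x * f1 x ^ 2) - b * (g y * g1 y ^ 2)) := by linarith
    have c6 := mul_le_mul_of_nonneg_left c5 (by positivity : 0 ≤ ε ^ 2 / 2)
    have c7 : K1 * ε ^ 2 = (K + K ^ 3) * ε ^ 2 + 2 * M * ε ^ 2 := by rw [hK1]; ring
    have c8 : M * ε ^ 3 ≤ M * ε ^ 2 := mul_le_mul_of_nonneg_left hε32 hM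
    have c9 : 0 ≤ (2 * K + 2 * M + K2) * ε ^ 3 := by positivity
    linarith
  · -- second derivatives
    have s1 := hC (x + ε) (y + ε)
    have s2 := hC (x + -ε) (y + -ε)
    have r1 : a * (x + ε) + b * (y + ε) = z + ε := by
      have : a * (x + ε) + b * (y + ε) = z + (a + b) * ε := by rw [hz]; ring
      rw [this, hab, one_mul]
    have r2 : a * (x + -ε) + b * (y + -ε) = z + -ε := by
      have : a * (x + -ε) + b * (y + -ε) = z + (a + b) * (-ε) := by rw [hz]; ring
      rw [this, hab, one_mul]
    rw [r1] at s1
    rw [r2] at s2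
    have tf := abs_le.1 (hf.taylor2 x ε)
    have tf' := abs_le.1 (hf.taylor2 x (-ε))
    have tg := abs_le.1 (hg.taylor2 y ε)
    have tg' := abs_le.1 (hg.taylor2 y (-ε))
    have th := abs_le.1 (hh.taylor2 z ε)
    have th' := abs_le.1 (hh.taylor2 z (-ε))
    simp only [abs_neg, abs_of_pos hε] at tf tf' tg tg' th th'
    have sec : m - 2 * K * ε ^ 3 ≤ h z - a * f x - b * g y +
        ε ^ 2 / 2 * (h2 z - a * f2 x - b * g2 y) := by
      have u1 := mul_le_mul_of_nonneg_left tf.1 ha.le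
      have u2 := mul_le_mul_of_nonneg_left tf'.1 ha.le
      have u3 := mul_le_mul_of_nonneg_left tg.1 hb.le
      have u4 := mul_le_mul_of_nonneg_left tg'.1 hb.le
      have u5 : a * (K * ε ^ 3) + b * (K * ε ^ 3) = K * ε ^ 3 := by rw [← add_mul, hab, one_mul]
      linarith [th.2, th'.2]
    -- first derivatives
    have first : ∀ c : ℝ, ∀ k k1 k2 : ℝ → ℝ, C2 K k k1 k2 → 0 < c → c ≤ 1 → ∀ w,
        (∀ t, m ≤ h z - a * f x - b * g y + (h (z + c * t) - h z) - c * (k (w + t) - k w)) →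
        c * |h1 z - k1 w| ≤ (K1 + 2 * K) * ε := by
      intro c k k1 k2 hk hc hc1 w hw
      have main : ∀ t, |t| = ε → -(c * (h1 z - k1 w) * t) ≤ (K1 + 2 * K) * ε ^ 2 := by
        intro t ht
        have v1 := hw t
        have v2 := (abs_le.1 (hh.taylor1 z (c * t))).2
        have v3 := (abs_le.1 (hk.taylor1 w t)).1
        rw [abs_mul, abs_of_pos hc, ht] at v2
        rw [ht] at v3
        have v4 : K * (c * ε) ^ 2 ≤ K * ε ^ 2 := by
          have : c * ε ≤ ε := mul_le_of_le_one_left hε.le hc1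
          gcongr
        have v5 := mul_le_mul_of_nonneg_left v3 hc.le
        have v6 : c * (K * ε ^ 2) ≤ 1 * (K * ε ^ 2) :=
          mul_le_mul_of_nonneg_right hc1 (by positivity)
        linarith
      have m1 := main ε (abs_of_pos hε)
      have m2 := main (-ε) (by rw [abs_neg, abs_of_pos hε])
      have : c * |h1 z - k1 w| * ε ≤ (K1 + 2 * K) * ε * ε := by
        rcases abs_cases (h1 z - k1 w) with ⟨e, _⟩ | ⟨e, _⟩ <;> rw [e] <;> linarith
      exact le_of_mul_le_mul_right this hε
    have p1 := first a f f1 f2 hf ha ha1 x (fun t => by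
      have := hC (x + t) y
      have e : a * (x + t) + b * y = z + a * t := by rw [hz]; ring
      rw [e] at this
      linarith)
    have p2 := first b g g1 g2 hg hb hb1 y (fun t => by
      have := hC x (y + t)
      have e : a * x + b * (y + t) = z + b * t := by rw [hz]; ring
      rw [e] at this
      linarith)
    have sq : ∀ c s p q : ℝ, 0 < c → |s| ≤ K → |p| ≤ K → |q| ≤ K →
        c * |p - q| ≤ (K1 + 2 * K) * ε →
        c * (s * (p ^ 2 - q ^ 2)) ≤ 2 * K ^ 2 * (K1 + 2 * K) * ε := by
      intro c s p q hc hs hp hq hpq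
      have hpq' : |p + q| ≤ 2 * K := (abs_add_le _ _).trans (by linarith)
      calc c * (s * (p ^ 2 - q ^ 2)) ≤ |c * (s * (p ^ 2 - q ^ 2))| := le_abs_self _
        _ = |s| * |p + q| * (c * |p - q|) := by
          have : c * (s * (p ^ 2 - q ^ 2)) = s * (p + q) * (c * (p - q)) := by ring
          rw [this, abs_mul, abs_mul, abs_mul, abs_of_pos hc]
        _ ≤ K * (2 * K) * ((K1 + 2 * K) * ε) := by gcongr
        _ = _ := by ring
    have q1 := sq a (f x) (h1 z) (f1 x) ha bf bh1 bf1 p1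
    have q2 := sq b (g y) (h1 z) (g1 y) hb bg bh1 bg1 p2
    have q3 : h1 z ^ 2 * (h z - a * f x - b * g y) ≤ K ^ 2 * K1 * ε := by
      have w1 : h z - a * f x - b * g y ≤ K1 * ε := by
        have : K1 * ε ^ 2 ≤ K1 * ε := mul_le_mul_of_nonneg_left (pow_le_of_le_one hε.le hε1 (by norm_num)) hK1n
        linarith
      have w2 : h1 z ^ 2 ≤ K ^ 2 := by rw [← sq_abs]; gcongr
      calc h1 z ^ 2 * (h z - a * f x - b * g y) ≤ h1 z ^ 2 * (K1 * ε) :=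
            mul_le_mul_of_nonneg_left w1 (sq_nonneg _)
        _ ≤ K ^ 2 * (K1 * ε) := mul_le_mul_of_nonneg_right w2 (by positivity)
        _ = _ := by ring
    have q4 : h z * h1 z ^ 2 - a * (f x * f1 x ^ 2) - b * (g y * g1 y ^ 2) ≤ K2 * ε := by
      rw [hK2]; linarith
    have q5 := mul_le_mul_of_nonneg_left q4 (by positivity : 0 ≤ ε ^ 2 / 2)
    have q6 : 0 ≤ K2 * ε ^ 3 := by positivity
    linarith

end

open MeasureTheory Metric Set Filter
open scoped RealInnerProductSpace Topology Pointwise NNReal ENNReal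

noncomputable section

lemma avg_iter_cont {F : ℝ → ℝ} (hF : Continuous F) (ε : ℝ) (k : ℕ) :
    Continuous ((avg ε)^[k] F) := by
  induction k generalizing F with
  | zero => exact hF
  | succ k ih =>
    rw [Function.iterate_succ_apply]; apply ih; unfold avg; fun_prop

/-- Law of the random walk with steps `± ε`. -/
def rwm (ε : ℝ) : ℕ → Measure ℝ
  | 0 => Measure.dirac 0
  | k + 1 => (2⁻¹ : ℝ≥0∞) • ((rwm ε k).map (fun x => x + ε) + (rwm ε k).map (fun x => x - ε))

instance rwm_prob (ε : ℝ) (k : ℕ) : IsProbabilityMeasure (rwm ε k) := by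
  induction k with
  | zero => unfold rwm; infer_instance
  | succ k ih =>
    constructor
    have h1 := Measure.isProbabilityMeasure_map (μ := rwm ε k) (f := fun x => x + ε) (by fun_prop)
    have h2 := Measure.isProbabilityMeasure_map (μ := rwm ε k) (f := fun x => x - ε) (by fun_prop)
    simp only [rwm, Measure.smul_apply, Measure.add_apply, measure_univ, smul_eq_mul]
    rw [one_add_one_eq_two]
    exact ENNReal.inv_mul_cancel (by norm_num) (by norm_num)

lemma rwm_integral_succ {E : Type*} [NormedAddCommGroup E] [NormedSpace ℝ E] [CompleteSpace E]
    {F : ℝ → E} (hF : Continuous F) {B : ℝ} (hB : ∀ x, ‖F x‖ ≤ B) (ε : ℝ) (k : ℕ) :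
    ∫ x, F x ∂(rwm ε (k + 1)) = (2⁻¹ : ℝ) • (∫ x, F (x + ε) ∂(rwm ε k) + ∫ x, F (x - ε) ∂(rwm ε k)) := by
  have i1 : ∀ μ : Measure ℝ, IsProbabilityMeasure μ → Integrable F μ := fun μ _ =>
    Integrable.of_bound hF.aestronglyMeasurable B (Eventually.of_forall hB)
  have h1 := Measure.isProbabilityMeasure_map (μ := rwm ε k) (f := fun x => x + ε) (by fun_prop)
  have h2 := Measure.isProbabilityMeasure_map (μ := rwm ε k) (f := fun x => x - ε) (by fun_prop)
  simp only [rwm]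
  rw [integral_smul_measure, integral_add_measure (i1 _ h1) (i1 _ h2), integral_map (by fun_prop),
    integral_map (by fun_prop)]
  · simp
  · exact hF.aestronglyMeasurable
  · exact hF.aestronglyMeasurable

lemma rwm_integral {F : ℝ → ℝ} (hF : Continuous F) {B : ℝ} (hB : ∀ x, |F x| ≤ B) (ε : ℝ) (k : ℕ) :
    ∫ x, F x ∂(rwm ε k) = (avg ε)^[k] F 0 := by
  induction k generalizing F with
  | zero => simp [rwm]
  | succ k ih =>
    rw [rwm_integral_succ hF hB, Function.iterate_succ_apply, ← ih]
    · have i1 : Integrable (fun x => F (x + ε)) (rwm ε k) :=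
        Integrable.of_bound (by fun_prop) B (Eventually.of_forall fun x => hB _)
      have i2 : Integrable (fun x => F (x - ε)) (rwm ε k) :=
        Integrable.of_bound (by fun_prop) B (Eventually.of_forall fun x => hB _)
      rw [← integral_add i1 i2, smul_eq_mul, ← integral_const_mul]
      congr 1; funext x; unfold avg; ring
    · unfold avg; fun_prop
    · intro x
      have h1 := hB (x + ε); have h2 := hB (x - ε)
      unfold avg
      rw [abs_le] at *; constructor <;> linarith [h1.1, h1.2, h2.1, h2.2]

lemma rwm_charFun (ε : ℝ) (k : ℕ) (t : ℝ) :
    charFun (rwm ε k) t = (Complex.cos (t * ε)) ^ k := by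
  induction k with
  | zero => simp [rwm]
  | succ k ih =>
    have h := rwm_integral_succ (F := fun x : ℝ => Complex.exp (t * x * Complex.I)) (by fun_prop)
      (B := 1) (fun x => by
        rw [← Complex.ofReal_mul, Complex.norm_exp_ofReal_mul_I]) ε k
    rw [charFun_apply_real, h, pow_succ, ← ih, charFun_apply_real, Complex.cos]
    have e1 : ∀ x : ℝ, Complex.exp (t * ((x + ε : ℝ) : ℂ) * Complex.I) =
      Complex.exp (t * x * Complex.I) * Complex.exp (t * ε * Complex.I) := by
      intro x; rw [← Complex.exp_add]; congr 1; push_cast; ring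
    have e2 : ∀ x : ℝ, Complex.exp (t * ((x - ε : ℝ) : ℂ) * Complex.I) =
      Complex.exp (t * x * Complex.I) * Complex.exp (-(t * ε) * Complex.I) := by
      intro x; rw [← Complex.exp_add]; congr 1; push_cast; ring
    simp_rw [e1, e2]
    rw [integral_mul_const, integral_mul_const]
    simp only [Complex.real_smul]
    push_cast
    ring

/-- Bundling. -/
def toPM (μ : Measure ℝ) [h : IsProbabilityMeasure μ] : ProbabilityMeasure ℝ := ⟨μ, h⟩

lemma toPM_coe (μ : Measure ℝ) [IsProbabilityMeasure μ] : (toPM μ : Measure ℝ) = μ := rfl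

lemma rwm_tendsto {F : ℝ → ℝ} (hF : Continuous F) {B : ℝ} (hB : ∀ x, |F x| ≤ B) :
    Tendsto (fun N : ℕ => (avg (Real.sqrt N)⁻¹)^[N] F 0) atTop
      (𝓝 (∫ x, F x ∂(ProbabilityTheory.gaussianReal 0 1))) := by
  have key : Tendsto (β := ProbabilityMeasure ℝ)
      (fun N : ℕ => toPM (rwm (Real.sqrt N)⁻¹ N)) atTop
      (𝓝 (toPM (ProbabilityTheory.gaussianReal 0 1))) := by
    rw [ProbabilityMeasure.tendsto_iff_tendsto_charFun]
    intro t
    simp only [toPM_coe, rwm_charFun, ProbabilityTheory.charFun_gaussianReal]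
    have := ProbabilityTheory.tendsto_charFun_inv_sqrt_mul_pow (X := id) (P := rwm 1 1)
      aemeasurable_id ?_ ?_ t
    · simp only [Measure.map_id, rwm_charFun] at this
      refine (this.congr fun N => ?_).trans_eq ?_
      · congr 2; push_cast; ring_nf
      · congr 2; simp [neg_div]
    · have i0 := integral_dirac (fun x : ℝ => x + 1) (0:ℝ)
      simp only [rwm, Measure.map_dirac' (by fun_prop : Measurable fun x : ℝ => x + 1),
        Measure.map_dirac' (by fun_prop : Measurable fun x : ℝ => x - 1), id]
      rw [integral_smul_measure, integral_add_measure] <;> simp [integrable_dirac]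
    · simp only [rwm, Measure.map_dirac' (by fun_prop : Measurable fun x : ℝ => x + 1),
        Measure.map_dirac' (by fun_prop : Measurable fun x : ℝ => x - 1), Pi.pow_apply, id]
      rw [integral_smul_measure, integral_add_measure] <;> norm_num [integrable_dirac]
  have := (ProbabilityMeasure.tendsto_iff_forall_integral_tendsto.1 key)
    (BoundedContinuousFunction.ofNormedAddCommGroup F hF B hB)
  simp only [toPM_coe, BoundedContinuousFunction.coe_ofNormedAddCommGroup] at this
  exact this.congr fun N => rwm_integral hF hB _ _

end

open MeasureTheory Metric Set Filter
open scoped RealInnerProductSpace Topology Pointwise NNReal ENNReal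

noncomputable section

/-- The Gaussian quasi-mean. -/
def G1 (F : ℝ → ℝ) : ℝ := PhiInv (∫ x, Phi (F x) ∂(ProbabilityTheory.gaussianReal 0 1))

lemma C2_iter {K : ℝ} {u u1 u2 : ℝ → ℝ} (h : C2 K u u1 u2) (ε : ℝ) (k : ℕ) :
    ∃ v1 v2, C2 K ((avg ε)^[k] u) v1 v2 := by
  induction k with
  | zero => exact ⟨u1, u2, h⟩
  | succ k ih =>
    obtain ⟨v1, v2, hv⟩ := ih
    rw [Function.iterate_succ_apply']
    exact ⟨_, _, hv.avg ε⟩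

lemma Rng_iter {a : ℝ} {w : ℝ → ℝ} (h : Rng a w) (ε : ℝ) (k : ℕ) : Rng a ((avg ε)^[k] w) := by
  induction k with
  | zero => exact h
  | succ k ih => rw [Function.iterate_succ_apply']; exact ih.avg ε

lemma flow {a b : ℝ} (ha : 0 < a) (hb : 0 < b) (hab : a + b = 1) {K : ℝ} {f f1 f2 g g1 g2 h h1 h2 : ℝ → ℝ}
    (hf : C2 K f f1 f2) (hg : C2 K g g1 g2) (hh : C2 K h h1 h2)
    (H : ∀ x y, a * f x + b * g y ≤ h (a * x + b * y)) :
    ∃ M, 0 ≤ M ∧ ∀ ε, 0 < ε → ε ≤ 1 → ∀ k : ℕ, ∀ x y,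
      -(k * (M * ε ^ 3)) ≤ PhiInv ((avg ε)^[k] (fun x => Phi (h x)) (a * x + b * y)) -
        a * PhiInv ((avg ε)^[k] (fun x => Phi (f x)) x) -
        b * PhiInv ((avg ε)^[k] (fun x => Phi (g x)) y) := by
  obtain ⟨K1, hK1⟩ := C2.Phi_comp K
  obtain ⟨L, hL⟩ := C2.PhiInv_comp K1 K
  obtain ⟨M, hM, hexp⟩ := step_expand L
  have reg : ∀ u u1 u2 : ℝ → ℝ, C2 K u u1 u2 → ∀ ε k, ∃ v1 v2,
      C2 L (fun x => PhiInv ((avg ε)^[k] (fun x => Phi (u x)) x)) v1 v2 := by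
    intro u u1 u2 hu ε k
    obtain ⟨v1, v2, hv⟩ := C2_iter (hK1 u u1 u2 hu) ε k
    exact hL _ _ _ hv (Rng_iter (Rng_of_abs hu.b0.bd) ε k)
  have hLn : 0 ≤ L := by
    obtain ⟨v1, v2, hv⟩ := reg f f1 f2 hf 0 0
    exact hv.b0.nonneg
  have stp : ∀ u u1 u2 : ℝ → ℝ, C2 K u u1 u2 → ∀ (ε : ℝ) (k : ℕ),
      (avg ε)^[k+1] (fun x => Phi (u x)) =
      avg ε (fun x => Phi (PhiInv ((avg ε)^[k] (fun x => Phi (u x)) x))) := by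
    intro u u1 u2 hu ε k
    rw [Function.iterate_succ_apply']
    congr 1
    funext x
    have hr := Rng_iter (Rng_of_abs hu.b0.bd) ε k
    rw [Phi_PhiInv (hr.pos x) (hr.lt_one x)]
  obtain ⟨M', hM', hmax⟩ := step_max ha hb hab hLn hM
  refine ⟨M', hM', fun ε hε hε1 k => ?_⟩
  induction k with
  | zero =>
    intro x y
    simp only [Function.iterate_zero, id, PhiInv_Phi]
    have := H x y
    simp only [Nat.cast_zero, zero_mul, neg_zero]
    linarith
  | succ k ih =>
    intro x y
    obtain ⟨fv1, fv2, hfv⟩ := reg f f1 f2 hf ε k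
    obtain ⟨gv1, gv2, hgv⟩ := reg g g1 g2 hg ε k
    obtain ⟨hv1, hv2, hhv⟩ := reg h h1 h2 hh ε k
    have := hmax _ _ _ _ _ _ _ _ _
      (fun x => PhiInv ((avg ε)^[k+1] (fun x => Phi (f x)) x))
      (fun x => PhiInv ((avg ε)^[k+1] (fun x => Phi (g x)) x))
      (fun x => PhiInv ((avg ε)^[k+1] (fun x => Phi (h x)) x))
      hfv hgv hhv ε hε hε1
      (fun x => by rw [stp f f1 f2 hf]; exact hexp _ _ _ hfv ε hε hε1 x)
      (fun x => by rw [stp g g1 g2 hg]; exact hexp _ _ _ hgv ε hε hε1 x)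
      (fun x => by rw [stp h h1 h2 hh]; exact hexp _ _ _ hhv ε hε hε1 x)
      (-(k * (M' * ε ^ 3))) (neg_nonpos.2 (by positivity)) ih x y
    push_cast
    linarith

lemma Phi_int_mem {K : ℝ} {F : ℝ → ℝ} (hF : Continuous F) (hb : ∀ x, |F x| ≤ K)
    {X : Type*} [MeasurableSpace X] {P : Measure X} [IsProbabilityMeasure P] {T : X → ℝ}
    (hT : Measurable T) :
    Phi (-K) ≤ ∫ x, Phi (F (T x)) ∂P ∧ ∫ x, Phi (F (T x)) ∂P ≤ Phi K := by
  have hr := Rng_of_abs hb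
  have hm : Measurable fun x => Phi (F (T x)) := (Phi_cont.comp hF).measurable.comp hT
  have hi : Integrable (fun x => Phi (F (T x))) P :=
    Integrable.of_bound hm.aestronglyMeasurable 1 (Eventually.of_forall fun x => by
      rw [Real.norm_eq_abs, abs_of_pos (Phi_pos _)]; exact (Phi_lt_one _).le)
  constructor
  · have := integral_mono (μ := P) (integrable_const (Phi (-K))) hi (fun x => (hr (T x)).1)
    simpa using this
  · have := integral_mono (μ := P) hi (integrable_const (Phi K)) (fun x => (hr (T x)).2)
    simpa using this

lemma ehrhard1_C2 {a b : ℝ} (ha : 0 < a) (hb : 0 < b) (hab : a + b = 1) {K : ℝ}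
    {f f1 f2 g g1 g2 h h1 h2 : ℝ → ℝ}
    (hf : C2 K f f1 f2) (hg : C2 K g g1 g2) (hh : C2 K h h1 h2)
    (H : ∀ x y, a * f x + b * g y ≤ h (a * x + b * y)) : a * G1 f + b * G1 g ≤ G1 h := by
  obtain ⟨M, hM, hfl⟩ := flow ha hb hab hf hg hh H
  have cont : ∀ u u1 u2 : ℝ → ℝ, C2 K u u1 u2 → Tendsto (fun N : ℕ =>
      PhiInv ((avg (Real.sqrt N)⁻¹)^[N] (fun x => Phi (u x)) 0)) atTop (𝓝 (G1 u)) := by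
    intro u u1 u2 hu
    have hc : Continuous u := continuous_iff_continuousAt.2 fun x => (hu.d1 x).continuousAt
    have := rwm_tendsto (F := fun x => Phi (u x)) (Phi_cont.comp hc) (B := 1) (fun x => by
      rw [abs_of_pos (Phi_pos _)]; exact (Phi_lt_one _).le)
    have hm := Phi_int_mem hc hu.b0.bd (P := ProbabilityTheory.gaussianReal 0 1) measurable_id
    exact (PhiInv_contAt ((Phi_pos _).trans_le hm.1) (hm.2.trans_lt (Phi_lt_one _))).tendsto.comp this
  have t := ((cont h h1 h2 hh).sub ((cont f f1 f2 hf).const_mul a)).sub ((cont g g1 g2 hg).const_mul b)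
  have t0 : Tendsto (fun N : ℕ => -(M * (Real.sqrt N)⁻¹)) atTop (𝓝 0) := by
    have : Tendsto (fun N : ℕ => (Real.sqrt N)⁻¹) atTop (𝓝 0) :=
      tendsto_inv_atTop_zero.comp (Real.tendsto_sqrt_atTop.comp tendsto_natCast_atTop_atTop)
    simpa using (this.const_mul M).neg
  have := le_of_tendsto_of_tendsto t0 t (by
    filter_upwards [eventually_ge_atTop 1] with N hN
    have hN' : (1:ℝ) ≤ N := by exact_mod_cast hN
    have hs : 1 ≤ Real.sqrt N := Real.one_le_sqrt.2 hN'
    have hs0 : 0 < Real.sqrt N := by linarith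
    have := hfl (Real.sqrt N)⁻¹ (by positivity) (inv_le_one_of_one_le₀ hs) N 0 0
    simp only [mul_zero, add_zero] at this
    refine le_trans (le_of_eq ?_) this
    have e : (N : ℝ) = Real.sqrt N ^ 2 := (Real.sq_sqrt (by linarith)).symm
    rw [neg_inj]
    generalize hS : Real.sqrt N = S at *
    rw [e]; field_simp)
  linarith

/-- Box average. -/
def box (δ : ℝ) (u : ℝ → ℝ) : ℝ → ℝ := fun x => δ⁻¹ * ∫ s in (0:ℝ)..δ, u (x + s)

lemma box_deriv {δ : ℝ} {u : ℝ → ℝ} (hu : Continuous u) (x : ℝ) :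
    HasDerivAt (box δ u) (δ⁻¹ * (u (x + δ) - u x)) x := by
  have e : box δ u = fun x => δ⁻¹ * ((∫ s in (0:ℝ)..(x + δ), u s) - ∫ s in (0:ℝ)..x, u s) := by
    funext x
    unfold box
    rw [intervalIntegral.integral_comp_add_left]
    rw [intervalIntegral.integral_interval_sub_left (hu.intervalIntegrable _ _)
      (hu.intervalIntegrable _ _), add_zero]
  rw [e]
  have d : ∀ y, HasDerivAt (fun y => ∫ s in (0:ℝ)..y, u s) (u y) y := fun y =>
    intervalIntegral.integral_hasDerivAt_right (hu.intervalIntegrable _ _)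
    (hu.stronglyMeasurableAtFilter _ _) hu.continuousAt
  exact (((d (x + δ)).comp_add_const x δ).sub (d x)).const_mul _

lemma box_cont {δ : ℝ} {u : ℝ → ℝ} (hu : Continuous u) : Continuous (box δ u) :=
  continuous_iff_continuousAt.2 fun x => (box_deriv hu x).continuousAt

lemma box_le {δ : ℝ} (hδ : 0 < δ) {u v : ℝ → ℝ} (hu : Continuous u) (hv : Continuous v) {x y : ℝ}
    (h : ∀ s ∈ Icc 0 δ, u (x + s) ≤ v (y + s)) : box δ u x ≤ box δ v y := by
  unfold box
  refine mul_le_mul_of_nonneg_left ?_ (by positivity)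
  exact intervalIntegral.integral_mono_on hδ.le ((by fun_prop : Continuous fun s => u (x + s)).intervalIntegrable _ _)
    ((by fun_prop : Continuous fun s => v (y + s)).intervalIntegrable _ _) h

lemma box_const {δ : ℝ} (hδ : 0 < δ) (c x : ℝ) : box δ (fun _ => c) x = c := by
  unfold box; simp; field_simp

lemma box_near {δ : ℝ} (hδ : 0 < δ) {u : ℝ → ℝ} (hu : Continuous u) {c e x : ℝ} {r : ℝ}
    (h : ∀ y ∈ Icc x (x + (r + δ)), |u y - c| ≤ e) : ∀ y ∈ Icc x (x + r), |box δ u y - c| ≤ e := by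
  intro y hy
  rw [abs_le]
  constructor
  · have := box_le hδ (x := y) (y := y) (continuous_const (y := c - e)) hu (fun s hs => by
      have := (abs_le.1 (h (y + s) ⟨by linarith [hy.1, hs.1], by linarith [hy.2, hs.2]⟩)).1
      linarith)
    rw [box_const hδ] at this; linarith
  · have := box_le hδ (x := y) (y := y) hu (continuous_const (y := c + e)) (fun s hs => by
      have := (abs_le.1 (h (y + s) ⟨by linarith [hy.1, hs.1], by linarith [hy.2, hs.2]⟩)).2
      linarith)
    rw [box_const hδ] at this; linarith

lemma box_bd {δ : ℝ} (hδ : 0 < δ) {u : ℝ → ℝ} (hu : Continuous u) {K : ℝ} (h : ∀ x, |u x| ≤ K) (x : ℝ) :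
    |box δ u x| ≤ K := by
  have := box_near hδ hu (c := 0) (e := K) (x := x) (r := 0) (fun y _ => by simpa using h y) x (by simp)
  simpa using this

lemma box_ineq {a b : ℝ} (hab : a + b = 1) {δ : ℝ} (hδ : 0 < δ) {f g h : ℝ → ℝ}
    (hf : Continuous f) (hg : Continuous g) (hh : Continuous h)
    (H : ∀ x y, a * f x + b * g y ≤ h (a * x + b * y)) (x y : ℝ) :
    a * box δ f x + b * box δ g y ≤ box δ h (a * x + b * y) := by
  have e : a * box δ f x + b * box δ g y = δ⁻¹ * ∫ s in (0:ℝ)..δ, (a * f (x + s) + b * g (y + s)) := by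
    rw [intervalIntegral.integral_add ((by fun_prop : Continuous fun s => a * f (x + s)).intervalIntegrable _ _)
      ((by fun_prop : Continuous fun s => b * g (y + s)).intervalIntegrable _ _),
      intervalIntegral.integral_const_mul, intervalIntegral.integral_const_mul]
    unfold box; ring
  rw [e]
  unfold box
  refine mul_le_mul_of_nonneg_left ?_ (by positivity)
  refine intervalIntegral.integral_mono_on hδ.le
    ((by fun_prop : Continuous fun s => a * f (x + s) + b * g (y + s)).intervalIntegrable _ _)
    ((by fun_prop : Continuous fun s => h (a * x + b * y + s)).intervalIntegrable _ _) (fun s _ => ?_)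
  have := H (x + s) (y + s)
  have e2 : a * (x + s) + b * (y + s) = a * x + b * y + s := by
    linear_combination s * hab
  rwa [e2] at this

lemma diff_BL {δ K : ℝ} (hδ : 0 < δ) {u : ℝ → ℝ} (h : BL K u) :
    BL (2 * δ⁻¹ * K) (fun x => δ⁻¹ * (u (x + δ) - u x)) := by
  have hi : 0 < δ⁻¹ := inv_pos.2 hδ
  constructor
  · intro x
    rw [abs_mul, abs_of_pos hi]
    have : |u (x + δ) - u x| ≤ 2 * K := by
      have h1 := abs_le.1 (h.bd (x + δ)); have h2 := abs_le.1 (h.bd x)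
      rw [abs_le]; constructor <;> linarith [h1.1, h1.2, h2.1, h2.2]
    nlinarith
  · intro x y
    have e : δ⁻¹ * (u (x + δ) - u x) - δ⁻¹ * (u (y + δ) - u y) =
      δ⁻¹ * ((u (x + δ) - u (y + δ)) - (u x - u y)) := by ring
    rw [e, abs_mul, abs_of_pos hi]
    have : |(u (x + δ) - u (y + δ)) - (u x - u y)| ≤ 2 * K * |x - y| := by
      have h1 := abs_le.1 (h.lip (x + δ) (y + δ)); have h2 := abs_le.1 (h.lip x y)
      rw [add_sub_add_right_eq_sub] at h1
      rw [abs_le]; constructor <;> linarith [h1.1, h1.2, h2.1, h2.2]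
    nlinarith

lemma box3_C2 {δ : ℝ} (hδ : 0 < δ) (K : ℝ) : ∃ L, ∀ u : ℝ → ℝ, Continuous u → (∀ x, |u x| ≤ K) →
    ∃ v1 v2, C2 L (box δ (box δ (box δ u))) v1 v2 := by
  have hi : 0 < δ⁻¹ := inv_pos.2 hδ
  let B := max K (2 * δ⁻¹ * K)
  refine ⟨max B (max (2 * δ⁻¹ * B) (2 * δ⁻¹ * (2 * δ⁻¹ * B))), fun u hu hb => ?_⟩
  have key : ∀ u : ℝ → ℝ, Continuous u → (∀ x, |u x| ≤ K) → BL B (box δ u) := by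
    intro u hu hb
    refine BL_of_deriv (fun x => box_deriv hu x) (box_bd hδ hu hb) (fun x => ?_)
    rw [abs_mul, abs_of_pos hi]
    have : |u (x + δ) - u x| ≤ 2 * K := by
      have h1 := abs_le.1 (hb (x + δ)); have h2 := abs_le.1 (hb x)
      rw [abs_le]; constructor <;> linarith [h1.1, h1.2, h2.1, h2.2]
    nlinarith
  have c1 := box_cont (δ := δ) hu
  have b1 := box_bd hδ hu hb
  have c2 := box_cont (δ := δ) c1
  have b2 := box_bd hδ c1 b1
  refine ⟨fun x => δ⁻¹ * (box δ (box δ u) (x + δ) - box δ (box δ u) x),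
    fun x => δ⁻¹ * (δ⁻¹ * (box δ u (x + δ + δ) - box δ u (x + δ)) - δ⁻¹ * (box δ u (x + δ) - box δ u x)),
    fun x => box_deriv c2 x, fun x => ?_, (key _ c2 b2).mono (le_max_left _ _),
    (diff_BL hδ (key _ c1 b1)).mono ((le_max_left _ _).trans (le_max_right _ _)),
    (diff_BL hδ (diff_BL hδ (key u hu hb))).mono ((le_max_right _ _).trans (le_max_right _ _))⟩
  exact (((box_deriv c1 (x + δ)).comp_add_const x δ).sub (box_deriv c1 x)).const_mul _

lemma box3_tendsto {u : ℝ → ℝ} (hu : Continuous u) (x : ℝ) :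
    Tendsto (fun δ => box δ (box δ (box δ u)) x) (𝓝[>] 0) (𝓝 (u x)) := by
  rw [Metric.tendsto_nhds]
  intro e he
  obtain ⟨r, hr, hr'⟩ := Metric.continuous_iff.1 hu x (e / 2) (by linarith)
  have hmem : Ioo 0 (r / 3) ∈ 𝓝[>] (0:ℝ) := Ioo_mem_nhdsGT (by linarith)
  filter_upwards [hmem] with δ hδ
  have h0 : ∀ y ∈ Icc x (x + (0 + δ + δ + δ)), |u y - u x| ≤ e / 2 := by
    intro y hy
    have := hr' y (by rw [Real.dist_eq, abs_lt]; constructor <;> linarith [hy.1, hy.2, hδ.2, hδ.1])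
    exact this.le
  have c1 := box_cont (δ := δ) hu
  have c2 := box_cont (δ := δ) c1
  have h1 := box_near hδ.1 hu h0
  have h2 := box_near hδ.1 c1 h1
  have h3 := box_near hδ.1 c2 h2 x (by simp)
  rw [Real.dist_eq]; linarith

lemma ehrhard1 {a b : ℝ} (ha : 0 < a) (hb : 0 < b) (hab : a + b = 1) {K : ℝ}
    {f g h : ℝ → ℝ} (hf : Continuous f) (hg : Continuous g) (hh : Continuous h)
    (bf : ∀ x, |f x| ≤ K) (bg : ∀ x, |g x| ≤ K) (bh : ∀ x, |h x| ≤ K)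
    (H : ∀ x y, a * f x + b * g y ≤ h (a * x + b * y)) : a * G1 f + b * G1 g ≤ G1 h := by
  have cont : ∀ u : ℝ → ℝ, Continuous u → (∀ x, |u x| ≤ K) → Tendsto (fun δ =>
      G1 (box δ (box δ (box δ u)))) (𝓝[>] 0) (𝓝 (G1 u)) := by
    intro u hu hb
    have hm := Phi_int_mem hu hb (P := ProbabilityTheory.gaussianReal 0 1) measurable_id
    refine (PhiInv_contAt ((Phi_pos _).trans_le hm.1) (hm.2.trans_lt (Phi_lt_one _))).tendsto.comp ?_
    refine tendsto_integral_filter_of_dominated_convergence (fun _ => (1:ℝ)) ?_ ?_ (integrable_const _) ?_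
    · refine Eventually.of_forall fun δ => Continuous.aestronglyMeasurable ?_
      exact Phi_cont.comp (box_cont (box_cont (box_cont hu)))
    · refine Eventually.of_forall fun δ => Eventually.of_forall fun x => ?_
      rw [Real.norm_eq_abs, abs_of_pos (Phi_pos _)]; exact (Phi_lt_one _).le
    · refine Eventually.of_forall fun x => ?_
      exact (Phi_cont.tendsto _).comp (box3_tendsto hu x)
  refine le_of_tendsto_of_tendsto (((cont f hf bf).const_mul a).add ((cont g hg bg).const_mul b))
    (cont h hh bh) ?_
  filter_upwards [self_mem_nhdsWithin] with δ hδ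
  have hδ : 0 < δ := hδ
  obtain ⟨L, hL⟩ := box3_C2 hδ K
  obtain ⟨_, _, rf⟩ := hL f hf bf
  obtain ⟨_, _, rg⟩ := hL g hg bg
  obtain ⟨_, _, rh⟩ := hL h hh bh
  exact ehrhard1_C2 ha hb hab rf rg rh (box_ineq hab hδ (box_cont (box_cont hf))
    (box_cont (box_cont hg)) (box_cont (box_cont hh)) (box_ineq hab hδ (box_cont hf)
    (box_cont hg) (box_cont hh) (box_ineq hab hδ hf hg hh H)))

end

open MeasureTheory Metric Set Filter
open scoped RealInnerProductSpace Topology Pointwise NNReal ENNReal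

noncomputable section

/-- Standard Gaussian product measure. -/
def gpi (n : ℕ) : Measure (Fin n → ℝ) := Measure.pi fun _ => ProbabilityTheory.gaussianReal 0 1

instance (n : ℕ) : IsProbabilityMeasure (gpi n) := by unfold gpi; infer_instance

/-- Gaussian quasi-mean in dimension `n`. -/
def Gn (n : ℕ) (F : (Fin n → ℝ) → ℝ) : ℝ := PhiInv (∫ x, Phi (F x) ∂(gpi n))

lemma Phi_int_mem' {X : Type*} [MeasurableSpace X] {P : Measure X} [IsProbabilityMeasure P]
    {K : ℝ} {F : X → ℝ} (hF : Measurable F) (hb : ∀ x, |F x| ≤ K) :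
    Phi (-K) ≤ ∫ x, Phi (F x) ∂P ∧ ∫ x, Phi (F x) ∂P ≤ Phi K := by
  have hm : Measurable fun x => Phi (F x) := Phi_cont.measurable.comp hF
  have hi : Integrable (fun x => Phi (F x)) P :=
    Integrable.of_bound hm.aestronglyMeasurable 1 (Eventually.of_forall fun x => by
      rw [Real.norm_eq_abs, abs_of_pos (Phi_pos _)]; exact (Phi_lt_one _).le)
  constructor
  · have := integral_mono (μ := P) (integrable_const (Phi (-K))) hi
      (fun x => Phi_strictMono.monotone (abs_le.1 (hb x)).1)
    simpa using this
  · have := integral_mono (μ := P) hi (integrable_const (Phi K))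
      (fun x => Phi_strictMono.monotone (abs_le.1 (hb x)).2)
    simpa using this

lemma cons_cont {n : ℕ} : Continuous (fun p : ℝ × (Fin n → ℝ) => (Fin.cons p.1 p.2 : Fin (n+1) → ℝ)) := by
  refine continuous_pi fun i => ?_
  refine Fin.cases ?_ (fun j => ?_) i
  · simpa using continuous_fst
  · simp only [Fin.cons_succ]; fun_prop

lemma gpi_succ {n : ℕ} {F : (Fin (n+1) → ℝ) → ℝ} (hF : Continuous F) {K : ℝ} (hb : ∀ x, |F x| ≤ K) :
    ∫ x, F x ∂(gpi (n+1)) = ∫ y, ∫ s, F (Fin.cons s y) ∂(ProbabilityTheory.gaussianReal 0 1) ∂(gpi n) := by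
  have h := (measurePreserving_piFinSuccAbove (fun _ : Fin (n+1) => ProbabilityTheory.gaussianReal 0 1) 0).symm
  have h2 := h.integral_comp (MeasurableEquiv.measurableEmbedding _) F
  unfold gpi
  rw [← h2, integral_prod_symm]
  · have e : ∀ (x : ℝ) (y : Fin n → ℝ), (MeasurableEquiv.piFinSuccAbove (fun _ : Fin (n+1) => ℝ) 0).symm (x, y) =
        (Fin.cons x y : Fin (n+1) → ℝ) := by
      intro x y
      funext i
      refine Fin.cases ?_ (fun j => ?_) i <;> rfl
    simp_rw [e]
  · refine Integrable.of_bound (C := K) ?_ (Eventually.of_forall fun x => hb _)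
    exact (hF.measurable.comp (MeasurableEquiv.measurable _)).aestronglyMeasurable

lemma ehrhard_n {a b : ℝ} (ha : 0 < a) (hb : 0 < b) (hab : a + b = 1) {K : ℝ} (n : ℕ) :
    ∀ {f g h : (Fin n → ℝ) → ℝ} (hf : Continuous f) (hg : Continuous g) (hh : Continuous h)
    (bf : ∀ x, |f x| ≤ K) (bg : ∀ x, |g x| ≤ K) (bh : ∀ x, |h x| ≤ K)
    (H : ∀ x y, a * f x + b * g y ≤ h (a • x + b • y)), a * Gn n f + b * Gn n g ≤ Gn n h := by
  induction n with
  | zero =>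
    intro f g h hf hg hh bf bg bh H
    have e : ∀ u : (Fin 0 → ℝ) → ℝ, Gn 0 u = u 0 := by
      intro u
      unfold Gn
      have : ∀ x, Phi (u x) = Phi (u 0) := fun x => by rw [Subsingleton.elim x 0]
      simp only [this, integral_const, probReal_univ, one_smul, PhiInv_Phi]
    rw [e, e, e]
    have := H 0 0
    rwa [Subsingleton.elim (a • (0 : Fin 0 → ℝ) + b • 0) 0] at this
  | succ n ih =>
    intro f g h hf hg hh bf bg bh H
    have key : ∀ u : (Fin (n+1) → ℝ) → ℝ, Continuous u → (∀ x, |u x| ≤ K) →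
        Continuous (fun y => G1 (fun s => u (Fin.cons s y))) ∧ (∀ y, |G1 (fun s => u (Fin.cons s y))| ≤ K) ∧
        Gn (n+1) u = Gn n (fun y => G1 (fun s => u (Fin.cons s y))) := by
      intro u hu bu
      have mem : ∀ y : Fin n → ℝ, _ := fun y => Phi_int_mem' (P := ProbabilityTheory.gaussianReal 0 1)
        (F := fun s => u (Fin.cons s y))
        ((hu.comp (cons_cont.comp (Continuous.prodMk_left y))).measurable) (fun s => bu _)
      refine ⟨?_, ?_, ?_⟩
      · refine continuous_iff_continuousAt.2 fun y => ?_
        refine ContinuousAt.comp (g := PhiInv) (PhiInv_contAt ((Phi_pos _).trans_le (mem y).1)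
          ((mem y).2.trans_lt (Phi_lt_one _))) ?_
        refine Continuous.continuousAt ?_
        refine continuous_of_dominated (bound := fun _ => (1:ℝ)) ?_ ?_ (integrable_const _) ?_
        · intro y
          exact (Phi_cont.comp (hu.comp (cons_cont.comp (Continuous.prodMk_left y)))).aestronglyMeasurable
        · refine fun y => Eventually.of_forall fun x => ?_
          rw [Real.norm_eq_abs, abs_of_pos (Phi_pos _)]; exact (Phi_lt_one _).le
        · refine Eventually.of_forall fun s => ?_
          exact Phi_cont.comp (hu.comp (cons_cont.comp (Continuous.prodMk_right s)))
      · intro y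
        have h0 := ((Phi_pos _).trans_le (mem y).1)
        have h1 := ((mem y).2.trans_lt (Phi_lt_one _))
        rw [abs_le]
        constructor
        · exact (PhiInv_le_iff h0 h1).2 (mem y).1
        · rw [← Phi_strictMono.le_iff_le]; unfold G1; rw [Phi_PhiInv h0 h1]; exact (mem y).2
      · unfold Gn
        rw [gpi_succ (F := fun x => Phi (u x)) (Phi_cont.comp hu) (K := 1)
          (fun x => by rw [abs_of_pos (Phi_pos _)]; exact (Phi_lt_one _).le)]
        congr 2
        funext y
        unfold G1
        rw [Phi_PhiInv ((Phi_pos _).trans_le (mem y).1) ((mem y).2.trans_lt (Phi_lt_one _))]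
    obtain ⟨cf, cbf, ef⟩ := key f hf bf
    obtain ⟨cg, cbg, eg⟩ := key g hg bg
    obtain ⟨ch, cbh, eh⟩ := key h hh bh
    rw [ef, eg, eh]
    refine ih cf cg ch cbf cbg cbh (fun x y => ?_)
    refine ehrhard1 ha hb hab (K := K) (hf.comp (cons_cont.comp (Continuous.prodMk_left x)))
      (hg.comp (cons_cont.comp (Continuous.prodMk_left y)))
      (hh.comp (cons_cont.comp (Continuous.prodMk_left (a • x + b • y)))) (fun _ => bf _) (fun _ => bg _)
      (fun _ => bh _) (fun s t => ?_)
    have := H (Fin.cons s x) (Fin.cons t y)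
    have e : (a • (Fin.cons s x : Fin (n+1) → ℝ) + b • (Fin.cons t y : Fin (n+1) → ℝ)) =
        Fin.cons (a * s + b * t) (a • x + b • y) := by
      funext i
      refine Fin.cases ?_ (fun j => ?_) i <;> simp
    rwa [e] at this

lemma lintegral_prod_pi (n : ℕ) (f : Fin n → ℝ → ℝ≥0∞) (hf : ∀ i, Measurable (f i)) :
    ∫⁻ x : Fin n → ℝ, ∏ i, f i (x i) = ∏ i, ∫⁻ t, f i t := by
  induction n with
  | zero => simp [volume_pi, Measure.pi_of_empty]
  | succ n ih =>
    have h := (volume_preserving_piFinSuccAbove (fun _ : Fin (n+1) => ℝ) 0).symm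
    rw [← h.lintegral_comp_emb (MeasurableEquiv.measurableEmbedding _)]
    have e : ∀ p : ℝ × (Fin n → ℝ), ∏ i, f i ((MeasurableEquiv.piFinSuccAbove (fun _ : Fin (n+1) => ℝ) 0).symm p i)
        = f 0 p.1 * ∏ i, f (Fin.succ i) (p.2 i) := by
      intro p
      rw [Fin.prod_univ_succ]
      congr 1
    simp_rw [e]
    have := lintegral_prod_mul (μ := (volume : Measure ℝ)) (ν := (volume : Measure (Fin n → ℝ)))
      (f := f 0) (g := fun y => ∏ i, f (Fin.succ i) (y i)) (hf 0).aemeasurable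
      (Finset.measurable_prod _ fun i _ => (hf _).comp (measurable_pi_apply i)).aemeasurable
    refine this.trans ?_
    rw [ih _ (fun i => hf _), Fin.prod_univ_succ]

lemma gpi_eq (n : ℕ) : gpi n = volume.withDensity (fun x => ENNReal.ofReal (∏ i, ph (x i))) := by
  unfold gpi
  refine Measure.pi_eq (fun s hs => ?_)
  rw [withDensity_apply _ (MeasurableSet.univ_pi hs), ← lintegral_indicator (MeasurableSet.univ_pi hs)]
  have e : ∀ x : Fin n → ℝ, (univ.pi s).indicator (fun x => ENNReal.ofReal (∏ i, ph (x i))) x =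
      ∏ i, (s i).indicator (fun t => ENNReal.ofReal (ph t)) (x i) := by
    intro x
    classical
    rw [Set.indicator_apply]
    split_ifs with h
    · rw [ENNReal.ofReal_prod_of_nonneg (fun i _ => (ph_pos _).le)]
      refine Finset.prod_congr rfl fun i _ => ?_
      rw [Set.indicator_of_mem (h i (mem_univ i))]
    · simp only [mem_univ_pi, not_forall] at h
      obtain ⟨i, hi⟩ := h
      refine (Finset.prod_eq_zero (Finset.mem_univ i) ?_).symm
      rw [Set.indicator_of_notMem hi]
  simp_rw [e]
  rw [lintegral_prod_pi n _ (fun i => (by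
    exact (ENNReal.measurable_ofReal.comp ph_cont.measurable).indicator (hs i)))]
  refine Finset.prod_congr rfl fun i _ => ?_
  rw [lintegral_indicator (hs i), ProbabilityTheory.gaussianReal_of_var_ne_zero 0 one_ne_zero,
    withDensity_apply _ (hs i)]
  simp_rw [ProbabilityTheory.gaussianPDF, ← ph_eq_pdf]

/-- Gaussian density in dimension `n`. -/
def gd (n : ℕ) (x : Eu n) : ℝ := (Real.sqrt (2 * Real.pi))⁻¹ ^ n * Real.exp (-‖x‖ ^ 2 / 2)

lemma gd_pos {n : ℕ} (x : Eu n) : 0 < gd n x := by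
  have := sqrt2pi_pos
  unfold gd; positivity

lemma gd_cont {n : ℕ} : Continuous (gd n) := by unfold gd; fun_prop

lemma gd_prod {n : ℕ} (x : Fin n → ℝ) : gd n (WithLp.toLp 2 x) = ∏ i, ph (x i) := by
  unfold gd ph
  rw [Finset.prod_mul_distrib, ← Real.exp_sum, EuclideanSpace.norm_sq_eq]
  simp only [Finset.prod_const, Finset.card_univ, Fintype.card_fin]
  congr 2
  rw [← Finset.sum_neg_distrib, Finset.sum_div]
  simp

/-- Gaussian measure on `Eu n`. -/
def gm (n : ℕ) : Measure (Eu n) := volume.withDensity (fun x => ENNReal.ofReal (gd n x))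

lemma gm_map (n : ℕ) : MeasurePreserving (WithLp.toLp 2 : (Fin n → ℝ) → Eu n) (gpi n) (gm n) := by
  have h := PiLp.volume_preserving_toLp (Fin n)
  refine ⟨h.measurable, ?_⟩
  ext s hs
  rw [Measure.map_apply h.measurable hs, gpi_eq, gm, withDensity_apply _ hs,
    withDensity_apply _ (h.measurable hs), ← h.setLIntegral_comp_preimage hs (by
      exact ENNReal.measurable_ofReal.comp gd_cont.measurable)]
  simp_rw [gd_prod]

instance gm_prob (n : ℕ) : IsProbabilityMeasure (gm n) :=
  by
  rw [← (gm_map n).map_eq]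
  exact Measure.isProbabilityMeasure_map (gm_map n).measurable.aemeasurable

lemma gd_integrable (n : ℕ) : Integrable (gd n) := by
  have := (measure_lt_top (gm n) univ)
  rw [gm, withDensity_apply _ MeasurableSet.univ, Measure.restrict_univ] at this
  refine ⟨gd_cont.aestronglyMeasurable, ?_⟩
  rw [hasFiniteIntegral_iff_ofReal (Eventually.of_forall fun x => (gd_pos x).le)]
  exact this

lemma gaussVol_eq {n : ℕ} {A : Set (Eu n)} (hA : MeasurableSet A) : gaussVol n A = (gm n A).toReal := by
  have h : gaussVol n A = ∫ x in A, gd n x := by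
    unfold gaussVol gd; rw [integral_const_mul]
  rw [h, gm, withDensity_apply _ hA, integral_eq_lintegral_of_nonneg_ae
    (Eventually.of_forall fun x => (gd_pos x).le) gd_cont.aestronglyMeasurable]

lemma gm_integral {n : ℕ} {F : Eu n → ℝ} : ∫ x, F (WithLp.toLp 2 x) ∂(gpi n) = ∫ x, F x ∂(gm n) :=
  (gm_map n).integral_comp (MeasurableEquiv.toLp 2 (Fin n → ℝ)).measurableEmbedding F

end

open MeasureTheory Metric Set Filter
open scoped RealInnerProductSpace Topology Pointwise NNReal ENNReal

noncomputable section

lemma ehrhard_Eu {n : ℕ} {a b : ℝ} (ha : 0 < a) (hb : 0 < b) (hab : a + b = 1) {K : ℝ}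
    {f g h : Eu n → ℝ} (hf : Continuous f) (hg : Continuous g) (hh : Continuous h)
    (bf : ∀ x, |f x| ≤ K) (bg : ∀ x, |g x| ≤ K) (bh : ∀ x, |h x| ≤ K)
    (H : ∀ x y, a * f x + b * g y ≤ h (a • x + b • y)) :
    a * PhiInv (∫ x, Phi (f x) ∂(gm n)) + b * PhiInv (∫ x, Phi (g x) ∂(gm n)) ≤
      PhiInv (∫ x, Phi (h x) ∂(gm n)) := by
  have hc : Continuous (WithLp.toLp 2 : (Fin n → ℝ) → Eu n) := PiLp.continuous_toLp 2 _
  have := ehrhard_n ha hb hab n (hf.comp hc) (hg.comp hc) (hh.comp hc) (fun _ => bf _) (fun _ => bg _)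
    (fun _ => bh _) (fun x y => H _ _)
  unfold Gn at this
  simp only [Function.comp] at this
  rw [gm_integral (F := fun x => Phi (f x)), gm_integral (F := fun x => Phi (g x)),
    gm_integral (F := fun x => Phi (h x))] at this
  exact this

/-- Approximating functions. -/
def wk {n : ℕ} (K : Set (Eu n)) (c k : ℝ) (x : Eu n) : ℝ := max (-(c * k)) (k - k ^ 2 * infDist x K)

lemma wk_cont {n : ℕ} (K : Set (Eu n)) (c k : ℝ) : Continuous (wk K c k) := by
  unfold wk
  have := continuous_infDist_pt K
  fun_prop

lemma wk_bd {n : ℕ} (K : Set (Eu n)) {c k C : ℝ} (hc : 1 ≤ c) (hk : 0 ≤ k) (hC : c ≤ C) (x : Eu n) :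
    |wk K c k x| ≤ C * k := by
  unfold wk
  have h0 : 0 ≤ k ^ 2 * infDist x K := mul_nonneg (sq_nonneg _) infDist_nonneg
  have h1 : k ≤ C * k := by nlinarith
  have h2 : c * k ≤ C * k := by nlinarith
  rw [abs_le]
  constructor
  · exact le_trans (by linarith) (le_max_left _ _)
  · exact max_le (by nlinarith) (by linarith)

lemma wk_tendsto {n : ℕ} {K : Set (Eu n)} (hK : IsClosed K) (hne : K.Nonempty) {c : ℝ} (hc : 1 ≤ c) :
    Tendsto (fun k : ℕ => ∫ x, Phi (wk K c k x) ∂(gm n)) atTop (𝓝 (gaussVol n K)) := by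
  rw [gaussVol_eq hK.measurableSet]
  have : (gm n K).toReal = ∫ x, K.indicator (fun _ => (1 : ℝ)) x ∂(gm n) := by
    rw [integral_indicator hK.measurableSet]; simp [Measure.real]
  rw [this]
  refine tendsto_integral_of_dominated_convergence (fun _ => 1)
    (fun k => (Phi_cont.comp (wk_cont K c k)).aestronglyMeasurable) (integrable_const _)
    (fun k => Eventually.of_forall fun x => ?_) (Eventually.of_forall fun x => ?_)
  · rw [Real.norm_eq_abs, abs_of_pos (Phi_pos _)]; exact (Phi_lt_one _).le
  · by_cases hx : x ∈ K
    · rw [Set.indicator_of_mem hx]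
      refine Phi_tendsto_top.comp ?_
      refine tendsto_atTop_mono (fun k => ?_) (tendsto_natCast_atTop_atTop (R := ℝ))
      unfold wk
      rw [infDist_zero_of_mem hx]
      exact le_trans (by simp) (le_max_right _ _)
    · rw [Set.indicator_of_notMem hx]
      refine Phi_tendsto_bot.comp ?_
      have hd : 0 < infDist x K := (hK.notMem_iff_infDist_pos hne).1 hx
      set d := infDist x K with hdd
      obtain ⟨N, hN⟩ := exists_nat_gt (2 / d)
      refine tendsto_atBot_mono' atTop (f₂ := fun k : ℕ => wk K c k x) (f₁ := fun k : ℕ => - (k : ℝ)) ?_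
        (tendsto_neg_atTop_atBot.comp (tendsto_natCast_atTop_atTop (R := ℝ)))
      filter_upwards [eventually_ge_atTop N] with k hk
      have hk' : (2 : ℝ) / d < k := hN.trans_le (by exact_mod_cast hk)
      rw [div_lt_iff₀ hd] at hk'
      have hk0 : (0 : ℝ) ≤ k := Nat.cast_nonneg _
      unfold wk
      refine max_le (by nlinarith) ?_
      rw [← hdd]
      nlinarith

lemma infDist_comb {n : ℕ} {K L : Set (Eu n)} (hK : IsCompact K) (hL : IsCompact L) (hKn : K.Nonempty)
    (hLn : L.Nonempty) {s s' : ℝ} (hs : 0 < s) (hs' : 0 < s') (x y : Eu n) :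
    infDist (s • x + s' • y) (s • K + s' • L) ≤ s * infDist x K + s' * infDist y L := by
  obtain ⟨p, hp, ep⟩ := hK.exists_infDist_eq_dist hKn x
  obtain ⟨q, hq, eq⟩ := hL.exists_infDist_eq_dist hLn y
  have hm : s • p + s' • q ∈ s • K + s' • L := add_mem_add (smul_mem_smul_set hp) (smul_mem_smul_set hq)
  refine (infDist_le_dist_of_mem hm).trans ?_
  refine (dist_add_add_le _ _ _ _).trans ?_
  rw [dist_smul₀, dist_smul₀, ep, eq, Real.norm_of_nonneg hs.le, Real.norm_of_nonneg hs'.le]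

theorem ehrhard_set {n : ℕ} {K L : Set (Eu n)} (hK : IsCompact K) (hL : IsCompact L) (hKn : K.Nonempty)
    (hLn : L.Nonempty) {s s' : ℝ} (hs : 0 < s) (hs' : 0 < s') (hss : s + s' = 1) {p q : ℝ}
    (hp : Phi p ≤ gaussVol n K) (hq : Phi q ≤ gaussVol n L) :
    Phi (s * p + s' * q) ≤ gaussVol n (s • K + s' • L) := by
  set M := s • K + s' • L with hM
  have hMc : IsCompact M := (hK.smul s).add (hL.smul s')
  have hMn : M.Nonempty := (hKn.smul_set).add (hLn.smul_set)
  set c := 2 / min s s' with hc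
  have hmin : 0 < min s s' := lt_min hs hs'
  have hcs : 2 ≤ c * s := by
    rw [hc, div_mul_eq_mul_div, le_div_iff₀ hmin]
    nlinarith [min_le_left s s']
  have hcs' : 2 ≤ c * s' := by
    rw [hc, div_mul_eq_mul_div, le_div_iff₀ hmin]
    nlinarith [min_le_right s s']
  have hc1 : 1 ≤ c := by nlinarith
  have key : ∀ δ > 0, Phi (s * (p - δ) + s' * (q - δ)) ≤ gaussVol n M := by
    intro δ hδ
    have tK := wk_tendsto hK.isClosed hKn hc1
    have tL := wk_tendsto hL.isClosed hLn hc1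
    have tM := wk_tendsto hMc.isClosed hMn (le_refl (1 : ℝ))
    have e1 : Phi (p - δ) < gaussVol n K := (Phi_strictMono (by linarith)).trans_le hp
    have e2 : Phi (q - δ) < gaussVol n L := (Phi_strictMono (by linarith)).trans_le hq
    refine ge_of_tendsto tM ?_
    filter_upwards [tK.eventually (lt_mem_nhds e1), tL.eventually (lt_mem_nhds e2)] with k h1 h2
    have hk0 : (0 : ℝ) ≤ k := Nat.cast_nonneg _
    have bK := wk_bd K hc1 hk0 le_rfl
    have bL := wk_bd L hc1 hk0 le_rfl
    have bM := wk_bd M le_rfl hk0 hc1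
    have mem : ∀ {f : Eu n → ℝ}, Continuous f → (∀ x, |f x| ≤ c * k) →
        0 < ∫ x, Phi (f x) ∂(gm n) ∧ ∫ x, Phi (f x) ∂(gm n) < 1 := by
      intro f hf hb
      have := Phi_int_mem' (P := gm n) hf.measurable hb
      exact ⟨(Phi_pos _).trans_le this.1, this.2.trans_lt (Phi_lt_one _)⟩
    have E := ehrhard_Eu hs hs' hss (wk_cont K c k) (wk_cont L c k) (wk_cont M 1 k) bK bL bM ?_
    · have m1 := mem (wk_cont K c k) bK
      have m2 := mem (wk_cont L c k) bL
      have m3 := mem (wk_cont M 1 k) bM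
      have i1 : p - δ ≤ PhiInv (∫ x, Phi (wk K c k x) ∂(gm n)) := by
        rw [← Phi_strictMono.le_iff_le, Phi_PhiInv m1.1 m1.2]; exact h1.le
      have i2 : q - δ ≤ PhiInv (∫ x, Phi (wk L c k x) ∂(gm n)) := by
        rw [← Phi_strictMono.le_iff_le, Phi_PhiInv m2.1 m2.2]; exact h2.le
      rw [← Phi_PhiInv m3.1 m3.2]
      refine Phi_strictMono.monotone (le_trans ?_ E)
      gcongr
    · intro x y
      have hd := infDist_comb hK hL hKn hLn hs hs' x y
      rw [← hM] at hd
      have d1 : 0 ≤ infDist x K := infDist_nonneg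
      have d2 : 0 ≤ infDist y L := infDist_nonneg
      have uK : wk K c k x ≤ k := max_le (by nlinarith) (by nlinarith [mul_nonneg (sq_nonneg (k:ℝ)) d1])
      have uL : wk L c k y ≤ k := max_le (by nlinarith) (by nlinarith [mul_nonneg (sq_nonneg (k:ℝ)) d2])
      have lM : -(1 * (k:ℝ)) ≤ wk M 1 k (s • x + s' • y) := le_max_left _ _
      have lM' : k - (k:ℝ)^2 * infDist (s • x + s' • y) M ≤ wk M 1 k (s • x + s' • y) := le_max_right _ _
      have a1 : s' * wk L c k y ≤ s' * k := by gcongr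
      have a2 : s * wk K c k x ≤ s * k := by gcongr
      have a3 : 2 * k ≤ c * s * k := by gcongr
      have a4 : 2 * k ≤ c * s' * k := by gcongr
      have hsk : s * k + s' * k = k := by rw [← add_mul, hss, one_mul]
      have hsk1 : s * k ≤ k := by nlinarith
      have hsk2 : s' * k ≤ k := by nlinarith
      rcases max_choice (-(c * (k:ℝ))) (k - (k:ℝ) ^ 2 * infDist x K) with hh | hh
      · have : wk K c k x = -(c * k) := hh
        rw [this]; linarith
      · have hh : wk K c k x = k - (k:ℝ) ^ 2 * infDist x K := hh
        rcases max_choice (-(c * (k:ℝ))) (k - (k:ℝ) ^ 2 * infDist y L) with h' | h'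
        · have : wk L c k y = -(c * k) := h'
          rw [this]; linarith
        · have h' : wk L c k y = k - (k:ℝ) ^ 2 * infDist y L := h'
          have := mul_le_mul_of_nonneg_left hd (sq_nonneg (k:ℝ))
          rw [hh, h']; linarith
  have lim : Tendsto (fun δ : ℝ => Phi (s * (p - δ) + s' * (q - δ))) (𝓝[>] 0) (𝓝 (Phi (s * p + s' * q))) := by
    have : Continuous (fun δ : ℝ => Phi (s * (p - δ) + s' * (q - δ))) := Phi_cont.comp (by fun_prop)
    have h0 := this.tendsto 0
    simp only [sub_zero] at h0
    exact h0.mono_left nhdsWithin_le_nhds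
  exact le_of_tendsto lim (by filter_upwards [self_mem_nhdsWithin] with δ hδ using key δ hδ)

end

open MeasureTheory Metric Set Filter
open scoped RealInnerProductSpace Topology Pointwise NNReal ENNReal

noncomputable section

/-- Sup-convolution of `θ` over `K`. -/
def sc {n : ℕ} (K : Set (Eu n)) (θ : Eu n → ℝ) (k : ℝ) (x : Eu n) : ℝ :=
  sSup ((fun p => θ p - k * dist x p) '' K)

section
variable {n : ℕ} {K : Set (Eu n)} {θ : Eu n → ℝ}

lemma sc_isCompact (hK : IsCompact K) (hθ : Continuous θ) (k : ℝ) (x : Eu n) :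
    IsCompact ((fun p => θ p - k * dist x p) '' K) := hK.image (by fun_prop)

lemma sc_ge (hK : IsCompact K) (hθ : Continuous θ) (k : ℝ) (x : Eu n) {p : Eu n} (hp : p ∈ K) :
    θ p - k * dist x p ≤ sc K θ k x :=
  le_csSup (sc_isCompact hK hθ k x).bddAbove (mem_image_of_mem _ hp)

lemma sc_mem (hK : IsCompact K) (hn : K.Nonempty) (hθ : Continuous θ) (k : ℝ) (x : Eu n) :
    ∃ p ∈ K, sc K θ k x = θ p - k * dist x p := by
  obtain ⟨p, hp, h⟩ := (sc_isCompact hK hθ k x).sSup_mem (hn.image _)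
  exact ⟨p, hp, h.symm⟩

lemma sc_cont (hK : IsCompact K) (hn : K.Nonempty) (hθ : Continuous θ) {k : ℝ} (hk : 0 ≤ k) :
    Continuous (sc K θ k) := by
  have : LipschitzWith ⟨k, hk⟩ (sc K θ k) := by
    refine LipschitzWith.of_le_add_mul _ fun x y => ?_
    obtain ⟨p, hp, h⟩ := sc_mem hK hn hθ k x
    have h2 := sc_ge hK hθ k y hp
    have h3 : dist y p ≤ dist x y + dist x p := by
      have := dist_triangle y x p; rwa [dist_comm y x] at this
    have h4 := mul_le_mul_of_nonneg_left h3 hk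
    rw [h]
    change _ ≤ sc K θ k y + k * dist x y
    linarith
  exact this.continuous

/-- truncated version -/
def tc (K : Set (Eu n)) (θ : Eu n → ℝ) (c k : ℝ) (x : Eu n) : ℝ := max (-(c * k)) (sc K θ k x)

lemma tc_cont (hK : IsCompact K) (hn : K.Nonempty) (hθ : Continuous θ) {c k : ℝ} (hk : 0 ≤ k) :
    Continuous (tc K θ c k) := by
  have := sc_cont hK hn hθ hk
  unfold tc; fun_prop

lemma sc_le (hK : IsCompact K) (hn : K.Nonempty) (hθ : Continuous θ) {k A : ℝ} (hk : 0 ≤ k)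
    (hA : ∀ p ∈ K, θ p ≤ A) (x : Eu n) : sc K θ k x ≤ A - k * infDist x K := by
  obtain ⟨p, hp, h⟩ := sc_mem hK hn hθ k x
  have := mul_le_mul_of_nonneg_left (infDist_le_dist_of_mem (x := x) hp) hk
  rw [h]; linarith [hA p hp]

lemma tc_bd (hK : IsCompact K) (hn : K.Nonempty) (hθ : Continuous θ) {c C k A : ℝ} (hk : 0 ≤ k)
    (hA : ∀ p ∈ K, θ p ≤ A) (hAk : A ≤ k) (hc : 1 ≤ c) (hC : c ≤ C) (x : Eu n) : |tc K θ c k x| ≤ C * k := by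
  have h1 := sc_le hK hn hθ hk hA x
  have h0 : 0 ≤ k * infDist x K := mul_nonneg hk infDist_nonneg
  have h2 : k ≤ C * k := by nlinarith
  have h3 : c * k ≤ C * k := by nlinarith
  have h4 : 0 ≤ c * k := by positivity
  rw [abs_le]
  constructor
  · exact le_trans (by linarith) (le_max_left _ _)
  · exact max_le (by linarith) (by linarith)

lemma tc_tendsto (hK : IsCompact K) (hn : K.Nonempty) (hθ : Continuous θ) {c : ℝ} (hc : 1 ≤ c) :
    Tendsto (fun k : ℕ => ∫ x, Phi (tc K θ c k x) ∂(gm n)) atTop (𝓝 (∫ x in K, Phi (θ x) ∂(gm n))) := by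
  obtain ⟨A, hA⟩ : ∃ A, ∀ p ∈ K, θ p ≤ A := by
    obtain ⟨A, hA⟩ := (hK.image hθ).bddAbove
    exact ⟨A, fun p hp => hA (mem_image_of_mem _ hp)⟩
  rw [← integral_indicator hK.measurableSet]
  refine tendsto_integral_of_dominated_convergence (fun _ => 1)
    (fun k => (Phi_cont.comp (tc_cont hK hn hθ (Nat.cast_nonneg k))).aestronglyMeasurable) (integrable_const _)
    (fun k => Eventually.of_forall fun x => ?_) (Eventually.of_forall fun x => ?_)
  · rw [Real.norm_eq_abs, abs_of_pos (Phi_pos _)]; exact (Phi_lt_one _).le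
  · by_cases hx : x ∈ K
    · rw [Set.indicator_of_mem hx]
      refine (Phi_cont.tendsto _).comp ?_
      have hlow : ∀ k : ℕ, θ x ≤ sc K θ k x := fun k => by
        have := sc_ge hK hθ k x hx
        simpa using this
      rw [Metric.tendsto_nhds]
      intro ε hε
      obtain ⟨δ, hδ, hd⟩ := Metric.continuousAt_iff.1 (hθ.continuousAt (x := x)) ε hε
      obtain ⟨N, hN⟩ := exists_nat_gt (max ((A - θ x) / δ) (-θ x))
      filter_upwards [eventually_ge_atTop N] with k hk
      have hk' : (N : ℝ) ≤ k := by exact_mod_cast hk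
      have hk0 : (0 : ℝ) ≤ k := Nat.cast_nonneg _
      have h1 : A - θ x < k * δ := by
        rw [← div_lt_iff₀ hδ]; exact (le_max_left _ _).trans_lt (hN.trans_le hk')
      have h2 : -θ x < k := (le_max_right _ _).trans_lt (hN.trans_le hk')
      have e : tc K θ c k x = sc K θ k x := by
        refine max_eq_right ?_
        have := hlow k
        nlinarith
      rw [e]
      obtain ⟨p, hp, h⟩ := sc_mem hK hn hθ k x
      rw [Real.dist_eq, abs_of_nonneg (by linarith [hlow k])]
      by_cases hpd : dist p x < δ
      · have := hd hpd
        rw [Real.dist_eq] at this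
        have := (abs_lt.1 this).2
        have : 0 ≤ k * dist x p := mul_nonneg hk0 dist_nonneg
        linarith
      · push Not at hpd
        rw [dist_comm] at hpd
        have := mul_le_mul_of_nonneg_left hpd hk0
        linarith [hA p hp]
    · rw [Set.indicator_of_notMem hx]
      refine Phi_tendsto_bot.comp ?_
      have hd : 0 < infDist x K := (hK.isClosed.notMem_iff_infDist_pos hn).1 hx
      have hc' : (0:ℝ) < c := by linarith
      have t1 : Tendsto (fun k : ℕ => -(c * (k:ℝ))) atTop atBot :=
        tendsto_neg_atTop_atBot.comp ((tendsto_natCast_atTop_atTop (R := ℝ)).const_mul_atTop hc')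
      have t2 : Tendsto (fun k : ℕ => A - (k:ℝ) * infDist x K) atTop atBot := by
        have := tendsto_neg_atTop_atBot.comp ((tendsto_natCast_atTop_atTop (R := ℝ)).atTop_mul_const hd)
        exact tendsto_atBot_add_const_left _ A this
      rw [tendsto_atBot] at t1 t2 ⊢
      intro b
      filter_upwards [t1 b, t2 b] with k h1 h2
      exact max_le h1 ((sc_le hK hn hθ (Nat.cast_nonneg k) hA x).trans h2)

end

theorem ehrhard_fun_set {n : ℕ} {K L : Set (Eu n)} (hK : IsCompact K) (hL : IsCompact L) (hKn : K.Nonempty)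
    (hLn : L.Nonempty) {θ₁ θ₂ θ₃ : Eu n → ℝ} (h1 : Continuous θ₁) (h2 : Continuous θ₂) (h3 : Continuous θ₃)
    (H : ∀ p ∈ K, ∀ q ∈ L, (1/2 : ℝ) * θ₁ p + (1/2 : ℝ) * θ₂ q ≤ θ₃ ((1/2 : ℝ) • p + (1/2 : ℝ) • q)) {r₁ r₂ : ℝ}
    (hr1 : Phi r₁ < ∫ x in K, Phi (θ₁ x) ∂(gm n)) (hr2 : Phi r₂ < ∫ x in L, Phi (θ₂ x) ∂(gm n)) :
    Phi ((1/2 : ℝ) * r₁ + (1/2 : ℝ) * r₂) ≤ ∫ x in (1/2 : ℝ) • K + (1/2 : ℝ) • L, Phi (θ₃ x) ∂(gm n) := by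
  set M := (1/2 : ℝ) • K + (1/2 : ℝ) • L with hM
  have hMc : IsCompact M := (hK.smul _).add (hL.smul _)
  have hMn : M.Nonempty := (hKn.smul_set).add (hLn.smul_set)
  have bdd : ∀ {X : Set (Eu n)} {θ : Eu n → ℝ}, IsCompact X → Continuous θ → ∃ A, ∀ p ∈ X, θ p ≤ A := by
    intro X θ hX hθ
    obtain ⟨A, hA⟩ := (hX.image hθ).bddAbove
    exact ⟨A, fun p hp => hA (mem_image_of_mem _ hp)⟩
  obtain ⟨A, hA⟩ := bdd hK h1
  obtain ⟨B, hB⟩ := bdd hL h2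
  obtain ⟨C, hC⟩ := bdd hMc h3
  have tK := tc_tendsto hK hKn h1 (by norm_num : (1:ℝ) ≤ 3)
  have tL := tc_tendsto hL hLn h2 (by norm_num : (1:ℝ) ≤ 3)
  have tM := tc_tendsto hMc hMn h3 (le_refl (1 : ℝ))
  refine ge_of_tendsto tM ?_
  filter_upwards [tK.eventually (lt_mem_nhds hr1), tL.eventually (lt_mem_nhds hr2),
    (tendsto_natCast_atTop_atTop (R := ℝ)).eventually_ge_atTop A,
    (tendsto_natCast_atTop_atTop (R := ℝ)).eventually_ge_atTop B,
    (tendsto_natCast_atTop_atTop (R := ℝ)).eventually_ge_atTop C] with k hk1 hk2 kA kB kC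
  have hk0 : (0 : ℝ) ≤ k := Nat.cast_nonneg _
  have cK := tc_cont hK hKn h1 (c := 3) hk0
  have cL := tc_cont hL hLn h2 (c := 3) hk0
  have cM := tc_cont hMc hMn h3 (c := 1) hk0
  have bK := tc_bd hK hKn h1 hk0 hA kA (by norm_num : (1:ℝ) ≤ 3) le_rfl
  have bL := tc_bd hL hLn h2 hk0 hB kB (by norm_num : (1:ℝ) ≤ 3) le_rfl
  have bM := tc_bd hMc hMn h3 hk0 hC kC le_rfl (by norm_num : (1:ℝ) ≤ 3)
  have mem : ∀ {f : Eu n → ℝ}, Continuous f → (∀ x, |f x| ≤ 3 * k) →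
      0 < ∫ x, Phi (f x) ∂(gm n) ∧ ∫ x, Phi (f x) ∂(gm n) < 1 := by
    intro f hf hb
    have := Phi_int_mem' (P := gm n) hf.measurable hb
    exact ⟨(Phi_pos _).trans_le this.1, this.2.trans_lt (Phi_lt_one _)⟩
  have E := ehrhard_Eu (by norm_num) (by norm_num) (by norm_num : (1/2:ℝ) + 1/2 = 1) cK cL cM bK bL bM ?_
  · have m1 := mem cK bK
    have m2 := mem cL bL
    have m3 := mem cM bM
    have i1 := (PhiInv_le_iff m1.1 m1.2).2 hk1.le
    have i2 := (PhiInv_le_iff m2.1 m2.2).2 hk2.le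
    rw [← PhiInv_le_iff m3.1 m3.2]
    refine le_trans ?_ E
    linarith
  · intro x y
    have l1 : sc K θ₁ k x ≤ k := (sc_le hK hKn h1 hk0 hA x).trans (by
      have : 0 ≤ k * infDist x K := mul_nonneg hk0 infDist_nonneg
      linarith)
    have l2 : sc L θ₂ k y ≤ k := (sc_le hL hLn h2 hk0 hB y).trans (by
      have : 0 ≤ k * infDist y L := mul_nonneg hk0 infDist_nonneg
      linarith)
    have lM : -(1 * (k:ℝ)) ≤ tc M θ₃ 1 k ((1/2:ℝ) • x + (1/2:ℝ) • y) := le_max_left _ _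
    have lM' : sc M θ₃ k ((1/2:ℝ) • x + (1/2:ℝ) • y) ≤ tc M θ₃ 1 k ((1/2:ℝ) • x + (1/2:ℝ) • y) :=
      le_max_right _ _
    have u1 : tc K θ₁ 3 k x ≤ k := max_le (by linarith) l1
    have u2 : tc L θ₂ 3 k y ≤ k := max_le (by linarith) l2
    rcases max_choice (-(3 * (k:ℝ))) (sc K θ₁ k x) with hh | hh
    · have : tc K θ₁ 3 k x = -(3 * k) := hh
      rw [this]; linarith
    · have hh : tc K θ₁ 3 k x = sc K θ₁ k x := hh
      rcases max_choice (-(3 * (k:ℝ))) (sc L θ₂ k y) with h' | h'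
      · have : tc L θ₂ 3 k y = -(3 * k) := h'
        rw [this]; linarith
      · have h' : tc L θ₂ 3 k y = sc L θ₂ k y := h'
        obtain ⟨p, hp, e1⟩ := sc_mem hK hKn h1 k x
        obtain ⟨q, hq, e2⟩ := sc_mem hL hLn h2 k y
        have hm : (1/2:ℝ) • p + (1/2:ℝ) • q ∈ M :=
          add_mem_add (smul_mem_smul_set hp) (smul_mem_smul_set hq)
        have g := sc_ge hMc h3 k ((1/2:ℝ) • x + (1/2:ℝ) • y) hm
        have d : dist ((1/2:ℝ) • x + (1/2:ℝ) • y) ((1/2:ℝ) • p + (1/2:ℝ) • q) ≤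
            1/2 * dist x p + 1/2 * dist y q := by
          refine (dist_add_add_le _ _ _ _).trans ?_
          rw [dist_smul₀, dist_smul₀]; norm_num
        have d' := mul_le_mul_of_nonneg_left d hk0
        have := H p hp q hq
        rw [hh, h', e1, e2]; linarith

/-- Rescaled tail. -/
def Rt (T s : ℝ) : ℝ := T / ph T * Phi (-T + s / T)

lemma Rt_eq {T : ℝ} (hT : 0 < T) (s : ℝ) : Rt T s = ∫ t in Iic s, Real.exp (t - t ^ 2 / (2 * T ^ 2)) := by
  unfold Rt
  rw [Phi_eq, ← integral_indicator measurableSet_Iic, ← integral_indicator measurableSet_Iic]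
  have h := Measure.integral_comp_div (fun y => (Iic (-T + s / T)).indicator ph (y - T)) T
  rw [integral_sub_right_eq_self (fun y => (Iic (-T + s / T)).indicator ph y) T, abs_of_pos hT, smul_eq_mul] at h
  rw [div_mul_eq_mul_div, ← h, ← integral_div]
  refine integral_congr_ae (Eventually.of_forall fun t => ?_)
  change (Iic (-T + s / T)).indicator ph (t / T - T) / ph T = (Iic s).indicator (fun t => Real.exp (t - t ^ 2 / (2 * T ^ 2))) t
  by_cases ht : t ≤ s
  · have h1 : t / T - T ≤ -T + s / T := by
      have := div_le_div_of_nonneg_right ht hT.le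
      linarith
    rw [Set.indicator_of_mem (show t / T - T ∈ Iic (-T + s / T) from h1), Set.indicator_of_mem (show t ∈ Iic s from ht)]
    unfold ph
    rw [mul_div_mul_left _ _ (inv_ne_zero sqrt2pi_pos.ne'), ← Real.exp_sub]
    congr 1
    field_simp
    ring
  · have h1 : ¬ (t / T - T ≤ -T + s / T) := by
      intro h
      apply ht
      have : t / T ≤ s / T := by linarith
      exact (div_le_div_iff_of_pos_right hT).1 this
    rw [Set.indicator_of_notMem (show t / T - T ∉ Iic (-T + s / T) from h1), Set.indicator_of_notMem (show t ∉ Iic s from ht)]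
    simp

lemma Rt_nonneg {T : ℝ} (hT : 0 < T) (s : ℝ) : 0 ≤ Rt T s := by
  unfold Rt
  have := ph_pos T
  have := Phi_pos (-T + s / T)
  positivity

lemma Rt_le {T : ℝ} (hT : 0 < T) (s : ℝ) : Rt T s ≤ Real.exp s := by
  rw [Rt_eq hT, ← integral_exp_Iic s]
  refine integral_mono_of_nonneg (Eventually.of_forall fun t => (Real.exp_pos _).le) (integrableOn_exp_Iic s)
    (Eventually.of_forall fun t => Real.exp_le_exp.2 ?_)
  have : 0 ≤ t ^ 2 / (2 * T ^ 2) := by positivity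
  linarith

lemma Rt_tendsto (s : ℝ) : Tendsto (fun T => Rt T s) atTop (𝓝 (Real.exp s)) := by
  have : Tendsto (fun T : ℝ => ∫ t in Iic s, Real.exp (t - t ^ 2 / (2 * T ^ 2))) atTop (𝓝 (∫ t in Iic s, Real.exp t)) := by
    refine tendsto_integral_filter_of_dominated_convergence Real.exp ?_ ?_ (integrableOn_exp_Iic s) ?_
    · exact Eventually.of_forall fun T => Continuous.aestronglyMeasurable (by fun_prop)
    · refine Eventually.of_forall fun T => Eventually.of_forall fun t => ?_
      rw [Real.norm_eq_abs, Real.abs_exp]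
      refine Real.exp_le_exp.2 ?_
      have : 0 ≤ t ^ 2 / (2 * T ^ 2) := by positivity
      linarith
    · refine Eventually.of_forall fun t => ?_
      refine (Real.continuous_exp.tendsto _).comp ?_
      have h1 : Tendsto (fun T : ℝ => 2 * T ^ 2) atTop atTop :=
        (tendsto_pow_atTop (by norm_num)).const_mul_atTop (by norm_num)
      have := (h1.const_div_atTop (t ^ 2)).const_sub t
      simpa using this
  rw [integral_exp_Iic] at this
  refine this.congr' ?_
  filter_upwards [eventually_gt_atTop 0] with T hT using (Rt_eq hT s).symm

lemma Rt_int_tendsto {n : ℕ} {K : Set (Eu n)} (hK : IsCompact K) {θ : Eu n → ℝ} (hθ : Continuous θ) :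
    Tendsto (fun T => ∫ x in K, Rt T (θ x) ∂(gm n)) atTop (𝓝 (∫ x in K, Real.exp (θ x) ∂(gm n))) := by
  refine tendsto_integral_filter_of_dominated_convergence (fun x => Real.exp (θ x)) ?_ ?_ ?_ ?_
  · refine Eventually.of_forall fun T => Continuous.aestronglyMeasurable ?_
    unfold Rt
    have := Phi_cont
    fun_prop
  · filter_upwards [eventually_gt_atTop 0] with T hT
    refine Eventually.of_forall fun x => ?_
    rw [Real.norm_eq_abs, abs_of_nonneg (Rt_nonneg hT _)]
    exact Rt_le hT _
  · exact (Real.continuous_exp.comp hθ).continuousOn.integrableOn_compact hK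
  · exact Eventually.of_forall fun x => Rt_tendsto _

theorem gauss_PL {n : ℕ} {K L : Set (Eu n)} (hK : IsCompact K) (hL : IsCompact L) (hKn : K.Nonempty)
    (hLn : L.Nonempty) {θ₁ θ₂ θ₃ : Eu n → ℝ} (h1 : Continuous θ₁) (h2 : Continuous θ₂) (h3 : Continuous θ₃)
    (H : ∀ p ∈ K, ∀ q ∈ L, (1/2 : ℝ) * θ₁ p + (1/2 : ℝ) * θ₂ q ≤ θ₃ ((1/2 : ℝ) • p + (1/2 : ℝ) • q)) {r₁ r₂ : ℝ}
    (hr1 : Real.exp r₁ < ∫ x in K, Real.exp (θ₁ x) ∂(gm n))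
    (hr2 : Real.exp r₂ < ∫ x in L, Real.exp (θ₂ x) ∂(gm n)) :
    Real.exp ((1/2 : ℝ) * r₁ + (1/2 : ℝ) * r₂) ≤
      ∫ x in (1/2 : ℝ) • K + (1/2 : ℝ) • L, Real.exp (θ₃ x) ∂(gm n) := by
  have hMc : IsCompact ((1/2 : ℝ) • K + (1/2 : ℝ) • L) := (hK.smul _).add (hL.smul _)
  have t1 := (Rt_tendsto r₁).eventually_lt (Rt_int_tendsto hK h1) hr1
  have t2 := (Rt_tendsto r₂).eventually_lt (Rt_int_tendsto hL h2) hr2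
  refine le_of_tendsto_of_tendsto (Rt_tendsto _) (Rt_int_tendsto hMc h3) ?_
  filter_upwards [t1, t2, eventually_gt_atTop 0] with T e1 e2 hT
  have hp := ph_pos T
  have hq : 0 < T / ph T := by positivity
  unfold Rt at e1 e2 ⊢
  rw [integral_const_mul] at e1 e2 ⊢
  have e1 := lt_of_mul_lt_mul_left e1 hq.le
  have e2 := lt_of_mul_lt_mul_left e2 hq.le
  refine mul_le_mul_of_nonneg_left ?_ hq.le
  have := ehrhard_fun_set hK hL hKn hLn (θ₁ := fun x => -T + θ₁ x / T) (θ₂ := fun x => -T + θ₂ x / T)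
    (θ₃ := fun x => -T + θ₃ x / T) (by fun_prop) (by fun_prop) (by fun_prop) ?_ e1 e2
  · have e : -T + ((1/2 : ℝ) * r₁ + (1/2 : ℝ) * r₂) / T = (1/2 : ℝ) * (-T + r₁ / T) + (1/2 : ℝ) * (-T + r₂ / T) := by
      ring
    rw [e]; exact this
  · intro p hp q hq
    have := div_le_div_of_nonneg_right (H p hp q hq) hT.le
    have e : (1/2 : ℝ) * (-T + θ₁ p / T) + (1/2 : ℝ) * (-T + θ₂ q / T) = -T +
      ((1/2 : ℝ) * θ₁ p + (1/2 : ℝ) * θ₂ q) / T := by ring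
    rw [e]; linarith

end

open MeasureTheory Metric Set Filter
open scoped RealInnerProductSpace Topology Pointwise NNReal ENNReal

noncomputable section

lemma gm_setIntegral {n : ℕ} (A : Set (Eu n)) (hA : MeasurableSet A) (F : Eu n → ℝ) :
    ∫ x in A, F x ∂(gm n) = ∫ x in A, gd n x * F x := by
  unfold gm
  rw [restrict_withDensity hA, integral_withDensity_eq_integral_toReal_smul]
  · refine integral_congr_ae (Eventually.of_forall fun x => ?_)
    simp [ENNReal.toReal_ofReal (gd_pos x).le]
  · exact ENNReal.measurable_ofReal.comp gd_cont.measurable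
  · exact Eventually.of_forall fun x => ENNReal.ofReal_lt_top

lemma gm_open_pos {n : ℕ} {U : Set (Eu n)} (hU : IsOpen U) (h : gm n U = 0) : U = ∅ := by
  unfold gm at h
  rw [withDensity_apply_eq_zero (f := fun x : Eu n => ENNReal.ofReal (gd n x))
    (ENNReal.measurable_ofReal.comp gd_cont.measurable)] at h
  have e : {x : Eu n | ENNReal.ofReal (gd n x) ≠ 0} ∩ U = U := by
    refine inter_eq_right.2 fun x _ => ?_
    simpa using gd_pos x
  rw [e] at h
  exact (hU.measure_eq_zero_iff volume).1 h

lemma gm_scale {n : ℕ} (X : Set (Eu n)) (hX : IsCompact X) (φ : Eu n → ℝ) {R : ℝ} (hR : 0 < R) (hR2 : R ^ 2 = 1 / 2) :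
    ∫ x in R • X, Real.exp (-‖x‖ ^ 2 / 2) * φ x ∂(gm n) = R ^ n * ∫ x in X, φ (R • x) ∂(gm n) := by
  rw [gm_setIntegral _ (hX.smul R).measurableSet, gm_setIntegral _ hX.measurableSet]
  have h := Measure.setIntegral_comp_smul_of_pos volume
    (fun x : Eu n => gd n x * (Real.exp (-‖x‖ ^ 2 / 2) * φ x)) X hR
  rw [finrank_euclideanSpace_fin, smul_eq_mul] at h
  have e : ∀ x : Eu n, gd n (R • x) * (Real.exp (-‖R • x‖ ^ 2 / 2) * φ (R • x)) = gd n x * φ (R • x) := by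
    intro x
    unfold gd
    rw [norm_smul, mul_pow, Real.norm_eq_abs, sq_abs, hR2, mul_assoc, ← mul_assoc (Real.exp _) (Real.exp _),
      ← Real.exp_add]
    ring_nf
  simp_rw [e] at h
  rw [h, ← mul_assoc, mul_inv_cancel₀ (pow_pos hR n).ne', one_mul]

theorem gauss_strict {n : ℕ} {K L : Set (Eu n)} (hK : IsCompact K) (hL : IsCompact L) (hKn : K.Nonempty)
    (hLn : L.Nonempty) (hIntg : K ⊆ closure (interior K)) (hpos : 0 < gaussVol n K)
    (h1 : gaussVol n L = gaussVol n K) (h2 : gaussVol n ((1/2 : ℝ) • K + (1/2 : ℝ) • L) = gaussVol n K) :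
    K ⊆ L := by
  set R : ℝ := Real.sqrt (1/2) with hRd
  have hR : 0 < R := Real.sqrt_pos.2 (by norm_num)
  have hR2 : R ^ 2 = 1 / 2 := Real.sq_sqrt (by norm_num)
  set γ := gaussVol n K with hγ
  have hMc : IsCompact ((1/2 : ℝ) • K + (1/2 : ℝ) • L) := (hK.smul _).add (hL.smul _)
  have hMs : (1/2 : ℝ) • (R • K) + (1/2 : ℝ) • (R • L) = R • ((1/2 : ℝ) • K + (1/2 : ℝ) • L) := by
    rw [smul_add, smul_comm, smul_comm _ R L]
  have hvol : ∀ {X : Set (Eu n)}, IsCompact X → ∫ x in X, (1:ℝ) ∂(gm n) = gaussVol n X := by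
    intro X hX
    rw [gaussVol_eq hX.measurableSet]; simp [Measure.real]
  set b : Eu n → ℝ := fun y => infDist (R • y) (R • L) with hb
  have hbc : Continuous b := (continuous_infDist_pt _).comp (continuous_const_smul R)
  have hb0 : ∀ y, 0 ≤ b y := fun y => infDist_nonneg
  have hbint : IntegrableOn b K (gm n) := hbc.continuousOn.integrableOn_compact hK
  -- the main estimate
  have key : ∀ ε : ℝ, 0 < ε → ∫ y in K, Real.exp (ε * b y) ∂(gm n) ≤ Real.exp (ε ^ 2) * γ := by
    intro ε hε
    set A := ∫ y in K, Real.exp (ε * b y) ∂(gm n) with hA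
    have hAge : γ ≤ A := by
      rw [hγ, ← hvol hK]
      refine integral_mono_of_nonneg (Eventually.of_forall fun _ => zero_le_one) ?_
        (Eventually.of_forall fun y => Real.one_le_exp (mul_nonneg hε.le (hb0 y)))
      exact (Real.continuous_exp.comp (hbc.const_mul ε)).continuousOn.integrableOn_compact hK
    have hApos : 0 < A := hpos.trans_le hAge
    have hRn : 0 < R ^ n := pow_pos hR n
    have i1 : ∫ x in R • K, Real.exp (-‖x‖ ^ 2 / 2 + ε * infDist x (R • L)) ∂(gm n) = R ^ n * A := by
      simp_rw [Real.exp_add]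
      exact gm_scale K hK (fun x => Real.exp (ε * infDist x (R • L))) hR hR2
    have i2 : ∫ x in R • L, Real.exp (-‖x‖ ^ 2 / 2 - ε * infDist x (R • L)) ∂(gm n) = R ^ n * γ := by
      have := gm_scale L hL (fun x => 1) hR hR2
      rw [hvol hL, h1] at this
      rw [← this]
      refine setIntegral_congr_fun (hL.smul R).measurableSet fun x hx => ?_
      simp [infDist_zero_of_mem hx]
    have i3 : ∫ x in (1/2 : ℝ) • (R • K) + (1/2 : ℝ) • (R • L), Real.exp (-‖x‖ ^ 2 / 2 + ε ^ 2 / 2) ∂(gm n) =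
        R ^ n * (γ * Real.exp (ε ^ 2 / 2)) := by
      rw [hMs]
      simp_rw [Real.exp_add]
      rw [gm_scale _ hMc (fun x => Real.exp (ε ^ 2 / 2)) hR hR2]
      congr 1
      have := hvol hMc
      rw [h2] at this
      rw [← this, ← integral_mul_const]
      simp
    have cont : Continuous (fun x : Eu n => infDist x (R • L)) := continuous_infDist_pt _
    have fin : ∀ δ : ℝ, 0 < δ → Real.exp (1/2 * (Real.log (R ^ n * A) - δ) + 1/2 * (Real.log (R ^ n * γ) - δ)) ≤
        R ^ n * (γ * Real.exp (ε ^ 2 / 2)) := by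
      intro δ hδ
      rw [← i3]
      refine gauss_PL (hK.smul R) (hL.smul R) hKn.smul_set hLn.smul_set
        (θ₁ := fun x => -‖x‖ ^ 2 / 2 + ε * infDist x (R • L)) (θ₂ := fun x => -‖x‖ ^ 2 / 2 - ε * infDist x (R • L))
        (θ₃ := fun x => -‖x‖ ^ 2 / 2 + ε ^ 2 / 2) (by fun_prop) (by fun_prop) (by fun_prop) ?_ ?_ ?_
      · intro p _ q _
        have l1 : infDist p (R • L) ≤ infDist q (R • L) + dist p q := infDist_le_infDist_add_dist
        rw [dist_eq_norm] at l1
        have par := parallelogram_law_with_norm ℝ p q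
        have nn : ‖(1/2 : ℝ) • p + (1/2 : ℝ) • q‖ = 1/2 * ‖p + q‖ := by
          rw [← smul_add, norm_smul]; norm_num
        have l2 := mul_le_mul_of_nonneg_left l1 hε.le
        rw [nn]
        nlinarith [sq_nonneg (‖p - q‖ - 2 * ε)]
      · rw [i1]
        rw [Real.exp_sub, Real.exp_log (by positivity)]
        exact div_lt_self (by positivity) (Real.one_lt_exp_iff.2 hδ)
      · rw [i2]
        rw [Real.exp_sub, Real.exp_log (by positivity)]
        exact div_lt_self (by positivity) (Real.one_lt_exp_iff.2 hδ)
    have lim : 1/2 * Real.log (R ^ n * A) + 1/2 * Real.log (R ^ n * γ) ≤ Real.log (R ^ n * (γ * Real.exp (ε ^ 2 / 2))) := by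
      refine le_of_forall_pos_le_add fun δ hδ => ?_
      have := Real.log_le_log (Real.exp_pos _) (fin δ hδ)
      rw [Real.log_exp] at this
      linarith
    rw [Real.log_mul hRn.ne' hApos.ne', Real.log_mul hRn.ne' hpos.ne', Real.log_mul hRn.ne' (by positivity),
      Real.log_mul hpos.ne' (by positivity), Real.log_exp] at lim
    have : Real.log A ≤ ε ^ 2 + Real.log γ := by linarith
    rw [← Real.exp_le_exp, Real.exp_log hApos, Real.exp_add, Real.exp_log hpos] at this
    exact this
  have hint0 : ∫ y in K, b y ∂(gm n) = 0 := by
    refine le_antisymm ?_ (integral_nonneg hb0)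
    have hsmall : ∀ ε : ℝ, 0 < ε → ε ≤ 1 → ∫ y in K, b y ∂(gm n) ≤ 2 * γ * ε := by
      intro ε hε hε1
      have k := key ε hε
      have lo : γ + ε * ∫ y in K, b y ∂(gm n) ≤ ∫ y in K, Real.exp (ε * b y) ∂(gm n) := by
        rw [hγ, ← hvol hK, ← integral_const_mul, ← integral_add (integrable_const _) (hbint.const_mul ε)]
        refine integral_mono ((integrable_const _).add (hbint.const_mul ε))
          ((Real.continuous_exp.comp (hbc.const_mul ε)).continuousOn.integrableOn_compact hK) (fun y => ?_)
        have := Real.add_one_le_exp (ε * b y)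
        linarith
      have e2 : Real.exp (ε ^ 2) ≤ 1 + 2 * ε ^ 2 := by
        have h := Real.abs_exp_sub_one_sub_id_le (x := ε ^ 2) (by rw [abs_of_nonneg (sq_nonneg _)]; nlinarith)
        have := (abs_le.1 h).2
        have h4 : ε ^ 2 ≤ 1 := by nlinarith
        nlinarith [mul_le_mul_of_nonneg_left h4 (sq_nonneg ε)]
      have : ε * ∫ y in K, b y ∂(gm n) ≤ ε * (2 * γ * ε) := by nlinarith
      exact le_of_mul_le_mul_left this hε
    refine le_of_forall_pos_le_add fun δ hδ => ?_
    have h0 : 0 < min 1 (δ / (2 * γ)) := lt_min one_pos (by positivity)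
    have := hsmall _ h0 (min_le_left _ _)
    have h3 : 2 * γ * min 1 (δ / (2 * γ)) ≤ 2 * γ * (δ / (2 * γ)) :=
      mul_le_mul_of_nonneg_left (min_le_right _ _) (by positivity)
    rw [mul_div_cancel₀ _ (by positivity)] at h3
    linarith
  have hae := (setIntegral_eq_zero_iff_of_nonneg_ae (Eventually.of_forall hb0) hbint).1 hint0
  have hU : IsOpen (interior K ∩ {y | 0 < b y}) := isOpen_interior.inter (isOpen_lt continuous_const hbc)
  have hU0 : gm n (interior K ∩ {y | 0 < b y}) = 0 := by
    rw [EventuallyEq, ae_restrict_iff' hK.measurableSet, ae_iff] at hae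
    refine measure_mono_null (fun y hy => ?_) hae
    simp only [mem_ofPred_eq, Classical.not_imp]
    exact ⟨interior_subset hy.1, hy.2.ne'⟩
  have hemp := gm_open_pos hU hU0
  have hsub : interior K ⊆ L := by
    intro y hy
    have : b y = 0 := by
      by_contra h
      have : y ∈ interior K ∩ {y | 0 < b y} := ⟨hy, lt_of_le_of_ne (hb0 y) (Ne.symm h)⟩
      rw [hemp] at this; exact this
    have hm := ((hL.smul R).isClosed.mem_iff_infDist_zero hLn.smul_set).2 this
    rwa [smul_mem_smul_set_iff₀ hR.ne'] at hm
  exact hIntg.trans (closure_minimal hsub hL.isClosed)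

end

open MeasureTheory Metric Set Filter
open scoped RealInnerProductSpace Topology Pointwise NNReal ENNReal

noncomputable section

/-- convex bodies with the origin in the interior -/
structure CB {n : ℕ} (K : Set (Eu n)) : Prop where
  conv : Convex ℝ K
  comp : IsCompact K
  int0 : (0 : Eu n) ∈ interior K

section supp
variable {n : ℕ} {K L : Set (Eu n)}

lemma suppFun_image_compact (hK : IsCompact K) (v : Eu n) : IsCompact ((fun y => ⟪y, v⟫) '' K) :=
  hK.image (by fun_prop)

lemma le_suppFun (hK : IsCompact K) {y : Eu n} (hy : y ∈ K) (v : Eu n) : ⟪y, v⟫ ≤ suppFun K v :=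
  le_csSup (suppFun_image_compact hK v).bddAbove (mem_image_of_mem _ hy)

lemma suppFun_attained (hK : IsCompact K) (hn : K.Nonempty) (v : Eu n) : ∃ y ∈ K, suppFun K v = ⟪y, v⟫ := by
  obtain ⟨y, hy, h⟩ := (suppFun_image_compact hK v).sSup_mem (hn.image _)
  exact ⟨y, hy, h.symm⟩

lemma suppFun_le (hK : IsCompact K) (hn : K.Nonempty) {v : Eu n} {a : ℝ} (h : ∀ y ∈ K, ⟪y, v⟫ ≤ a) :
    suppFun K v ≤ a := by
  obtain ⟨y, hy, e⟩ := suppFun_attained hK hn v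
  rw [e]; exact h y hy

lemma suppFun_lip (hK : IsCompact K) (hn : K.Nonempty) {R : ℝ} (hR : ∀ y ∈ K, ‖y‖ ≤ R) (v w : Eu n) :
    suppFun K v ≤ suppFun K w + R * ‖v - w‖ := by
  refine suppFun_le hK hn fun y hy => ?_
  have h1 := le_suppFun hK hy w
  have h2 : ⟪y, v - w⟫ ≤ ‖y‖ * ‖v - w‖ := real_inner_le_norm _ _
  have h3 := mul_le_mul_of_nonneg_right (hR y hy) (norm_nonneg (v - w))
  rw [inner_sub_right] at h2
  linarith

lemma suppFun_cont (hK : IsCompact K) (hn : K.Nonempty) : Continuous (suppFun K) := by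
  obtain ⟨R, hR⟩ := hK.isBounded.exists_norm_le
  have hR0 : 0 ≤ R := by
    obtain ⟨y, hy⟩ := hn
    exact (norm_nonneg y).trans (hR y hy)
  have : LipschitzWith ⟨R, hR0⟩ (suppFun K) := LipschitzWith.of_le_add_mul _ fun v w => by
    rw [dist_eq_norm]; exact suppFun_lip hK hn hR v w
  exact this.continuous

lemma suppFun_smul_comb (hK : IsCompact K) (hL : IsCompact L) (hKn : K.Nonempty) (hLn : L.Nonempty) {s t : ℝ}
    (hs : 0 ≤ s) (ht : 0 ≤ t) (v : Eu n) :
    suppFun (s • K + t • L) v = s * suppFun K v + t * suppFun L v := by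
  have hc : IsCompact (s • K + t • L) := (hK.smul s).add (hL.smul t)
  refine le_antisymm ?_ ?_
  · refine suppFun_le hc (hKn.smul_set.add hLn.smul_set) fun y hy => ?_
    obtain ⟨_, ⟨a, ha, rfl⟩, _, ⟨b, hb, rfl⟩, rfl⟩ := hy
    simp only [inner_add_left, real_inner_smul_left]
    have := mul_le_mul_of_nonneg_left (le_suppFun hK ha v) hs
    have := mul_le_mul_of_nonneg_left (le_suppFun hL hb v) ht
    linarith
  · obtain ⟨a, ha, e1⟩ := suppFun_attained hK hKn v
    obtain ⟨b, hb, e2⟩ := suppFun_attained hL hLn v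
    have := le_suppFun hc (add_mem_add (smul_mem_smul_set ha) (smul_mem_smul_set hb)) v (y := s • a + t • b)
    simp only [inner_add_left, real_inner_smul_left] at this
    rw [e1, e2]; exact this

lemma mem_of_inner_le_suppFun (hc : Convex ℝ K) (hK : IsCompact K) (hn : K.Nonempty) {x : Eu n}
    (h : ∀ v : Eu n, ‖v‖ = 1 → ⟪x, v⟫ ≤ suppFun K v) : x ∈ K := by
  by_contra hx
  obtain ⟨f, u, h1, h2⟩ := geometric_hahn_banach_closed_point hc hK.isClosed hx
  set a := (InnerProductSpace.toDual ℝ (Eu n)).symm f with ha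
  have hf : ∀ y, f y = ⟪y, a⟫ := fun y => by
    rw [real_inner_comm, ha, InnerProductSpace.toDual_symm_apply]
  have ha0 : a ≠ 0 := by
    intro h0
    obtain ⟨y, hy⟩ := hn
    have := h1 y hy
    rw [hf, h0] at this h2
    simp only [inner_zero_right] at this h2
    linarith
  have hna : 0 < ‖a‖ := norm_pos_iff.2 ha0
  have h3 := h (‖a‖⁻¹ • a) (by rw [norm_smul, norm_inv, norm_norm, inv_mul_cancel₀ hna.ne'])
  obtain ⟨y, hy, e⟩ := suppFun_attained hK hn (‖a‖⁻¹ • a)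
  rw [e, real_inner_smul_right, real_inner_smul_right] at h3
  have h4 := le_of_mul_le_mul_left h3 (inv_pos.2 hna)
  rw [← hf, ← hf] at h4
  linarith [h1 y hy]

lemma wulff_suppFun (hc : Convex ℝ K) (hK : IsCompact K) (hn : K.Nonempty) : wulff (suppFun K) = K := by
  ext x
  exact ⟨fun h => mem_of_inner_le_suppFun hc hK hn h, fun hx v _ => le_suppFun hK hx v⟩

lemma wulff_convex (g : Eu n → ℝ) : Convex ℝ (wulff g) := by
  intro x hx y hy a b ha hb hab v hv
  rw [inner_add_left, real_inner_smul_left, real_inner_smul_left]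
  have h1 := mul_le_mul_of_nonneg_left (hx v hv) ha
  have h2 := mul_le_mul_of_nonneg_left (hy v hv) hb
  have : a * g v + b * g v = g v := by rw [← add_mul, hab, one_mul]
  linarith

lemma wulff_closed (g : Eu n → ℝ) : IsClosed (wulff g) := by
  have : wulff g = ⋂ v : Eu n, ⋂ (_ : ‖v‖ = 1), {x | ⟪x, v⟫ ≤ g v} := by
    ext x; simp [wulff]
  rw [this]
  exact isClosed_iInter fun v => isClosed_iInter fun _ => isClosed_le (by fun_prop) continuous_const

end supp

section cb
variable {n : ℕ} {K : Set (Eu n)}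

lemma CB.nhds (h : CB K) : K ∈ 𝓝 (0 : Eu n) := mem_interior_iff_mem_nhds.1 h.int0
lemma CB.zero_mem (h : CB K) : (0 : Eu n) ∈ K := interior_subset h.int0
lemma CB.ne (h : CB K) : K.Nonempty := ⟨0, h.zero_mem⟩
lemma CB.absorbent (h : CB K) : Absorbent ℝ K := absorbent_nhds_zero h.nhds
lemma CB.gauge_cont (h : CB K) : Continuous (gauge K) := continuous_gauge h.conv h.nhds
lemma CB.gauge_le_one (h : CB K) {x : Eu n} : gauge K x ≤ 1 ↔ x ∈ K := by
  rw [gauge_le_one_iff_mem_closure h.conv h.nhds, h.comp.isClosed.closure_eq]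
lemma CB.gauge_eq_one (h : CB K) {x : Eu n} : gauge K x = 1 ↔ x ∈ frontier K :=
  gauge_eq_one_iff_mem_frontier h.conv h.nhds
lemma CB.gauge_pos (h : CB K) {x : Eu n} (hx : x ≠ 0) : 0 < gauge K x :=
  (_root_.gauge_pos h.absorbent (NormedSpace.isVonNBounded_iff ℝ |>.2 h.comp.isBounded)).2 hx
lemma CB.gauge_smul (h : CB K) {a : ℝ} (ha : 0 ≤ a) (x : Eu n) : gauge K (a • x) = a * gauge K x := by
  rw [gauge_smul_of_nonneg ha, smul_eq_mul]
lemma CB.gauge_add (h : CB K) (x y : Eu n) : gauge K (x + y) ≤ gauge K x + gauge K y :=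
  gauge_add_le h.conv h.absorbent x y
lemma CB.gauge_convex (h : CB K) : ConvexOn ℝ univ (gauge K) := by
  refine ⟨convex_univ, fun x _ y _ a b ha hb _ => ?_⟩
  refine (h.gauge_add _ _).trans ?_
  rw [h.gauge_smul ha, h.gauge_smul hb]; rfl

lemma CB.suppFun_pos (h : CB K) {v : Eu n} (hv : v ≠ 0) : 0 < suppFun K v := by
  obtain ⟨r, hr, hb⟩ := Metric.mem_nhds_iff.1 h.nhds
  have hn : 0 < ‖v‖ := norm_pos_iff.2 hv
  have hm : (r / 2 * ‖v‖⁻¹) • v ∈ K := by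
    apply hb
    rw [mem_ball_zero_iff, norm_smul, norm_mul, norm_inv, norm_norm, mul_assoc, inv_mul_cancel₀ hn.ne', mul_one,
      Real.norm_of_nonneg (by positivity)]
    linarith
  have := le_suppFun h.comp hm v
  rw [real_inner_smul_left, real_inner_self_eq_norm_sq] at this
  refine lt_of_lt_of_le ?_ this
  positivity

lemma CB.inner_le (h : CB K) (x v : Eu n) : ⟪x, v⟫ ≤ suppFun K v * gauge K x := by
  by_cases hx : x = 0
  · rw [hx, gauge_zero]; simp
  have hg := h.gauge_pos hx
  have hm : (gauge K x)⁻¹ • x ∈ K := by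
    rw [← h.gauge_le_one, h.gauge_smul (inv_pos.2 hg).le, inv_mul_cancel₀ hg.ne']
  have := le_suppFun h.comp hm v
  rw [real_inner_smul_left, inv_mul_le_iff₀ hg] at this
  linarith

lemma CB.lower (h : CB K) : ∃ r > 0, ∀ v : Eu n, ‖v‖ = 1 → r ≤ suppFun K v := by
  obtain ⟨r, hr, hb⟩ := Metric.mem_nhds_iff.1 h.nhds
  refine ⟨r / 2, by positivity, fun v hv => ?_⟩
  have hm : (r / 2) • v ∈ K := by
    apply hb
    rw [mem_ball_zero_iff, norm_smul, hv, mul_one, Real.norm_of_nonneg (by positivity)]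
    linarith
  have := le_suppFun h.comp hm v
  rw [real_inner_smul_left, real_inner_self_eq_norm_sq, hv] at this
  linarith

lemma CB.gauge_lip (h : CB K) : ∃ C : ℝ≥0, LipschitzWith C (gauge K) := h.conv.lipschitz_gauge h.nhds

lemma CB.gauge_fderiv_le (h : CB K) {x : Eu n} {D : Eu n →L[ℝ] ℝ} (hD : HasFDerivAt (gauge K) D x) (y : Eu n) :
    D y ≤ gauge K y := by
  have h1 : HasDerivAt (fun t : ℝ => gauge K (x + t • y)) (D y) 0 := by
    have h2 : HasDerivAt (fun t : ℝ => x + t • y) y 0 := by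
      have := ((hasDerivAt_id (0:ℝ)).smul_const y).const_add x
      exact this.congr_deriv (by simp)
    have h3 : HasFDerivAt (gauge K) D (x + (0:ℝ) • y) := by simpa using hD
    exact h3.comp_hasDerivAt 0 h2
  have h2 := h1.tendsto_slope_zero_right
  refine le_of_tendsto h2 ?_
  filter_upwards [self_mem_nhdsWithin] with t ht
  have ht : 0 < t := ht
  have := h.gauge_add x (t • y)
  rw [h.gauge_smul ht.le] at this
  simp only [zero_add, zero_smul, add_zero, smul_eq_mul]
  rw [inv_mul_le_iff₀ ht]
  linarith

lemma CB.gauge_fderiv_self (h : CB K) {x : Eu n} {D : Eu n →L[ℝ] ℝ} (hD : HasFDerivAt (gauge K) D x) :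
    D x = gauge K x := by
  have h1 : HasDerivAt (fun t : ℝ => gauge K (t • x)) (D x) 1 := by
    have h2 : HasDerivAt (fun t : ℝ => t • x) x 1 :=
      ((hasDerivAt_id (1:ℝ)).smul_const x).congr_deriv (by simp)
    have h3 : HasFDerivAt (gauge K) D ((1:ℝ) • x) := by simpa using hD
    exact h3.comp_hasDerivAt 1 h2
  have h2 : HasDerivAt (fun t : ℝ => gauge K (t • x)) (gauge K x) 1 := by
    have h3 : HasDerivAt (fun t : ℝ => t * gauge K x) (gauge K x) 1 :=
      ((hasDerivAt_id (1:ℝ)).mul_const (gauge K x)).congr_deriv (by simp)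
    refine h3.congr_of_eventuallyEq ?_
    filter_upwards [lt_mem_nhds (zero_lt_one (α := ℝ))] with t ht
    exact h.gauge_smul ht.le x
  exact h1.unique h2

/-- gauge derivative scaling: differentiability along rays. -/
lemma CB.gauge_hasFDerivAt_smul (h : CB K) {x : Eu n} {D : Eu n →L[ℝ] ℝ} (hD : HasFDerivAt (gauge K) D x) {a : ℝ}
    (ha : 0 < a) : HasFDerivAt (gauge K) D (a • x) := by
  have h1 : HasFDerivAt (fun y : Eu n => a⁻¹ • y) (a⁻¹ • ContinuousLinearMap.id ℝ (Eu n)) (a • x) :=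
    (a⁻¹ • ContinuousLinearMap.id ℝ (Eu n)).hasFDerivAt
  have h2 : HasFDerivAt (gauge K) D (a⁻¹ • (a • x)) := by rwa [inv_smul_smul₀ ha.ne']
  have h3 := (h2.comp (a • x) h1).const_smul a
  have e : (a • (gauge K ∘ fun y : Eu n => a⁻¹ • y)) = gauge K := by
    funext y
    simp only [Pi.smul_apply, Function.comp, smul_eq_mul]
    rw [h.gauge_smul (inv_pos.2 ha).le, ← mul_assoc, mul_inv_cancel₀ ha.ne', one_mul]
  rw [e] at h3
  refine h3.congr_fderiv ?_
  ext y
  simp [ha.ne']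

/-- strict differentiability -/
lemma CB.gauge_strict (h : CB K) {x : Eu n} {D : Eu n →L[ℝ] ℝ} (hD : HasFDerivAt (gauge K) D x) {η : ℝ} (hη : 0 < η) :
    ∃ r > 0, (∀ y ∈ ball x r, ∀ z ∈ ball x r, |gauge K y - gauge K z - D (y - z)| ≤ η * ‖y - z‖) ∧
      ∀ y ∈ ball x r, ∀ D' : Eu n →L[ℝ] ℝ, HasFDerivAt (gauge K) D' y → ‖D' - D‖ ≤ η := by
  have h1 := hD.isLittleO.def (show 0 < η / 4 by positivity)
  obtain ⟨r, hr, hb⟩ := Metric.eventually_nhds_iff_ball.1 h1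
  set k : Eu n → ℝ := fun y => gauge K y - gauge K x - D (y - x) with hk
  have hconv : ConvexOn ℝ (ball x r) k := by
    have c1 : ConvexOn ℝ (ball x r) (gauge K) := h.gauge_convex.subset (subset_univ _) (convex_ball x r)
    refine ⟨convex_ball x r, fun y hy z hz a b ha hb hab => ?_⟩
    have := c1.2 hy hz ha hb hab
    simp only [hk, smul_eq_mul, map_sub, map_add, map_smul] at this ⊢
    have e : gauge K x = a * gauge K x + b * gauge K x := by rw [← add_mul, hab, one_mul]
    have e2 : D x = a * D x + b * D x := by rw [← add_mul, hab, one_mul]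
    linarith
  have hlip := hconv.lipschitzOnWith_of_abs_le (ε := r / 2) (M := η / 4 * r) (by positivity) (fun a ha => by
    have := hb a ha
    rw [Real.norm_eq_abs] at this
    refine this.trans ?_
    rw [← dist_eq_norm]
    exact mul_le_mul_of_nonneg_left ha.le (by positivity))
  have eC : 2 * (η / 4 * r) / (r / 2) = η := by field_simp; ring
  rw [eC] at hlip
  have er : r - r / 2 = r / 2 := by ring
  rw [er] at hlip
  refine ⟨r / 2, by positivity, fun y hy z hz => ?_, fun y hy D' hD' => ?_⟩
  · have := hlip.dist_le_mul y hy z hz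
    rw [Real.dist_eq, dist_eq_norm, Real.coe_toNNReal _ hη.le] at this
    convert this using 2
    simp only [hk, map_sub]; ring
  · have h2 : HasFDerivAt k (D' - D) y := by
      have h3 : HasFDerivAt (fun y => D (y - x)) D y := by
        have := (D.hasFDerivAt (x := y)).sub_const (D x)
        simpa using this
      exact (hD'.sub_const _).sub h3
    have := norm_fderiv_le_of_lipschitzOn ℝ (isOpen_ball.mem_nhds hy) hlip
    rw [h2.fderiv, Real.coe_toNNReal _ hη.le] at this
    exact this

/-- normals at regular points -/
lemma CB.normal_unique (h : CB K) {x : Eu n} {D : Eu n →L[ℝ] ℝ} (hx : gauge K x = 1) (hD : HasFDerivAt (gauge K) D x)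
    {v : Eu n} (e : ⟪x, v⟫ = suppFun K v) : ∀ y, ⟪y, v⟫ = suppFun K v * D y := by
  have hmin : IsLocalMin (fun y => suppFun K v * gauge K y - ⟪y, v⟫) x := by
    refine Eventually.of_forall fun y => ?_
    show suppFun K v * gauge K x - ⟪x, v⟫ ≤ suppFun K v * gauge K y - ⟪y, v⟫
    rw [hx, e]
    have := h.inner_le y v
    linarith
  have h1 : HasFDerivAt (fun y => suppFun K v * gauge K y - ⟪y, v⟫) (suppFun K v • D - innerSL ℝ v) x := by
    have h2 : HasFDerivAt (fun y : Eu n => ⟪y, v⟫) (innerSL ℝ v) x := by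
      have := (innerSL ℝ v).hasFDerivAt (x := x)
      refine this.congr_of_eventuallyEq (Eventually.of_forall fun y => ?_)
      exact real_inner_comm _ _
    exact (hD.const_mul _).sub h2
  have h2 := hmin.hasFDerivAt_eq_zero h1
  intro y
  have := congrArg (fun T : Eu n →L[ℝ] ℝ => T y) h2
  simp at this
  rw [real_inner_comm]
  linarith

end cb
end

open MeasureTheory Metric Set Filter
open scoped RealInnerProductSpace Topology Pointwise NNReal ENNReal

noncomputable section
section flat
variable {n : ℕ}

/-- solid cone over a flat set -/
def fcone (a : Eu n) (A : Set (Eu n)) : Set (Eu n) :=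
  {x | 0 < ⟪a, x⟫ ∧ ⟪a, x⟫ ≤ 1 ∧ (⟪a, x⟫)⁻¹ • x ∈ A}

lemma fcone_meas (a : Eu n) {A : Set (Eu n)} (hA : MeasurableSet A) : MeasurableSet (fcone a A) := by
  have h1 : Measurable (fun x : Eu n => ⟪a, x⟫) := by fun_prop
  have h2 : Measurable (fun x : Eu n => (⟪a, x⟫)⁻¹ • x) := by fun_prop
  exact (measurableSet_lt measurable_const h1).inter ((measurableSet_le h1 measurable_const).inter (h2 hA))

lemma flat_cone (hn : 1 ≤ n) {a : Eu n} (ha : a ≠ 0) {A : Set (Eu n)} (hA : MeasurableSet A)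
    (hA1 : ∀ y ∈ A, ⟪a, y⟫ = 1) :
    (n : ℝ≥0∞) * volume (fcone a A) = ‖a‖ₑ⁻¹ * (μHE[n - 1] : Measure (Eu n)) A := by
  have hf : Module.finrank ℝ (Eu n) = n := by simp
  have h0 := InnerProductSpace.euclideanHausdorffMeasure_eq_volume (V := Eu n)
  have h1 := EuclideanGeometry.euclideanHausdorffMeasure_eq_lintegral (0 : Eu n) ha (fcone_meas a hA)
  rw [h0, hf] at h1
  have hpos : 0 < ‖a‖ := norm_pos_iff.2 ha
  have hmem : ∀ (x : ℝ) (y : Eu n), y ∈ AffineSubspace.mk' (x • a +ᵥ (0 : Eu n)) (ℝ ∙ a)ᗮ ↔ ⟪a, y⟫ = x * ‖a‖ ^ 2 := by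
    intro x y
    rw [AffineSubspace.mem_mk', Submodule.mem_orthogonal_singleton_iff_inner_right]
    simp only [vadd_eq_add, add_zero, vsub_eq_sub, inner_sub_right, real_inner_smul_right,
      real_inner_self_eq_norm_sq]
    exact sub_eq_zero
  have hsl : ∀ x : ℝ, (μHE[n - 1] : Measure (Eu n)) (fcone a A ∩ AffineSubspace.mk' (x • a +ᵥ (0 : Eu n)) (ℝ ∙ a)ᗮ)
      = (Ioc (0:ℝ) (‖a‖ ^ 2)⁻¹).indicator (fun x => ENNReal.ofReal ((x * ‖a‖ ^ 2) ^ (n - 1))) x * (μHE[n - 1] : Measure (Eu n)) A := by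
    intro x
    by_cases hx : x ∈ Ioc (0:ℝ) (‖a‖ ^ 2)⁻¹
    · rw [Set.indicator_of_mem hx]
      have hs : 0 < x * ‖a‖ ^ 2 := mul_pos hx.1 (by positivity)
      have hs1 : x * ‖a‖ ^ 2 ≤ 1 := by
        have := mul_le_mul_of_nonneg_right hx.2 (show 0 ≤ ‖a‖ ^ 2 by positivity)
        rwa [inv_mul_cancel₀ (by positivity)] at this
      have : fcone a A ∩ AffineSubspace.mk' (x • a +ᵥ (0 : Eu n)) (ℝ ∙ a)ᗮ = (x * ‖a‖ ^ 2) • A := by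
        ext y
        rw [mem_inter_iff, SetLike.mem_coe, hmem, mem_smul_set_iff_inv_smul_mem₀ hs.ne']
        constructor
        · rintro ⟨⟨_, _, h⟩, e⟩
          rwa [e] at h
        · intro h
          have e := hA1 _ h
          rw [real_inner_smul_right] at e
          have e2 : ⟪a, y⟫ = x * ‖a‖ ^ 2 := ((inv_mul_eq_one₀ hs.ne').1 e).symm
          refine ⟨⟨?_, ?_, ?_⟩, e2⟩ <;> rw [e2] <;> assumption
      rw [this, Measure.euclideanHausdorffMeasure_smul₀ _ hs.ne', ENNReal.smul_def, smul_eq_mul]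
      congr 1
      rw [ENNReal.ofReal_pow hs.le, ENNReal.coe_pow, ← enorm_eq_nnnorm, Real.enorm_eq_ofReal hs.le]
    · rw [Set.indicator_of_notMem hx, zero_mul]
      have : fcone a A ∩ AffineSubspace.mk' (x • a +ᵥ (0 : Eu n)) (ℝ ∙ a)ᗮ = ∅ := by
        rw [eq_empty_iff_forall_notMem]
        rintro y ⟨⟨h1, h2, _⟩, e⟩
        rw [SetLike.mem_coe, hmem] at e
        apply hx
        rw [e] at h1 h2
        refine ⟨pos_of_mul_pos_left h1 (by positivity), ?_⟩
        rw [← one_div, le_div_iff₀ (by positivity)]; exact h2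
      rw [this, measure_empty]
  simp_rw [hsl] at h1
  have hm : Measurable (fun x : ℝ => ENNReal.ofReal ((x * ‖a‖ ^ 2) ^ (n - 1))) := by fun_prop
  rw [lintegral_mul_const _ (hm.indicator measurableSet_Ioc), lintegral_indicator measurableSet_Ioc,
    ← ofReal_integral_eq_lintegral_ofReal] at h1
  · rw [← intervalIntegral.integral_of_le (by positivity)] at h1
    have e : ∫ x in (0:ℝ)..(‖a‖ ^ 2)⁻¹, (x * ‖a‖ ^ 2) ^ (n - 1) = (‖a‖ ^ 2)⁻¹ / n := by
      simp_rw [mul_pow]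
      rw [intervalIntegral.integral_mul_const, integral_pow]
      have : ((n - 1 : ℕ) : ℝ) + 1 = n := by
        rw [Nat.cast_sub hn]; simp
      rw [this, Nat.sub_add_cancel hn, zero_pow (by omega), sub_zero]
      rw [← pow_sub_one_mul (by omega : n ≠ 0) ((‖a‖ ^ 2)⁻¹), inv_pow (‖a‖ ^ 2) (n - 1)]
      have hne : (‖a‖ ^ 2) ^ (n - 1) ≠ 0 := by positivity
      generalize (‖a‖ ^ 2) ^ (n - 1) = q at hne
      field_simp
    rw [e] at h1
    rw [h1, ← ofReal_norm, ← mul_assoc, ← mul_assoc]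
    congr 1
    have hn' : (0:ℝ) < n := by exact_mod_cast hn
    rw [← ENNReal.ofReal_natCast, ← ENNReal.ofReal_mul (by positivity), ← ENNReal.ofReal_mul (by positivity),
      ← ENNReal.ofReal_inv_of_pos hpos]
    congr 1
    field_simp
  · refine (Continuous.integrableOn_Icc (by fun_prop)).mono_set Ioc_subset_Icc_self
  · filter_upwards [ae_restrict_mem measurableSet_Ioc] with x hx
    have := hx.1.le
    simp only [Pi.zero_apply]
    positivity

end flat
end

open MeasureTheory Metric Set Filter
open scoped RealInnerProductSpace Topology Pointwise NNReal ENNReal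

noncomputable section
section loc
variable {n : ℕ} {K : Set (Eu n)}

lemma HE_image_le {f : Eu n → Eu n} {C : ℝ≥0} {s : Set (Eu n)} (hf : LipschitzOnWith C f s) (m : ℕ) :
    (μHE[m] : Measure (Eu n)) (f '' s) ≤ (C : ℝ≥0∞) ^ m * (μHE[m] : Measure (Eu n)) s := by
  rw [Measure.euclideanHausdorffMeasure_def, Measure.smul_apply, Measure.smul_apply, ENNReal.smul_def, ENNReal.smul_def, smul_eq_mul, smul_eq_mul]
  have := hf.hausdorffMeasure_image_le (d := (m : ℝ)) (by positivity)
  rw [ENNReal.rpow_natCast] at this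
  rw [mul_left_comm]
  gcongr

/-- radial projection onto the boundary -/
def rad (K : Set (Eu n)) (x : Eu n) : Eu n := (gauge K x)⁻¹ • x

lemma CB.rad_meas (h : CB K) : Measurable (rad K) := by
  have := h.gauge_cont.measurable
  unfold rad
  fun_prop

lemma CB.rad_smul (h : CB K) {c : ℝ} (hc : 0 < c) (x : Eu n) : rad K (c • x) = rad K x := by
  unfold rad
  rw [h.gauge_smul hc.le, smul_smul]
  congr 1
  field_simp

lemma rad_zero : rad K 0 = 0 := by simp [rad]

lemma CB.gauge_rad (h : CB K) {x : Eu n} (hx : x ≠ 0) : gauge K (rad K x) = 1 := by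
  have := h.gauge_pos hx
  unfold rad
  rw [h.gauge_smul (by positivity)]
  field_simp

lemma CB.rad_mem (h : CB K) {x : Eu n} (hx : x ≠ 0) : rad K x ∈ frontier K := h.gauge_eq_one.1 (h.gauge_rad hx)

lemma CB.gauge_smul_rad (h : CB K) (x : Eu n) : gauge K x • rad K x = x := by
  by_cases hx : x = 0
  · rw [hx, rad_zero, smul_zero]
  exact smul_inv_smul₀ (h.gauge_pos hx).ne' x

lemma CB.rad_of_frontier (h : CB K) {x : Eu n} (hx : x ∈ frontier K) : rad K x = x := by
  unfold rad
  rw [h.gauge_eq_one.2 hx, inv_one, one_smul]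

lemma CB.zero_notMem (h : CB K) : (0 : Eu n) ∉ frontier K := by
  intro h0
  have := h.gauge_eq_one.2 h0
  rw [gauge_zero] at this
  exact zero_ne_one this

/-- the cone volume measure (times n) -/
def coneM (K : Set (Eu n)) : Measure (Eu n) := (n : ℝ≥0∞) • Measure.map (rad K) (volume.restrict K)

lemma CB.coneM_apply (h : CB K) {E : Set (Eu n)} (hE : MeasurableSet E) :
    coneM K E = n * volume (rad K ⁻¹' E ∩ K) := by
  rw [coneM, Measure.smul_apply, Measure.map_apply h.rad_meas hE, Measure.restrict_apply (h.rad_meas hE), smul_eq_mul]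

/-- central projection to a hyperplane -/
def pimg (K : Set (Eu n)) (a : Eu n) (E : Set (Eu n)) : Set (Eu n) := {y | ⟪a, y⟫ = 1 ∧ rad K y ∈ E}

lemma CB.pimg_meas (h : CB K) (a : Eu n) {E : Set (Eu n)} (hE : MeasurableSet E) : MeasurableSet (pimg K a E) := by
  have h1 : Measurable (fun x : Eu n => ⟪a, x⟫) := by fun_prop
  exact (measurableSet_eq_fun h1 measurable_const).inter (h.rad_meas hE)

lemma CB.ne_zero_of_rad (h : CB K) {E : Set (Eu n)} (hEf : E ⊆ frontier K) {x : Eu n} (hx : rad K x ∈ E) : x ≠ 0 := by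
  rintro rfl
  rw [rad_zero] at hx
  exact h.zero_notMem (hEf hx)

lemma CB.cone_compare (h : CB K) (hn : 1 ≤ n) {a : Eu n} (ha : a ≠ 0) {E : Set (Eu n)} (hE : MeasurableSet E)
    (hEf : E ⊆ frontier K) {θ : ℝ≥0} (hθ : 0 < θ) (hE1 : ∀ y ∈ E, (θ : ℝ)⁻¹ ≤ ⟪a, y⟫ ∧ ⟪a, y⟫ ≤ θ) :
    coneM K E ≤ (θ : ℝ≥0∞) ^ n * (‖a‖ₑ⁻¹ * (μHE[n - 1] : Measure (Eu n)) (pimg K a E)) ∧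
    ‖a‖ₑ⁻¹ * (μHE[n - 1] : Measure (Eu n)) (pimg K a E) ≤ (θ : ℝ≥0∞) ^ n * coneM K E := by
  have hθ' : (0:ℝ) < θ := hθ
  rw [← flat_cone hn ha (h.pimg_meas a hE) (fun y hy => hy.1), h.coneM_apply hE]
  have hsc : ∀ S : Set (Eu n), volume ((θ : ℝ) • S) = (θ : ℝ≥0∞) ^ n * volume S := by
    intro S
    rw [Measure.addHaar_smul]
    simp [ENNReal.ofReal_pow]
  constructor
  · rw [mul_left_comm, ← hsc]
    gcongr
    rintro x ⟨hx1, hx2⟩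
    have hx0 := h.ne_zero_of_rad hEf hx1
    have hg := h.gauge_pos hx0
    have hg1 := h.gauge_le_one.2 hx2
    rw [mem_smul_set_iff_inv_smul_mem₀ hθ'.ne']
    obtain ⟨b1, b2⟩ := hE1 _ hx1
    have e : ⟪a, x⟫ = gauge K x * ⟪a, rad K x⟫ := by
      rw [← real_inner_smul_right, h.gauge_smul_rad]
    have hp : 0 < ⟪a, (θ:ℝ)⁻¹ • x⟫ := by
      rw [real_inner_smul_right, e]
      have : 0 < ⟪a, rad K x⟫ := lt_of_lt_of_le (by positivity) b1
      positivity
    refine ⟨hp, ?_, ?_, ?_⟩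
    · rw [real_inner_smul_right, e]
      calc (θ:ℝ)⁻¹ * (gauge K x * ⟪a, rad K x⟫) ≤ (θ:ℝ)⁻¹ * (1 * θ) := by
            have : 0 ≤ ⟪a, rad K x⟫ := le_trans (by positivity) b1
            gcongr
        _ = 1 := by field_simp
    · rw [real_inner_smul_right, inv_mul_cancel₀ hp.ne']
    · rw [h.rad_smul (by positivity), h.rad_smul (by positivity)]; exact hx1
  · rw [mul_left_comm, ← hsc]
    gcongr
    rintro x ⟨p1, p2, p3, p4⟩
    rw [h.rad_smul (by positivity)] at p4
    obtain ⟨b1, b2⟩ := hE1 _ p4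
    have hx0 := h.ne_zero_of_rad hEf p4
    have hg := h.gauge_pos hx0
    rw [mem_smul_set_iff_inv_smul_mem₀ hθ'.ne']
    have e : ⟪a, x⟫ = gauge K x * ⟪a, rad K x⟫ := by
      rw [← real_inner_smul_right, h.gauge_smul_rad]
    refine ⟨?_, ?_⟩
    · show rad K _ ∈ E
      rwa [h.rad_smul (by positivity)]
    · rw [← h.gauge_le_one, h.gauge_smul (by positivity)]
      have : gauge K x * (θ:ℝ)⁻¹ ≤ 1 := by
        refine le_trans ?_ p2
        rw [e]; gcongr
      linarith

lemma CB.pimg_image (h : CB K) {a : Eu n} {E : Set (Eu n)} (hEf : E ⊆ frontier K) (hp : ∀ y ∈ E, 0 < ⟪a, y⟫) :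
    pimg K a E = (fun y => (⟪a, y⟫)⁻¹ • y) '' E := by
  ext y
  constructor
  · rintro ⟨h1, h2⟩
    refine ⟨rad K y, h2, ?_⟩
    have hy0 := h.ne_zero_of_rad hEf h2
    have hg := h.gauge_pos hy0
    simp only [rad, real_inner_smul_right, h1, mul_one, inv_inv, smul_smul]
    rw [mul_inv_cancel₀ hg.ne', one_smul]
  · rintro ⟨z, hz, rfl⟩
    have := hp z hz
    refine ⟨?_, ?_⟩
    · rw [real_inner_smul_right, inv_mul_cancel₀ this.ne']
    · rw [h.rad_smul (by positivity), h.rad_of_frontier (hEf hz)]; exact hz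

lemma CB.rad_pimg (h : CB K) {a : Eu n} {E : Set (Eu n)} (hEf : E ⊆ frontier K) (hp : ∀ y ∈ E, 0 < ⟪a, y⟫) :
    rad K '' pimg K a E = E := by
  rw [h.pimg_image hEf hp, image_image]
  conv_rhs => rw [← image_id E]
  refine image_congr fun y hy => ?_
  have := hp y hy
  rw [h.rad_smul (by positivity), h.rad_of_frontier (hEf hy), id]

end loc
end

open MeasureTheory Metric Set Filter
open scoped RealInnerProductSpace Topology Pointwise NNReal ENNReal

noncomputable section
section loc2
variable {n : ℕ} {K : Set (Eu n)}

lemma inv_smul_diff {s t : ℝ} (hs : s ≠ 0) (ht : t ≠ 0) (y z : Eu n) :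
    s⁻¹ • y - t⁻¹ • z = s⁻¹ • (y - z) + ((t - s) / (s * t)) • z := by
  have : (t - s) / (s * t) = s⁻¹ - t⁻¹ := by field_simp
  rw [this, sub_smul, smul_sub]; abel

lemma eta_exists (M : ℝ) {c θ : ℝ} (hc : 0 < c) (hθ : 1 < θ) : ∃ η > 0, 1 + η ≤ θ ∧ θ⁻¹ ≤ 1 - η ∧
    (1 - η)⁻¹ + M * (η / (1 - η) ^ 2) ≤ θ ∧ θ⁻¹ ≤ (1 + η)⁻¹ - M * (η / (1 - η) ^ 2) ∧ η ≤ (1 - θ⁻¹) * c ∧ η ≤ (θ - 1) * c := by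
  have hi : θ⁻¹ < 1 := inv_lt_one_of_one_lt₀ hθ
  have t1 : Tendsto (fun η : ℝ => 1 + η) (𝓝[>] 0) (𝓝 1) := by
    have : ContinuousAt (fun η : ℝ => 1 + η) 0 := by fun_prop
    have := this.tendsto.mono_left (nhdsWithin_le_nhds (s := Ioi 0)); simpa using this
  have t2 : Tendsto (fun η : ℝ => 1 - η) (𝓝[>] 0) (𝓝 1) := by
    have : ContinuousAt (fun η : ℝ => 1 - η) 0 := by fun_prop
    have := this.tendsto.mono_left (nhdsWithin_le_nhds (s := Ioi 0)); simpa using this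
  have t0 : Tendsto (fun η : ℝ => η) (𝓝[>] 0) (𝓝 0) := nhdsWithin_le_nhds
  have t3 : Tendsto (fun η : ℝ => M * (η / (1 - η) ^ 2)) (𝓝[>] 0) (𝓝 0) := by
    have := (t0.div (t2.pow 2) (by norm_num)).const_mul M
    simpa using this
  have t4 : Tendsto (fun η : ℝ => (1 - η)⁻¹ + M * (η / (1 - η) ^ 2)) (𝓝[>] 0) (𝓝 1) := by
    have := (t2.inv₀ one_ne_zero).add t3
    simpa using this
  have t5 : Tendsto (fun η : ℝ => (1 + η)⁻¹ - M * (η / (1 - η) ^ 2)) (𝓝[>] 0) (𝓝 1) := by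
    have := (t1.inv₀ one_ne_zero).sub t3
    simpa using this
  have p1 : 0 < (1 - θ⁻¹) * c := mul_pos (by linarith) hc
  have p2 : 0 < (θ - 1) * c := mul_pos (by linarith) hc
  have hall := (((((t1.eventually_lt_const hθ).and (t2.eventually_const_lt hi)).and (t4.eventually_lt_const hθ)).and
    (t5.eventually_const_lt hi)).and ((t0.eventually_lt_const p1).and (t0.eventually_lt_const p2))).and
    (self_mem_nhdsWithin : Ioi (0:ℝ) ∈ 𝓝[>] 0)
  obtain ⟨η, ⟨⟨⟨⟨a1, a2⟩, a3⟩, a4⟩, a5, a6⟩, a7⟩ := hall.exists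
  exact ⟨η, a7, a1.le, a2.le, a3.le, a4.le, a5.le, a6.le⟩

lemma CB.local_reg (h : CB K) (hn : 1 ≤ n) {x : Eu n} (hx : x ∈ frontier K) {a : Eu n}
    (hD : HasFDerivAt (gauge K) (innerSL ℝ a) x) {θ : ℝ≥0} (hθ : 1 < θ) :
    ∃ r > 0, (∀ E, MeasurableSet E → E ⊆ frontier K ∩ ball x r →
      (μHE[n - 1] : Measure (Eu n)) E ≤ (θ : ℝ≥0∞) ^ (2 * n - 1) * (‖a‖ₑ * coneM K E) ∧
      ‖a‖ₑ * coneM K E ≤ (θ : ℝ≥0∞) ^ (2 * n - 1) * (μHE[n - 1] : Measure (Eu n)) E) ∧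
      ∀ y ∈ ball x r, ∀ D' : Eu n →L[ℝ] ℝ, HasFDerivAt (gauge K) D' y → ‖D'‖ ≤ θ * ‖a‖ ∧ ‖a‖ ≤ θ * ‖D'‖ := by
  have hθ1 : (1:ℝ) < θ := hθ
  have hθ0 : (0:ℝ) < θ := by linarith
  have hgx := h.gauge_eq_one.2 hx
  have hax : ⟪a, x⟫ = 1 := by
    have := h.gauge_fderiv_self hD
    rw [hgx] at this; simpa using this
  have ha : a ≠ 0 := by
    rintro rfl
    simp at hax
  have hna : 0 < ‖a‖ := norm_pos_iff.2 ha
  obtain ⟨η, hη, e1, e2, e3, e4, e5, e6⟩ := eta_exists (‖x‖ + 1) hna hθ1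
  obtain ⟨r, hr, h1, h2⟩ := h.gauge_strict hD hη
  have hη1 : η < 1 := by
    have : 0 < (θ:ℝ)⁻¹ := by positivity
    linarith
  refine ⟨min r 1, by positivity, fun E hE hEs => ?_, fun y hy D' hD' => ?_⟩
  · have hEf : E ⊆ frontier K := hEs.trans inter_subset_left
    have hb : ∀ y ∈ E, y ∈ ball x r ∧ dist y x < 1 := fun y hy =>
      ⟨ball_subset_ball (min_le_left _ _) (hEs hy).2, ball_subset_ball (min_le_right r 1) (hEs hy).2⟩
    have hdiff : ∀ y ∈ frontier K ∩ ball x r, ∀ z ∈ frontier K ∩ ball x r, |⟪a, z⟫ - ⟪a, y⟫| ≤ η * ‖y - z‖ := by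
      intro y hy z hz
      have := h1 y hy.2 z hz.2
      rw [h.gauge_eq_one.2 hy.1, h.gauge_eq_one.2 hz.1] at this
      simp only [innerSL_apply_apply, inner_sub_right] at this
      convert this using 2
      ring
    have hay : ∀ y ∈ E, 1 - η ≤ ⟪a, y⟫ ∧ ⟪a, y⟫ ≤ 1 + η := by
      intro y hy
      have := hdiff y ⟨hEf hy, (hb y hy).1⟩ x ⟨hx, mem_ball_self hr⟩
      rw [hax, ← dist_eq_norm] at this
      have h3 : η * dist y x ≤ η * 1 := mul_le_mul_of_nonneg_left (hb y hy).2.le hη.le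
      rw [abs_le] at this
      constructor <;> linarith [this.1, this.2]
    have hp : ∀ y ∈ E, 0 < ⟪a, y⟫ := fun y hy => by linarith [(hay y hy).1]
    have hnz : ∀ z ∈ E, ‖z‖ ≤ ‖x‖ + 1 := by
      intro z hz
      have := (hb z hz).2
      rw [dist_eq_norm] at this
      linarith [norm_le_norm_add_norm_sub' z x]
    have key : ∀ y ∈ E, ∀ z ∈ E, ‖((⟪a, z⟫ - ⟪a, y⟫) / (⟪a, y⟫ * ⟪a, z⟫)) • z‖ ≤ (‖x‖ + 1) * (η / (1 - η) ^ 2) * ‖y - z‖ := by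
      intro y hy z hz
      have d := hdiff y ⟨hEf hy, (hb y hy).1⟩ z ⟨hEf hz, (hb z hz).1⟩
      have py := hp y hy
      have pz := hp z hz
      rw [norm_smul, Real.norm_eq_abs, abs_div, abs_of_pos (mul_pos py pz)]
      have q : (1 - η) ^ 2 ≤ ⟪a, y⟫ * ⟪a, z⟫ := by
        rw [sq]; exact mul_le_mul (hay y hy).1 (hay z hz).1 (by linarith) py.le
      have q0 : 0 < (1 - η) ^ 2 := by
        have : 0 < 1 - η := by linarith
        positivity
      calc |⟪a, z⟫ - ⟪a, y⟫| / (⟪a, y⟫ * ⟪a, z⟫) * ‖z‖ ≤ (η * ‖y - z‖) / (1 - η) ^ 2 * (‖x‖ + 1) := by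
            gcongr
            exact hnz z hz
        _ = _ := by ring
    have L1 : LipschitzOnWith θ (fun y => (⟪a, y⟫)⁻¹ • y) E := by
      refine LipschitzOnWith.of_dist_le_mul fun y hy z hz => ?_
      rw [dist_eq_norm, dist_eq_norm, inv_smul_diff (hp y hy).ne' (hp z hz).ne']
      refine (norm_add_le _ _).trans ?_
      have k := key y hy z hz
      have k2 : ‖(⟪a, y⟫)⁻¹ • (y - z)‖ ≤ (1 - η)⁻¹ * ‖y - z‖ := by
        rw [norm_smul, Real.norm_eq_abs, abs_of_pos (inv_pos.2 (hp y hy))]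
        gcongr
        exact (hay y hy).1
      have := mul_le_mul_of_nonneg_right e3 (norm_nonneg (y - z))
      linarith
    have L2' : ∀ y ∈ E, ∀ z ∈ E, ‖y - z‖ ≤ θ * ‖(⟪a, y⟫)⁻¹ • y - (⟪a, z⟫)⁻¹ • z‖ := by
      intro y hy z hz
      rw [inv_smul_diff (hp y hy).ne' (hp z hz).ne']
      have k := key y hy z hz
      have k2 : (1 + η)⁻¹ * ‖y - z‖ ≤ ‖(⟪a, y⟫)⁻¹ • (y - z)‖ := by
        rw [norm_smul, Real.norm_eq_abs, abs_of_pos (inv_pos.2 (hp y hy))]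
        gcongr
        · exact hp y hy
        · exact (hay y hy).2
      have k3 := norm_sub_le_norm_add ((⟪a, y⟫)⁻¹ • (y - z)) (((⟪a, z⟫ - ⟪a, y⟫) / (⟪a, y⟫ * ⟪a, z⟫)) • z)
      have := mul_le_mul_of_nonneg_right e4 (norm_nonneg (y - z))
      rw [← div_le_iff₀' hθ0, div_eq_inv_mul]
      linarith
    have L2 : LipschitzOnWith θ (rad K) (pimg K a E) := by
      rw [h.pimg_image hEf hp]
      refine LipschitzOnWith.of_dist_le_mul ?_
      rintro _ ⟨y, hy, rfl⟩ _ ⟨z, hz, rfl⟩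
      simp only
      rw [h.rad_smul (inv_pos.2 (hp y hy)), h.rad_smul (inv_pos.2 (hp z hz)), h.rad_of_frontier (hEf hy),
        h.rad_of_frontier (hEf hz), dist_eq_norm, dist_eq_norm]
      exact L2' y hy z hz
    obtain ⟨c1, c2⟩ := h.cone_compare hn ha hE hEf (θ := θ) (by exact_mod_cast hθ0)
      (fun y hy => ⟨e2.trans (hay y hy).1, (hay y hy).2.trans e1⟩)
    have i1 := HE_image_le L1 (n - 1)
    have i2 := HE_image_le L2 (n - 1)
    rw [← h.pimg_image hEf hp] at i1
    rw [h.rad_pimg hEf hp] at i2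
    have ha0 : ‖a‖ₑ ≠ 0 := by simpa using ha
    have hat : ‖a‖ₑ ≠ ⊤ := enorm_ne_top
    have hpw : (θ : ℝ≥0∞) ^ (2 * n - 1) = (θ : ℝ≥0∞) ^ (n - 1) * (θ : ℝ≥0∞) ^ n := by
      rw [← pow_add]; congr 1; omega
    rw [hpw]
    constructor
    · refine i2.trans ?_
      rw [mul_assoc]
      gcongr
      calc (μHE[n - 1] : Measure (Eu n)) (pimg K a E) = ‖a‖ₑ * (‖a‖ₑ⁻¹ * (μHE[n - 1] : Measure (Eu n)) (pimg K a E)) := by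
            rw [← mul_assoc, ENNReal.mul_inv_cancel ha0 hat, one_mul]
        _ ≤ ‖a‖ₑ * ((θ : ℝ≥0∞) ^ n * coneM K E) := by gcongr
        _ = _ := by ring
    · calc ‖a‖ₑ * coneM K E ≤ ‖a‖ₑ * ((θ : ℝ≥0∞) ^ n * (‖a‖ₑ⁻¹ * (μHE[n - 1] : Measure (Eu n)) (pimg K a E))) := by gcongr
        _ = (‖a‖ₑ * ‖a‖ₑ⁻¹) * ((θ : ℝ≥0∞) ^ n * (μHE[n - 1] : Measure (Eu n)) (pimg K a E)) := by ring
        _ = (θ : ℝ≥0∞) ^ n * (μHE[n - 1] : Measure (Eu n)) (pimg K a E) := by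
          rw [ENNReal.mul_inv_cancel ha0 hat, one_mul]
        _ ≤ (θ : ℝ≥0∞) ^ n * ((θ : ℝ≥0∞) ^ (n - 1) * (μHE[n - 1] : Measure (Eu n)) E) := by gcongr
        _ = _ := by ring
  · have := h2 y (ball_subset_ball (min_le_left _ _) hy) D' hD'
    have na : ‖innerSL ℝ a‖ = ‖a‖ := innerSL_apply_norm ..
    have n1 := norm_sub_norm_le D' (innerSL ℝ a)
    have n2 := norm_sub_norm_le (innerSL ℝ a) D'
    rw [norm_sub_rev] at n2
    rw [na] at n1 n2
    constructor
    · linarith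
    · have : (θ:ℝ)⁻¹ * ‖a‖ ≤ ‖D'‖ := by linarith
      rwa [inv_mul_le_iff₀ hθ0] at this

lemma CB.local_null (h : CB K) (hn : 1 ≤ n) {x : Eu n} (hx : x ∈ frontier K) :
    ∃ r > 0, ∀ E, MeasurableSet E → E ⊆ frontier K ∩ ball x r → coneM K E = 0 → (μHE[n - 1] : Measure (Eu n)) E = 0 := by
  have hx0 : x ≠ 0 := by rintro rfl; exact h.zero_notMem hx
  have hnx : 0 < ‖x‖ := norm_pos_iff.2 hx0
  set a : Eu n := (‖x‖ ^ 2)⁻¹ • x with ha'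
  have hax : ⟪a, x⟫ = 1 := by
    rw [ha', real_inner_smul_left, real_inner_self_eq_norm_sq, inv_mul_cancel₀ (by positivity)]
  have ha : a ≠ 0 := by
    rintro h0
    rw [h0] at hax; simp at hax
  obtain ⟨L, hL⟩ := h.gauge_lip
  have hc : Continuous (fun y : Eu n => ⟪a, y⟫) := by fun_prop
  have ev1 : ∀ᶠ y in 𝓝 x, (2:ℝ)⁻¹ < ⟪a, y⟫ := hc.continuousAt.eventually_const_lt (by simp only [hax]; norm_num)
  have ev2 : ∀ᶠ y in 𝓝 x, ⟪a, y⟫ < 2 := hc.continuousAt.eventually_lt_const (by simp only [hax]; norm_num)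
  obtain ⟨r, hr, hb⟩ := Metric.eventually_nhds_iff_ball.1 (ev1.and ev2)
  refine ⟨r, hr, fun E hE hEs h0 => ?_⟩
  have hEf : E ⊆ frontier K := hEs.trans inter_subset_left
  have hbE : ∀ y ∈ E, (2:ℝ)⁻¹ ≤ ⟪a, y⟫ ∧ ⟪a, y⟫ ≤ 2 := fun y hy => ⟨(hb y (hEs hy).2).1.le, (hb y (hEs hy).2).2.le⟩
  have hp : ∀ y ∈ E, 0 < ⟪a, y⟫ := fun y hy => by linarith [(hbE y hy).1]
  obtain ⟨c1, c2⟩ := h.cone_compare hn ha hE hEf (θ := 2) (by norm_num) (by simpa using hbE)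
  rw [h0, mul_zero] at c2
  have hz : (μHE[n - 1] : Measure (Eu n)) (pimg K a E) = 0 := by
    have := nonpos_iff_eq_zero.1 c2
    rw [mul_eq_zero] at this
    rcases this with h | h
    · rw [ENNReal.inv_eq_zero] at h; exact absurd h enorm_ne_top
    · exact h
  set M := ‖x‖ + r with hM
  have hM0 : 0 < M := by positivity
  have L2 : LipschitzOnWith (2 + 4 * L * M.toNNReal) (rad K) (pimg K a E) := by
    have gw : ∀ w ∈ pimg K a E, gauge K w = (⟪a, rad K w⟫)⁻¹ ∧ 0 < gauge K w := by
      intro w hw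
      have hw0 := h.ne_zero_of_rad hEf hw.2
      have := h.gauge_pos hw0
      refine ⟨?_, this⟩
      rw [rad, real_inner_smul_right, hw.1, mul_one, inv_inv]
    have gb : ∀ w ∈ pimg K a E, (2:ℝ)⁻¹ ≤ gauge K w := by
      intro w hw
      rw [(gw w hw).1]
      exact inv_anti₀ (hp _ hw.2) (hbE _ hw.2).2
    refine LipschitzOnWith.of_dist_le_mul fun y hy z hz => ?_
    obtain ⟨_, py⟩ := gw y hy
    obtain ⟨_, pz⟩ := gw z hz
    have hy2 := gb y hy
    have e : rad K y - rad K z = (gauge K y)⁻¹ • (y - z) + ((gauge K z - gauge K y) / (gauge K y)) • rad K z := by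
      rw [rad, rad, inv_smul_diff py.ne' pz.ne', smul_smul]
      congr 2
      field_simp
    rw [dist_eq_norm, dist_eq_norm, e]
    refine (norm_add_le _ _).trans ?_
    have k1 : ‖(gauge K y)⁻¹ • (y - z)‖ ≤ 2 * ‖y - z‖ := by
      rw [norm_smul, Real.norm_eq_abs, abs_of_pos (inv_pos.2 py)]
      gcongr
      exact inv_le_of_inv_le₀ (by norm_num) hy2
    have k2 : ‖((gauge K z - gauge K y) / (gauge K y)) • rad K z‖ ≤ (2 * L * M) * ‖y - z‖ := by
      rw [norm_smul, Real.norm_eq_abs, abs_div, abs_of_pos py]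
      have l1 := hL.dist_le_mul z y
      rw [Real.dist_eq, dist_comm, dist_eq_norm] at l1
      have l2 : ‖rad K z‖ ≤ M := by
        have := (hEs hz.2).2
        rw [mem_ball, dist_eq_norm] at this
        linarith [norm_le_norm_add_norm_sub' (rad K z) x]
      calc |gauge K z - gauge K y| / gauge K y * ‖rad K z‖ ≤ (L * ‖y - z‖) / 2⁻¹ * M := by gcongr
        _ = _ := by ring
    have : ((2 + 4 * L * M.toNNReal : ℝ≥0) : ℝ) = 2 + 4 * L * M := by
      push_cast
      rw [Real.coe_toNNReal _ hM0.le]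
    rw [this]
    have : 0 ≤ L * M * ‖y - z‖ := by positivity
    linarith
  have i2 := HE_image_le L2 (n - 1)
  rw [h.rad_pimg hEf hp, hz, mul_zero] at i2
  exact nonpos_iff_eq_zero.1 i2

end loc2
end

open MeasureTheory Metric Set Filter
open scoped RealInnerProductSpace Topology Pointwise NNReal ENNReal

noncomputable section
section glob
variable {n : ℕ} {K : Set (Eu n)}

lemma loc_glob {μ ν : Measure (Eu n)} {S : Set (Eu n)}
    (hloc : ∀ x ∈ S, ∃ r > 0, ∀ E, MeasurableSet E → E ⊆ S ∩ ball x r → μ E ≤ ν E) {E : Set (Eu n)}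
    (hE : MeasurableSet E) (hES : E ⊆ S) : μ E ≤ ν E := by
  choose! r hr hb using hloc
  obtain ⟨t, htS, htc, hcov⟩ := TopologicalSpace.countable_cover_nhdsWithin (s := S) (f := fun x => ball x (r x))
    (fun x hx => mem_nhdsWithin_of_mem_nhds (ball_mem_nhds x (hr x hx)))
  rcases t.eq_empty_or_nonempty with h0 | hne
  · rw [h0] at hcov
    have : E = ∅ := by
      rw [eq_empty_iff_forall_notMem]
      intro x hx
      have := hcov (hES hx)
      simp at this
    rw [this]; simp
  obtain ⟨f, hf⟩ := htc.exists_eq_range hne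
  set U : ℕ → Set (Eu n) := fun i => ball (f i) (r (f i)) with hU
  have hUm : ∀ i, MeasurableSet (disjointed U i) := fun i => MeasurableSet.disjointed (fun i => measurableSet_ball) i
  have hEU : E = ⋃ i, E ∩ disjointed U i := by
    rw [← inter_iUnion, iUnion_disjointed, eq_comm, inter_eq_left]
    intro x hx
    have := hcov (hES hx)
    rw [hf] at this
    simpa [hU] using this
  have hd : Pairwise (Function.onFun Disjoint fun i => E ∩ disjointed U i) := by
    intro i j hij
    exact (disjoint_disjointed U hij).mono inter_subset_right inter_subset_right
  rw [hEU, measure_iUnion hd (fun i => hE.inter (hUm i)), measure_iUnion hd (fun i => hE.inter (hUm i))]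
  refine ENNReal.tsum_le_tsum fun i => ?_
  refine hb (f i) (htS (hf ▸ mem_range_self i)) _ (hE.inter (hUm i)) ?_
  exact inter_subset_inter hES (disjointed_subset U i)

lemma CB.frontier_meas : MeasurableSet (frontier K) := isClosed_frontier.measurableSet

lemma CB.ae_ne (hn : 1 ≤ n) : ∀ᵐ x : Eu n, x ≠ 0 := by
  haveI : Nontrivial (Eu n) := by
    haveI : Nonempty (Fin n) := ⟨⟨0, hn⟩⟩
    infer_instance
  have : volume ({0} : Set (Eu n)) = 0 := measure_singleton _
  rw [ae_iff]; simpa using this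

lemma CB.ae_reg (h : CB K) : ∀ᵐ x : Eu n, DifferentiableAt ℝ (gauge K) x := by
  obtain ⟨C, hC⟩ := h.gauge_lip
  exact hC.ae_differentiableAt

lemma CB.rad_reg (h : CB K) {x : Eu n} (hx : x ≠ 0) (hd : DifferentiableAt ℝ (gauge K) x) :
    HasFDerivAt (gauge K) (fderiv ℝ (gauge K) x) (rad K x) :=
  h.gauge_hasFDerivAt_smul hd.hasFDerivAt (inv_pos.2 (h.gauge_pos hx))

lemma CB.coneM_ae (h : CB K) (hn : 1 ≤ n) :
    ∀ᵐ x ∂(coneM K), x ∈ frontier K ∧ DifferentiableAt ℝ (gauge K) x := by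
  have h1 : ∀ᵐ x ∂(Measure.map (rad K) (volume.restrict K)), x ∈ frontier K ∧ DifferentiableAt ℝ (gauge K) x := by
    rw [ae_map_iff h.rad_meas.aemeasurable]
    · refine ae_restrict_of_ae ?_
      filter_upwards [CB.ae_ne hn, h.ae_reg] with x hx hd
      exact ⟨h.rad_mem hx, (h.rad_reg hx hd).differentiableAt⟩
    · exact CB.frontier_meas.inter (measurableSet_of_differentiableAt ℝ (gauge K))
  exact Measure.ae_smul_measure h1 _

instance CB.coneM_finite [Fact (CB K)] : IsFiniteMeasure (coneM K) := by
  have h : CB K := Fact.out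
  refine ⟨?_⟩
  rw [h.coneM_apply MeasurableSet.univ]
  refine ENNReal.mul_lt_top (ENNReal.natCast_lt_top n) ?_
  refine lt_of_le_of_lt (measure_mono inter_subset_right) h.comp.measure_lt_top

lemma CB.HE_nonreg (h : CB K) (hn : 1 ≤ n) :
    (μHE[n - 1] : Measure (Eu n)) (frontier K ∩ {x | DifferentiableAt ℝ (gauge K) x}ᶜ) = 0 := by
  have hm : MeasurableSet (frontier K ∩ {x | DifferentiableAt ℝ (gauge K) x}ᶜ) :=
    CB.frontier_meas.inter (measurableSet_of_differentiableAt ℝ (gauge K)).compl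
  have hV : coneM K (frontier K ∩ {x | DifferentiableAt ℝ (gauge K) x}ᶜ) = 0 := by
    have := h.coneM_ae hn
    rw [ae_iff] at this
    refine measure_mono_null ?_ this
    rintro x ⟨_, hx⟩ ⟨_, hx2⟩
    exact hx hx2
  refine measure_null_of_locally_null _ fun x hx => ?_
  obtain ⟨r, hr, hb⟩ := h.local_null hn hx.1
  refine ⟨_, inter_mem_nhdsWithin _ (ball_mem_nhds x hr), ?_⟩
  refine hb _ (hm.inter measurableSet_ball) (inter_subset_inter inter_subset_left subset_rfl) ?_
  exact measure_mono_null inter_subset_left hV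

theorem CB.surf_eq (h : CB K) (hn : 1 ≤ n) :
    (μHE[n - 1] : Measure (Eu n)).restrict (frontier K) = (coneM K).withDensity (fun x => ‖fderiv ℝ (gauge K) x‖ₑ) := by
  set S := frontier K ∩ {x | DifferentiableAt ℝ (gauge K) x} with hS
  have hSm : MeasurableSet S := CB.frontier_meas.inter (measurableSet_of_differentiableAt ℝ (gauge K))
  set W := (coneM K).withDensity (fun x => ‖fderiv ℝ (gauge K) x‖ₑ) with hW
  have hmf : Measurable (fun x => ‖fderiv ℝ (gauge K) x‖ₑ) := (measurable_fderiv ℝ (gauge K)).enorm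
  have hWS : W Sᶜ = 0 := by
    have : W ≪ coneM K := withDensity_absolutelyContinuous _ _
    exact this (h.coneM_ae hn)
  have hloc : ∀ θ : ℝ≥0, 1 < θ → ∀ x ∈ S, ∃ r > 0, ∀ E, MeasurableSet E → E ⊆ S ∩ ball x r →
      (μHE[n - 1] : Measure (Eu n)) E ≤ ((θ : ℝ≥0∞) ^ (2 * n) • W) E ∧ W E ≤ ((θ : ℝ≥0∞) ^ (2 * n) • (μHE[n - 1] : Measure (Eu n))) E := by
    intro θ hθ x hx
    set a := (InnerProductSpace.toDual ℝ (Eu n)).symm (fderiv ℝ (gauge K) x) with ha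
    have hia : innerSL ℝ a = fderiv ℝ (gauge K) x := by
      ext y
      rw [innerSL_apply_apply, ha, InnerProductSpace.toDual_symm_apply]
    have hD : HasFDerivAt (gauge K) (innerSL ℝ a) x := by rw [hia]; exact hx.2.hasFDerivAt
    obtain ⟨r, hr, h1, h2⟩ := h.local_reg hn hx.1 hD hθ
    refine ⟨r, hr, fun E hE hEs => ?_⟩
    obtain ⟨i1, i2⟩ := h1 E hE (hEs.trans (inter_subset_inter inter_subset_left subset_rfl))
    have hpw : (θ : ℝ≥0∞) ^ (2 * n) = (θ : ℝ≥0∞) ^ (2 * n - 1) * θ := by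
      rw [← pow_succ]; congr 1; omega
    have hWE : W E = ∫⁻ x in E, ‖fderiv ℝ (gauge K) x‖ₑ ∂(coneM K) := withDensity_apply _ hE
    have hb : ∀ y ∈ E, ‖fderiv ℝ (gauge K) y‖ₑ ≤ θ * ‖a‖ₑ ∧ ‖a‖ₑ ≤ θ * ‖fderiv ℝ (gauge K) y‖ₑ := by
      intro y hy
      obtain ⟨b1, b2⟩ := h2 y (hEs hy).2 _ (hEs hy).1.2.hasFDerivAt
      rw [enorm_eq_nnnorm, enorm_eq_nnnorm]
      constructor
      · exact_mod_cast b1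
      · exact_mod_cast b2
    have w1 : W E ≤ θ * (‖a‖ₑ * coneM K E) := by
      rw [hWE]
      refine (setLIntegral_mono measurable_const fun y hy => (hb y hy).1).trans ?_
      rw [setLIntegral_const, mul_assoc]
    have w2 : ‖a‖ₑ * coneM K E ≤ θ * W E := by
      rw [hWE, ← lintegral_const_mul _ hmf, ← setLIntegral_const]
      exact setLIntegral_mono (hmf.const_mul _) fun y hy => (hb y hy).2
    rw [Measure.smul_apply, Measure.smul_apply, smul_eq_mul, smul_eq_mul, hpw]
    constructor
    · refine i1.trans ?_
      rw [mul_assoc]; gcongr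
    · refine w1.trans ?_
      rw [mul_comm ((θ : ℝ≥0∞) ^ (2 * n - 1)), mul_assoc]; gcongr
  have lim : ∀ A B : ℝ≥0∞, (∀ θ : ℝ≥0, 1 < θ → A ≤ (θ : ℝ≥0∞) ^ (2 * n) * B) → A ≤ B := by
    intro A B hAB
    by_cases hB : B = ⊤
    · rw [hB]; exact le_top
    have t : Tendsto (fun θ : ℝ≥0 => (θ : ℝ≥0∞) ^ (2 * n) * B) (𝓝[>] 1) (𝓝 (1 * B)) := by
      refine ENNReal.Tendsto.mul_const ?_ (Or.inr hB)
      have : Tendsto (fun θ : ℝ≥0 => ((θ ^ (2 * n) : ℝ≥0) : ℝ≥0∞)) (𝓝[>] 1) (𝓝 ((1 ^ (2 * n) : ℝ≥0) : ℝ≥0∞)) := by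
        rw [ENNReal.tendsto_coe]
        exact ((continuous_id.pow (2 * n)).tendsto (1 : ℝ≥0)).mono_left nhdsWithin_le_nhds
      simpa using this
    rw [one_mul] at t
    haveI : (𝓝[>] (1:ℝ≥0)).NeBot := inferInstance
    exact ge_of_tendsto t (by filter_upwards [self_mem_nhdsWithin] with θ hθ using hAB θ hθ)
  have eqS : ∀ E, MeasurableSet E → E ⊆ S → (μHE[n - 1] : Measure (Eu n)) E = W E := by
    intro E hE hES
    refine le_antisymm (lim _ _ fun θ hθ => ?_) (lim _ _ fun θ hθ => ?_)
    · exact loc_glob (ν := (θ : ℝ≥0∞) ^ (2 * n) • W) (fun x hx => by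
        obtain ⟨r, hr, hb⟩ := hloc θ hθ x hx
        exact ⟨r, hr, fun E hE hEs => (hb E hE hEs).1⟩) hE hES
    · exact loc_glob (ν := (θ : ℝ≥0∞) ^ (2 * n) • (μHE[n - 1] : Measure (Eu n))) (fun x hx => by
        obtain ⟨r, hr, hb⟩ := hloc θ hθ x hx
        exact ⟨r, hr, fun E hE hEs => (hb E hE hEs).2⟩) hE hES
  ext E hE
  rw [Measure.restrict_apply hE]
  have e1 : W E = W (E ∩ S) := by
    refine le_antisymm ?_ (measure_mono inter_subset_left)
    refine (measure_le_inter_add_sdiff W E S).trans ?_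
    rw [measure_mono_null (fun x hx => hx.2 : E \ S ⊆ Sᶜ) hWS, add_zero]
  have e2 : (μHE[n - 1] : Measure (Eu n)) (E ∩ frontier K) = (μHE[n - 1] : Measure (Eu n)) (E ∩ S) := by
    refine le_antisymm ?_ (measure_mono (inter_subset_inter_right _ inter_subset_left))
    refine (measure_le_inter_add_sdiff _ (E ∩ frontier K) S).trans ?_
    have z : (μHE[n - 1] : Measure (Eu n)) ((E ∩ frontier K) \ S) = 0 := by
      refine measure_mono_null ?_ (h.HE_nonreg hn)
      rintro x ⟨⟨_, h1⟩, h2⟩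
      exact ⟨h1, fun h3 => h2 ⟨h1, h3⟩⟩
    rw [z, add_zero]
    exact measure_mono (fun x hx => ⟨hx.1.1, hx.2⟩)
  rw [e1, e2, eqS _ (hE.inter hSm) inter_subset_right]

end glob
end

open MeasureTheory Metric Set Filter
open scoped RealInnerProductSpace Topology Pointwise NNReal ENNReal

noncomputable section
section polar
variable {n : ℕ} {K : Set (Eu n)}

/-- spherical measure -/
abbrev sg (n : ℕ) : Measure (sphere (0 : Eu n) 1) := (volume : Measure (Eu n)).toSphere

lemma polar_lint (hn : 1 ≤ n) {F : Eu n → ℝ≥0∞} (hF : Measurable F) :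
    ∫⁻ x, F x = ∫⁻ u, (∫⁻ r in Ioi (0:ℝ), ENNReal.ofReal (r ^ (n - 1)) * F (r • (u : Eu n))) ∂(sg n) := by
  have hmp := (volume : Measure (Eu n)).measurePreserving_homeomorphUnitSphereProd
  have hfin : Module.finrank ℝ (Eu n) = n := by simp
  rw [hfin] at hmp
  have h1 : ∫⁻ x, F x = ∫⁻ x : ({0}ᶜ : Set (Eu n)), F x ∂(volume.comap Subtype.val) := by
    rw [lintegral_subtype_comap (measurableSet_singleton (0 : Eu n)).compl, Measure.restrict_eq_self_of_ae_mem]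
    exact CB.ae_ne hn
  have hm2 : Measurable (fun p : (sphere (0 : Eu n) 1) × Ioi (0:ℝ) => F ((p.2 : ℝ) • (p.1 : Eu n))) := by
    refine hF.comp ?_
    exact (measurable_subtype_coe.comp measurable_snd).smul (measurable_subtype_coe.comp measurable_fst)
  have h2 := hmp.lintegral_comp hm2
  rw [h1]
  have e : ∀ x : ({0}ᶜ : Set (Eu n)), F x = F ((((homeomorphUnitSphereProd (Eu n) x).2 : ℝ)) • (((homeomorphUnitSphereProd (Eu n) x).1 : Eu n))) := by
    intro x
    congr 1
    have hx : ‖(x : Eu n)‖ ≠ 0 := norm_ne_zero_iff.2 x.2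
    simp [smul_smul, hx]
  rw [lintegral_congr e, h2, lintegral_prod _ hm2.aemeasurable]
  refine lintegral_congr fun u => ?_
  rw [Measure.volumeIoiPow]
  have hm3 : Measurable (fun y : Ioi (0:ℝ) => F ((y : ℝ) • (u : Eu n))) := hm2.comp measurable_prodMk_left
  show ∫⁻ y : Ioi (0:ℝ), F ((y : ℝ) • (u : Eu n)) ∂_ = _
  rw [lintegral_withDensity_eq_lintegral_mul _ (by fun_prop) hm3]
  rw [← lintegral_subtype_comap measurableSet_Ioi]
  rfl

lemma sg_norm (u : sphere (0 : Eu n) 1) : ‖(u : Eu n)‖ = 1 := by simpa using u.2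

lemma sg_ne (u : sphere (0 : Eu n) 1) : (u : Eu n) ≠ 0 := by
  intro h
  have := sg_norm u
  rw [h, norm_zero] at this
  exact zero_ne_one this

/-- cone measure in polar coordinates -/
lemma CB.coneM_polar (h : CB K) (hn : 1 ≤ n) : coneM K =
    Measure.map (fun u : sphere (0 : Eu n) 1 => rad K u) ((sg n).withDensity (fun u => ENNReal.ofReal ((gauge K u)⁻¹ ^ n))) := by
  have hrm : Measurable (fun u : sphere (0 : Eu n) 1 => rad K u) := h.rad_meas.comp measurable_subtype_coe
  have hgm : Measurable (fun u : sphere (0 : Eu n) 1 => ENNReal.ofReal ((gauge K u)⁻¹ ^ n)) :=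
    ENNReal.measurable_ofReal.comp (((h.gauge_cont.measurable.comp measurable_subtype_coe).inv).pow_const n)
  ext E hE
  have hmS : MeasurableSet (rad K ⁻¹' E ∩ K) := (h.rad_meas hE).inter h.comp.measurableSet
  rw [h.coneM_apply hE, ← lintegral_indicator_one hmS, polar_lint hn (measurable_one.indicator hmS),
    Measure.map_apply hrm hE, withDensity_apply _ (hrm hE), ← lintegral_const_mul', ← lintegral_indicator (hrm hE)]
  swap
  · exact ENNReal.natCast_ne_top n
  refine lintegral_congr fun u => ?_
  have hg := h.gauge_pos (sg_ne u)
  have hn0 : (0:ℝ) < n := by exact_mod_cast hn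
  have hind : ∀ r ∈ Ioi (0:ℝ), ENNReal.ofReal (r ^ (n - 1)) * (rad K ⁻¹' E ∩ K).indicator 1 (r • (u : Eu n)) =
      (Ioc (0:ℝ) (gauge K u)⁻¹).indicator (fun r => ((fun u : sphere (0 : Eu n) 1 => rad K u) ⁻¹' E).indicator 1 u * ENNReal.ofReal (r ^ (n - 1))) r := by
    intro r hr
    have hr0 : 0 < r := hr
    have m1 : r • (u : Eu n) ∈ K ↔ r ∈ Ioc (0:ℝ) (gauge K u)⁻¹ := by
      rw [← h.gauge_le_one, h.gauge_smul hr0.le, ← le_div_iff₀ hg, one_div]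
      simp [hr0]
    have m2 : rad K (r • (u : Eu n)) = rad K u := h.rad_smul hr0 _
    by_cases c1 : r • (u : Eu n) ∈ K
    · rw [Set.indicator_of_mem (m1.1 c1)]
      by_cases c2 : rad K u ∈ E
      · rw [Set.indicator_of_mem (show r • (u : Eu n) ∈ rad K ⁻¹' E ∩ K from ⟨by rw [mem_preimage, m2]; exact c2, c1⟩),
          Set.indicator_of_mem (show u ∈ (fun u : sphere (0 : Eu n) 1 => rad K u) ⁻¹' E from c2)]
        simp
      · rw [Set.indicator_of_notMem (show r • (u : Eu n) ∉ rad K ⁻¹' E ∩ K from fun hh => c2 (by rw [← m2]; exact hh.1)),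
          Set.indicator_of_notMem (show u ∉ (fun u : sphere (0 : Eu n) 1 => rad K u) ⁻¹' E from c2)]
        simp
    · rw [Set.indicator_of_notMem (fun hh => c1 (m1.2 hh)), Set.indicator_of_notMem (fun hh => c1 hh.2), mul_zero]
  rw [setLIntegral_congr_fun measurableSet_Ioi hind, lintegral_indicator measurableSet_Ioc,
    Measure.restrict_restrict measurableSet_Ioc, inter_eq_left.2 (fun x hx => hx.1), lintegral_const_mul _ (by fun_prop),
    ← ofReal_integral_eq_lintegral_ofReal]
  · rw [← intervalIntegral.integral_of_le (by positivity), integral_pow]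
    have e1 : ((n - 1 : ℕ) : ℝ) + 1 = n := by rw [Nat.cast_sub hn]; simp
    rw [e1, Nat.sub_add_cancel hn, zero_pow (by omega), sub_zero]
    by_cases c2 : u ∈ (fun u : sphere (0 : Eu n) 1 => rad K u) ⁻¹' E
    · rw [Set.indicator_of_mem c2, Set.indicator_of_mem c2, Pi.one_apply, one_mul, ← ENNReal.ofReal_natCast,
        ← ENNReal.ofReal_mul (by positivity)]
      congr 1
      field_simp
    · rw [Set.indicator_of_notMem c2, Set.indicator_of_notMem c2, zero_mul, mul_zero]
  · exact (Continuous.integrableOn_Icc (by fun_prop)).mono_set Ioc_subset_Icc_self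
  · filter_upwards [ae_restrict_mem measurableSet_Ioc] with x hx
    have := hx.1.le
    simp only [Pi.zero_apply]
    positivity

/-- radial Gaussian distribution -/
def Psi (n : ℕ) (s : ℝ) : ℝ := ∫ r in (0:ℝ)..s, r ^ (n - 1) * ((√(2 * Real.pi))⁻¹ ^ n * Real.exp (-r ^ 2 / 2))

lemma Psi_hasDerivAt (s : ℝ) : HasDerivAt (Psi n) (s ^ (n - 1) * ((√(2 * Real.pi))⁻¹ ^ n * Real.exp (-s ^ 2 / 2))) s := by
  have hc : Continuous (fun r : ℝ => r ^ (n - 1) * ((√(2 * Real.pi))⁻¹ ^ n * Real.exp (-r ^ 2 / 2))) := by fun_prop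
  exact intervalIntegral.integral_hasDerivAt_right (hc.intervalIntegrable _ _) (hc.stronglyMeasurableAtFilter _ _) hc.continuousAt

lemma Psi_cont : Continuous (Psi n) := continuous_iff_continuousAt.2 fun s => (Psi_hasDerivAt s).continuousAt

lemma Psi_nonneg {s : ℝ} (hs : 0 ≤ s) : 0 ≤ Psi n s := by
  refine intervalIntegral.integral_nonneg hs fun r hr => ?_
  have := hr.1
  positivity

lemma gd_smul_sphere (u : sphere (0 : Eu n) 1) (r : ℝ) :
    gd n (r • (u : Eu n)) = (√(2 * Real.pi))⁻¹ ^ n * Real.exp (-r ^ 2 / 2) := by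
  unfold gd
  rw [norm_smul, sg_norm, mul_one, Real.norm_eq_abs, sq_abs]

lemma CB.gauss_polar (h : CB K) (hn : 1 ≤ n) : gaussVol n K = ∫ u, Psi n (gauge K u)⁻¹ ∂(sg n) := by
  rw [gaussVol_eq h.comp.measurableSet, integral_eq_lintegral_of_nonneg_ae]
  · congr 1
    have hm : Measurable (fun x => ENNReal.ofReal (gd n x)) := ENNReal.measurable_ofReal.comp gd_cont.measurable
    rw [gm, withDensity_apply _ h.comp.measurableSet, ← lintegral_indicator h.comp.measurableSet,
      polar_lint hn (hm.indicator h.comp.measurableSet)]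
    refine lintegral_congr fun u => ?_
    have hg := h.gauge_pos (sg_ne u)
    have hind : ∀ r ∈ Ioi (0:ℝ), ENNReal.ofReal (r ^ (n - 1)) * K.indicator (fun x => ENNReal.ofReal (gd n x)) (r • (u : Eu n)) =
        (Ioc (0:ℝ) (gauge K u)⁻¹).indicator (fun r => ENNReal.ofReal (r ^ (n - 1) * ((√(2 * Real.pi))⁻¹ ^ n * Real.exp (-r ^ 2 / 2)))) r := by
      intro r hr
      have hr0 : 0 < r := hr
      have m1 : r • (u : Eu n) ∈ K ↔ r ∈ Ioc (0:ℝ) (gauge K u)⁻¹ := by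
        rw [← h.gauge_le_one, h.gauge_smul hr0.le, ← le_div_iff₀ hg, one_div]
        simp [hr0]
      by_cases c1 : r • (u : Eu n) ∈ K
      · rw [Set.indicator_of_mem (m1.1 c1), Set.indicator_of_mem c1, gd_smul_sphere, ← ENNReal.ofReal_mul (by positivity)]
      · rw [Set.indicator_of_notMem (fun hh => c1 (m1.2 hh)), Set.indicator_of_notMem c1, mul_zero]
    rw [setLIntegral_congr_fun measurableSet_Ioi hind, lintegral_indicator measurableSet_Ioc,
      Measure.restrict_restrict measurableSet_Ioc, inter_eq_left.2 (fun x hx => hx.1),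
      ← ofReal_integral_eq_lintegral_ofReal, Psi, intervalIntegral.integral_of_le (by positivity)]
    · exact (Continuous.integrableOn_Icc (by fun_prop)).mono_set Ioc_subset_Icc_self
    · filter_upwards [ae_restrict_mem measurableSet_Ioc] with x hx
      have := hx.1.le
      simp only [Pi.zero_apply]
      positivity
  · refine Eventually.of_forall fun u => Psi_nonneg ?_
    exact inv_nonneg.2 (gauge_nonneg _)
  · refine Measurable.aestronglyMeasurable ?_
    exact Psi_cont.measurable.comp ((h.gauge_cont.measurable.comp measurable_subtype_coe).inv)

end polar
end

open MeasureTheory Metric Set Filter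
open scoped RealInnerProductSpace Topology Pointwise NNReal ENNReal

noncomputable section
section nrm
variable {n : ℕ} {K : Set (Eu n)}

/-- gradient of the gauge -/
def gr (K : Set (Eu n)) (x : Eu n) : Eu n := (InnerProductSpace.toDual ℝ (Eu n)).symm (fderiv ℝ (gauge K) x)

/-- outer unit normal -/
def nu (K : Set (Eu n)) (x : Eu n) : Eu n := ‖gr K x‖⁻¹ • gr K x

lemma gr_meas : Measurable (gr K) :=
  (InnerProductSpace.toDual ℝ (Eu n)).symm.continuous.measurable.comp (measurable_fderiv ℝ (gauge K))

lemma nu_meas : Measurable (nu K) := (gr_meas.norm.inv).smul gr_meas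

lemma gr_inner (x y : Eu n) : ⟪gr K x, y⟫ = fderiv ℝ (gauge K) x y := by
  rw [gr, InnerProductSpace.toDual_symm_apply]

lemma gr_norm (x : Eu n) : ‖gr K x‖ = ‖fderiv ℝ (gauge K) x‖ := by
  rw [gr, LinearIsometryEquiv.norm_map]

lemma CB.gr_self (h : CB K) {x : Eu n} (hx : x ∈ frontier K) (hd : DifferentiableAt ℝ (gauge K) x) : ⟪gr K x, x⟫ = 1 := by
  rw [gr_inner, h.gauge_fderiv_self hd.hasFDerivAt, h.gauge_eq_one.2 hx]

lemma CB.gr_pos (h : CB K) {x : Eu n} (hx : x ∈ frontier K) (hd : DifferentiableAt ℝ (gauge K) x) : 0 < ‖gr K x‖ := by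
  rw [norm_pos_iff]
  intro h0
  have := h.gr_self hx hd
  rw [h0, inner_zero_left] at this
  exact zero_ne_one this

lemma CB.nu_norm (h : CB K) {x : Eu n} (hx : x ∈ frontier K) (hd : DifferentiableAt ℝ (gauge K) x) : ‖nu K x‖ = 1 := by
  have := h.gr_pos hx hd
  rw [nu, norm_smul, norm_inv, norm_norm, inv_mul_cancel₀ this.ne']

lemma CB.inner_nu (h : CB K) {x : Eu n} (hx : x ∈ frontier K) (hd : DifferentiableAt ℝ (gauge K) x) :
    ⟪x, nu K x⟫ = ‖gr K x‖⁻¹ := by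
  rw [nu, real_inner_smul_right, real_inner_comm, h.gr_self hx hd, mul_one]

lemma CB.frontier_sub (h : CB K) : frontier K ⊆ K := h.comp.isClosed.frontier_subset

lemma CB.supp_nu (h : CB K) {x : Eu n} (hx : x ∈ frontier K) (hd : DifferentiableAt ℝ (gauge K) x) :
    suppFun K (nu K x) = ‖gr K x‖⁻¹ := by
  refine le_antisymm (suppFun_le h.comp h.ne fun y hy => ?_) ?_
  · rw [nu, real_inner_smul_right, real_inner_comm, gr_inner]
    have h1 := h.gauge_fderiv_le hd.hasFDerivAt y
    have h2 := h.gauge_le_one.2 hy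
    have h3 := h.gr_pos hx hd
    calc ‖gr K x‖⁻¹ * fderiv ℝ (gauge K) x y ≤ ‖gr K x‖⁻¹ * 1 := by
          gcongr
          linarith
      _ = _ := mul_one _
  · rw [← h.inner_nu hx hd]
    exact le_suppFun h.comp (h.frontier_sub hx) _

lemma CB.nu_unique (h : CB K) {x : Eu n} (hx : x ∈ frontier K) (hd : DifferentiableAt ℝ (gauge K) x) {v : Eu n}
    (hv : ‖v‖ = 1) (e : ⟪x, v⟫ = suppFun K v) : v = nu K x := by
  have h1 := h.normal_unique (h.gauge_eq_one.2 hx) hd.hasFDerivAt e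
  have hv0 : v ≠ 0 := by rintro rfl; simp at hv
  have hp := h.suppFun_pos hv0
  have h2 : v = suppFun K v • gr K x := by
    refine ext_inner_left ℝ fun y => ?_
    rw [h1, real_inner_smul_right, real_inner_comm, gr_inner]
  have h3 : suppFun K v * ‖gr K x‖ = 1 := by
    rw [← hv]; conv_rhs => rw [h2]
    rw [norm_smul, Real.norm_eq_abs, abs_of_pos hp]
  have h4 : suppFun K v = ‖gr K x‖⁻¹ := eq_inv_of_mul_eq_one_left h3
  rw [nu, ← h4]; exact h2

/-- perturbed body -/
def Kt (K : Set (Eu n)) (f : Eu n → ℝ) (t : ℝ) : Set (Eu n) := wulff (fun v => suppFun K v + t * f v)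

lemma Kt_zero (h : CB K) (f : Eu n → ℝ) : Kt K f 0 = K := by
  have := wulff_suppFun h.conv h.comp h.ne
  unfold Kt
  simpa using this

lemma CB.gauge_compare {L : Set (Eu n)} (h : CB K) (hL : CB L) {c : ℝ} (hc : 0 < c) (hKL : ∀ y ∈ K, c • y ∈ L) (x : Eu n) :
    c * gauge L x ≤ gauge K x := by
  by_cases hx : x = 0
  · rw [hx, gauge_zero, gauge_zero, mul_zero]
  have hg := h.gauge_pos hx
  have h1 := hL.gauge_le_one.2 (hKL _ (h.frontier_sub (h.rad_mem hx)))
  rw [rad, hL.gauge_smul hc.le, hL.gauge_smul (by positivity)] at h1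
  have : c * gauge L x = gauge K x * (c * ((gauge K x)⁻¹ * gauge L x)) := by field_simp
  rw [this]
  calc _ ≤ gauge K x * 1 := by gcongr
    _ = _ := mul_one _

lemma bdd_sphere {f : Eu n → ℝ} (hf : Continuous f) : ∃ M > 0, ∀ v : Eu n, ‖v‖ = 1 → |f v| ≤ M := by
  obtain ⟨M, hM⟩ := (isCompact_sphere (0 : Eu n) 1).exists_bound_of_continuousOn hf.continuousOn
  exact ⟨max M 1, by positivity, fun v hv => (hM v (by simpa using hv)).trans (le_max_left _ _)⟩

lemma CB.Kt_bounds (h : CB K) {f : Eu n → ℝ} (hf : Continuous f) : ∃ C > 0, ∀ t, 0 < t → C * t ≤ 1 / 2 →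
    CB (Kt K f t) ∧ (∀ y ∈ K, (1 - C * t) • y ∈ Kt K f t) ∧ (∀ y ∈ Kt K f t, (1 + C * t)⁻¹ • y ∈ K) := by
  obtain ⟨M, hM, hb⟩ := bdd_sphere hf
  obtain ⟨r, hr, hl⟩ := h.lower
  refine ⟨M / r, by positivity, fun t ht hCt => ?_⟩
  have hMt : ∀ v : Eu n, ‖v‖ = 1 → |t * f v| ≤ M / r * t * suppFun K v := by
    intro v hv
    rw [abs_mul, abs_of_pos ht]
    calc t * |f v| ≤ t * M := by gcongr; exact hb v hv
      _ = M / r * t * r := by field_simp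
      _ ≤ _ := by gcongr; exact hl v hv
  have h1 : ∀ y ∈ K, (1 - M / r * t) • y ∈ Kt K f t := by
    intro y hy v hv
    rw [real_inner_smul_left]
    have a1 := le_suppFun h.comp hy v
    have a2 := abs_le.1 (hMt v hv)
    have a3 : (1 - M / r * t) * ⟪y, v⟫ ≤ (1 - M / r * t) * suppFun K v := mul_le_mul_of_nonneg_left a1 (by linarith)
    have a4 : (1 - M / r * t) * suppFun K v = suppFun K v - M / r * t * suppFun K v := by ring
    linarith [a2.1]
  have hp : 0 < 1 + M / r * t := by positivity
  have h2 : ∀ y ∈ Kt K f t, (1 + M / r * t)⁻¹ • y ∈ K := by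
    intro y hy
    refine mem_of_inner_le_suppFun h.conv h.comp h.ne fun v hv => ?_
    rw [real_inner_smul_left, inv_mul_le_iff₀ hp]
    have a2 := abs_le.1 (hMt v hv)
    have a3 : ⟪y, v⟫ ≤ suppFun K v + t * f v := hy v hv
    have a4 : (1 + M / r * t) * suppFun K v = suppFun K v + M / r * t * suppFun K v := by ring
    linarith [a2.2]
  refine ⟨⟨wulff_convex _, ?_, ?_⟩, h1, h2⟩
  · have : Kt K f t ⊆ (1 + M / r * t) • K := by
      intro y hy
      rw [mem_smul_set_iff_inv_smul_mem₀ hp.ne']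
      exact h2 y hy
    exact (h.comp.smul _).of_isClosed_subset (wulff_closed _) this
  · have hq : 1 - M / r * t ≠ 0 := by linarith
    have hs : (1 - M / r * t) • K ⊆ Kt K f t := by
      rintro _ ⟨y, hy, rfl⟩
      exact h1 y hy
    refine interior_mono hs ?_
    rw [interior_smul₀ hq]
    exact ⟨0, h.int0, smul_zero _⟩

lemma CB.radial_deriv (h : CB K) {f : Eu n → ℝ} (hf : Continuous f) {x : Eu n} (hx : x ∈ frontier K)
    (hd : DifferentiableAt ℝ (gauge K) x) :
    Tendsto (fun t => ((gauge (Kt K f t) x)⁻¹ - 1) / t) (𝓝[>] 0) (𝓝 (f (nu K x) * ‖gr K x‖)) := by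
  obtain ⟨C, hC, hKt⟩ := h.Kt_bounds hf
  have hgr := h.gr_pos hx hd
  have hx0 : x ≠ 0 := by rintro rfl; exact h.zero_notMem hx
  have ev0 : ∀ᶠ t in 𝓝[>] (0:ℝ), 0 < t := self_mem_nhdsWithin
  have ev1 : ∀ᶠ t in 𝓝[>] (0:ℝ), C * t ≤ 1 / 2 := by
    have : Tendsto (fun t : ℝ => C * t) (𝓝[>] 0) (𝓝 0) := by
      have := ((continuous_const_mul C).tendsto 0).mono_left (nhdsWithin_le_nhds (s := Ioi (0:ℝ)))
      simpa using this
    exact (this.eventually_lt_const (by norm_num : (0:ℝ) < 1 / 2)).mono fun _ h => h.le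
  refine tendsto_order.2 ⟨fun l hl => ?_, fun l hl => ?_⟩
  · obtain ⟨l', hl1, hl2⟩ := exists_between hl
    have hν := h.nu_norm hx hd
    set S : Set (Eu n) := {v | v ∈ sphere (0 : Eu n) 1 ∧ f v - l' * ⟪x, v⟫ ≤ 0} with hS
    have hcl : IsClosed {v : Eu n | f v - l' * ⟪x, v⟫ ≤ 0} := isClosed_le (by fun_prop) continuous_const
    have hSc : IsCompact S := (isCompact_sphere (0 : Eu n) 1).inter_right hcl
    have hhc := suppFun_cont h.comp h.ne
    have hpos : ∀ v ∈ S, 0 < suppFun K v - ⟪x, v⟫ := by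
      intro v hv
      have hle := le_suppFun h.comp (h.frontier_sub hx) v
      refine lt_of_le_of_ne (by linarith) fun he => ?_
      have hv1 : ‖v‖ = 1 := by simpa using hv.1
      have := h.nu_unique hx hd hv1 (by linarith)
      have h2 := hv.2
      rw [this, h.inner_nu hx hd] at h2
      have : l' * ‖gr K x‖⁻¹ < f (nu K x) := by
        rw [← div_eq_mul_inv, div_lt_iff₀ hgr]; exact hl2
      linarith
    obtain ⟨c, hc, hcS⟩ : ∃ c > 0, ∀ v ∈ S, c ≤ suppFun K v - ⟪x, v⟫ := by
      rcases S.eq_empty_or_nonempty with h0 | hne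
      · exact ⟨1, one_pos, by simp [h0]⟩
      · obtain ⟨v, hv, hm⟩ := hSc.exists_isMinOn hne (f := fun v => suppFun K v - ⟪x, v⟫) (by fun_prop)
        exact ⟨_, hpos v hv, fun w hw => hm hw⟩
    obtain ⟨M, hM, hMb⟩ := bdd_sphere (f := fun v => l' * ⟪x, v⟫ - f v) (by fun_prop)
    have ev2 : ∀ᶠ t in 𝓝[>] (0:ℝ), t * M < c := by
      have : Tendsto (fun t : ℝ => t * M) (𝓝[>] 0) (𝓝 0) := by
        have := ((continuous_mul_const M).tendsto 0).mono_left (nhdsWithin_le_nhds (s := Ioi (0:ℝ)))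
        simpa using this
      exact this.eventually_lt_const hc
    have ev3 : ∀ᶠ t in 𝓝[>] (0:ℝ), 0 < 1 + t * l' := by
      have : Tendsto (fun t : ℝ => 1 + t * l') (𝓝[>] 0) (𝓝 1) := by
        have hcc : Continuous (fun t : ℝ => 1 + t * l') := by fun_prop
        have := (hcc.tendsto 0).mono_left (nhdsWithin_le_nhds (s := Ioi (0:ℝ)))
        simpa using this
      exact this.eventually_const_lt one_pos
    filter_upwards [ev0, ev1, ev2, ev3] with t ht0 ht1 ht2 ht3
    refine hl1.trans_le ?_
    obtain ⟨hCB, -, -⟩ := hKt t ht0 ht1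
    have hmem : (1 + t * l') • x ∈ Kt K f t := by
      intro v hv
      rw [real_inner_smul_left]
      show (1 + t * l') * ⟪x, v⟫ ≤ suppFun K v + t * f v
      have e : (1 + t * l') * ⟪x, v⟫ = ⟪x, v⟫ + t * (l' * ⟪x, v⟫ - f v) + t * f v := by ring
      rw [e]
      by_cases hvS : v ∈ S
      · have a1 := hcS v hvS
        have a2 := (abs_le.1 (hMb v hv)).2
        have a3 := mul_le_mul_of_nonneg_left a2 ht0.le
        linarith
      · have a1 : 0 < f v - l' * ⟪x, v⟫ := by
          by_contra hcon
          exact hvS ⟨by simpa using hv, not_lt.1 hcon⟩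
        have a2 := le_suppFun h.comp (h.frontier_sub hx) v
        have a3 : t * (l' * ⟪x, v⟫ - f v) ≤ 0 := mul_nonpos_of_nonneg_of_nonpos ht0.le (by linarith)
        linarith
    have hg := hCB.gauge_pos hx0
    have h1 := hCB.gauge_le_one.2 hmem
    rw [hCB.gauge_smul ht3.le] at h1
    rw [le_div_iff₀ ht0]
    have : 1 + t * l' ≤ (gauge (Kt K f t) x)⁻¹ := by
      rw [← one_div, le_div_iff₀ hg]; exact h1
    linarith
  · filter_upwards [ev0, ev1] with t ht0 ht1
    refine lt_of_le_of_lt ?_ hl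
    obtain ⟨hCB, -, -⟩ := hKt t ht0 ht1
    have hg := hCB.gauge_pos hx0
    have hm : (gauge (Kt K f t) x)⁻¹ • x ∈ Kt K f t := by
      rw [← hCB.gauge_le_one, hCB.gauge_smul (by positivity), inv_mul_cancel₀ hg.ne']
    have h1 : ⟪(gauge (Kt K f t) x)⁻¹ • x, nu K x⟫ ≤ suppFun K (nu K x) + t * f (nu K x) := hm _ (h.nu_norm hx hd)
    rw [real_inner_smul_left, h.inner_nu hx hd, h.supp_nu hx hd] at h1
    rw [div_le_iff₀ ht0]
    have h2 := mul_le_mul_of_nonneg_right h1 hgr.le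
    rw [mul_assoc, add_mul, inv_mul_cancel₀ hgr.ne'] at h2
    linarith

end nrm
end

open MeasureTheory Metric Set Filter
open scoped RealInnerProductSpace Topology Pointwise NNReal ENNReal

noncomputable section
section var
variable {n : ℕ} {K : Set (Eu n)}

/-- The Gaussian surface area measure (with the Euclidean Hausdorff normalization) -/
def SK (K : Set (Eu n)) : Measure (Eu n) :=
  Measure.map (nu K) ((((μHE[n-1] : Measure (Eu n)).restrict (frontier K))).withDensity (fun x => ENNReal.ofReal (gd n x)))

lemma CB.sg_ae (h : CB K) (hn : 1 ≤ n) :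
    ∀ᵐ u : sphere (0 : Eu n) 1 ∂(sg n), rad K u ∈ frontier K ∧ DifferentiableAt ℝ (gauge K) (rad K u) := by
  have h1 := h.coneM_ae hn
  rw [h.coneM_polar hn] at h1
  have hm : Measurable (fun u : sphere (0 : Eu n) 1 => rad K u) := h.rad_meas.comp measurable_subtype_coe
  have h2 := ae_of_ae_map hm.aemeasurable h1
  have hg : Measurable (fun u : sphere (0 : Eu n) 1 => gauge K (u : Eu n)) :=
    h.gauge_cont.measurable.comp measurable_subtype_coe
  rw [ae_withDensity_iff (by fun_prop)] at h2
  filter_upwards [h2] with u hu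
  refine hu ?_
  have := h.gauge_pos (sg_ne u)
  simp only [ne_eq, ENNReal.ofReal_eq_zero, not_le]
  positivity

lemma CB.SK_integral (h : CB K) (hn : 1 ≤ n) {f : Eu n → ℝ} (hf : Continuous f) :
    ∫ v, f v ∂SK K = ∫ u, (gauge K (u : Eu n))⁻¹ ^ n * (‖gr K (rad K u)‖ * (gd n (rad K u) * f (nu K (rad K u)))) ∂(sg n) := by
  have hm : Measurable (fun u : sphere (0 : Eu n) 1 => rad K u) := h.rad_meas.comp measurable_subtype_coe
  have hg : Measurable (fun u : sphere (0 : Eu n) 1 => gauge K (u : Eu n)) :=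
    h.gauge_cont.measurable.comp measurable_subtype_coe
  have hgd : Measurable (gd n) := gd_cont.measurable
  have hfd : Measurable (fderiv ℝ (gauge K)) := measurable_fderiv ℝ (gauge K)
  have hfm := hf.measurable
  have hnu : Measurable (nu K) := nu_meas
  rw [SK, integral_map nu_meas.aemeasurable hf.aestronglyMeasurable,
    integral_withDensity_eq_integral_toReal_smul (by fun_prop) (by simp), h.surf_eq hn,
    integral_withDensity_eq_integral_toReal_smul (by fun_prop) (by simp), h.coneM_polar hn,
    integral_map hm.aemeasurable ?_, integral_withDensity_eq_integral_toReal_smul (by fun_prop) (by simp)]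
  · refine integral_congr_ae (Eventually.of_forall fun u => ?_)
    have h1 := h.gauge_pos (sg_ne u)
    have h2 := (gd_pos (n := n) (rad K u)).le
    simp only [smul_eq_mul, gr_norm, toReal_enorm]
    rw [ENNReal.toReal_ofReal (by positivity), ENNReal.toReal_ofReal h2]
  · apply Measurable.aestronglyMeasurable
    simp only [smul_eq_mul]
    fun_prop

lemma CB.rho_bdd (h : CB K) : ∃ R > 0, ∀ u : sphere (0 : Eu n) 1, (gauge K (u : Eu n))⁻¹ ≤ R := by
  have hc : ContinuousOn (fun u => (gauge K u)⁻¹) (sphere (0 : Eu n) 1) := by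
    refine h.gauge_cont.continuousOn.inv₀ fun u hu => (h.gauge_pos ?_).ne'
    rintro rfl; simp at hu
  obtain ⟨M, hM⟩ := (isCompact_sphere (0 : Eu n) 1).exists_bound_of_continuousOn hc
  exact ⟨max M 1, by positivity, fun u => ((le_abs_self _).trans (hM u u.2)).trans (le_max_left _ _)⟩

lemma Psi_lip (R : ℝ) : ∃ L ≥ 0, ∀ a ∈ Icc 0 R, ∀ b ∈ Icc 0 R, |Psi n b - Psi n a| ≤ L * |b - a| := by
  have hc : Continuous (fun s : ℝ => s ^ (n - 1) * ((√(2 * Real.pi))⁻¹ ^ n * Real.exp (-s ^ 2 / 2))) := by fun_prop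
  obtain ⟨L, hL⟩ := (isCompact_Icc (a := (0:ℝ)) (b := R)).exists_bound_of_continuousOn hc.continuousOn
  refine ⟨max L 0, le_max_right _ _, fun a ha b hb => ?_⟩
  exact (convex_Icc (0:ℝ) R).norm_image_sub_le_of_norm_hasDerivWithin_le
    (fun x _ => (Psi_hasDerivAt x).hasDerivWithinAt) (fun x hx => (hL x hx).trans (le_max_left _ _)) ha hb

theorem CB.variation (h : CB K) (hn : 1 ≤ n) {f : Eu n → ℝ} (hf : Continuous f) :
    Tendsto (fun t => (gaussVol n (Kt K f t) - gaussVol n K) / t) (𝓝[>] 0) (𝓝 (∫ v, f v ∂SK K)) := by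
  obtain ⟨C, hC, hKt⟩ := h.Kt_bounds hf
  obtain ⟨R, hR, hRb⟩ := h.rho_bdd
  obtain ⟨L, hL, hLip⟩ := Psi_lip (n := n) (2 * R)
  have ev0 : ∀ᶠ t in 𝓝[>] (0:ℝ), 0 < t := self_mem_nhdsWithin
  have ev1 : ∀ᶠ t in 𝓝[>] (0:ℝ), C * t ≤ 1 / 2 := by
    have : Tendsto (fun t : ℝ => C * t) (𝓝[>] 0) (𝓝 0) := by
      have := ((continuous_const_mul C).tendsto 0).mono_left (nhdsWithin_le_nhds (s := Ioi (0:ℝ)))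
      simpa using this
    exact (this.eventually_lt_const (by norm_num : (0:ℝ) < 1 / 2)).mono fun _ h => h.le
  have psim : ∀ {M : Set (Eu n)}, CB M → Measurable (fun u : sphere (0 : Eu n) 1 => Psi n (gauge M (u : Eu n))⁻¹) := by
    intro M hM
    exact Psi_cont.measurable.comp (hM.gauge_cont.measurable.comp measurable_subtype_coe).inv
  have psii : ∀ {M : Set (Eu n)}, CB M → Integrable (fun u : sphere (0 : Eu n) 1 => Psi n (gauge M (u : Eu n))⁻¹) (sg n) := by
    intro M hM
    obtain ⟨R', hR', hb⟩ := hM.rho_bdd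
    obtain ⟨L', hL', hl⟩ := Psi_lip (n := n) R'
    refine Integrable.of_bound (psim hM).aestronglyMeasurable (L' * R' + |Psi n 0|) (Eventually.of_forall fun u => ?_)
    have hp : 0 < (gauge M (u : Eu n))⁻¹ := inv_pos.2 (hM.gauge_pos (sg_ne u))
    have := hl 0 ⟨le_rfl, hR'.le⟩ _ ⟨hp.le, hb u⟩
    rw [sub_zero, abs_of_pos hp] at this
    have h2 := mul_le_mul_of_nonneg_left (hb u) hL'
    have h3 := abs_add_le (Psi n (gauge M (u : Eu n))⁻¹ - Psi n 0) (Psi n 0)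
    rw [sub_add_cancel] at h3
    rw [Real.norm_eq_abs]
    linarith
  have key : Tendsto (fun t => ∫ u, (Psi n (gauge (Kt K f t) (u : Eu n))⁻¹ - Psi n (gauge K (u : Eu n))⁻¹) / t ∂(sg n))
      (𝓝[>] 0) (𝓝 (∫ v, f v ∂SK K)) := by
    rw [h.SK_integral hn hf]
    refine tendsto_integral_filter_of_dominated_convergence (fun _ => L * (C * R)) ?_ ?_ (integrable_const _) ?_
    · filter_upwards [ev0, ev1] with t ht0 ht1
      exact (((psim (hKt t ht0 ht1).1).sub (psim h)).div_const t).aestronglyMeasurable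
    · filter_upwards [ev0, ev1] with t ht0 ht1
      refine Eventually.of_forall fun u => ?_
      obtain ⟨hCB, hA, hB⟩ := hKt t ht0 ht1
      have g0 := h.gauge_pos (sg_ne u)
      have g1 := hCB.gauge_pos (sg_ne u)
      have a1 := h.gauge_compare hCB (by linarith) hA (u : Eu n)
      have hp : 0 < 1 + C * t := by positivity
      have a2 := hCB.gauge_compare h (inv_pos.2 hp) hB (u : Eu n)
      set a := gauge K (u : Eu n)
      set b := gauge (Kt K f t) (u : Eu n)
      have b1 : (1 - C * t) * a⁻¹ ≤ b⁻¹ := by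
        rw [← div_eq_mul_inv, ← one_div, div_le_div_iff₀ g0 g1]; linarith
      have b2 : b⁻¹ ≤ (1 + C * t) * a⁻¹ := by
        rw [inv_mul_le_iff₀ hp] at a2
        rw [← div_eq_mul_inv, ← one_div, div_le_div_iff₀ g1 g0]; linarith
      have hRu : a⁻¹ ≤ R := hRb u
      have ha : 0 < a⁻¹ := inv_pos.2 g0
      have hb : 0 < b⁻¹ := inv_pos.2 g1
      have hCa : C * t * a⁻¹ ≤ C * t * R := by gcongr
      have hCR : C * t * R ≤ 1 / 2 * R := by gcongr
      have hd : |b⁻¹ - a⁻¹| ≤ C * t * R := abs_le.2 ⟨by linarith, by linarith⟩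
      have := hLip a⁻¹ ⟨ha.le, by linarith⟩ b⁻¹ ⟨hb.le, by linarith⟩
      rw [Real.norm_eq_abs, abs_div, abs_of_pos ht0, div_le_iff₀ ht0]
      calc _ ≤ _ := this
        _ ≤ L * (C * t * R) := by gcongr
        _ = _ := by ring
    · filter_upwards [h.sg_ae hn] with u hu
      obtain ⟨hx, hd⟩ := hu
      have g0 := h.gauge_pos (sg_ne u)
      have hr := h.radial_deriv hf hx hd
      have hder : HasDerivWithinAt (fun t => (gauge (Kt K f t) (u : Eu n))⁻¹)
          ((gauge K (u : Eu n))⁻¹ * (f (nu K (rad K u)) * ‖gr K (rad K u)‖)) (Ioi 0) 0 := by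
        rw [hasDerivWithinAt_iff_tendsto_slope' (by simp)]
        refine (hr.const_mul (gauge K (u : Eu n))⁻¹).congr' ?_
        filter_upwards [ev0, ev1] with t ht0 ht1
        obtain ⟨hCB, hA, hB⟩ := hKt t ht0 ht1
        have g1 := hCB.gauge_pos (sg_ne u)
        rw [slope_def_field, Kt_zero h, rad, hCB.gauge_smul (by positivity), sub_zero]
        field_simp
      have hp := Psi_hasDerivAt (n := n) (gauge K (u : Eu n))⁻¹
      have hp' : HasDerivAt (Psi n) ((gauge K (u : Eu n))⁻¹ ^ (n - 1) * ((√(2 * Real.pi))⁻¹ ^ n * Real.exp (-(gauge K (u : Eu n))⁻¹ ^ 2 / 2))) ((fun t => (gauge (Kt K f t) (u : Eu n))⁻¹) 0) := by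
        simp only [Kt_zero h]; exact hp
      have hc := hp'.comp_hasDerivWithinAt 0 hder
      rw [hasDerivWithinAt_iff_tendsto_slope' (by simp)] at hc
      have e : (gauge K (u : Eu n))⁻¹ ^ n * (‖gr K (rad K u)‖ * (gd n (rad K u) * f (nu K (rad K u))))
        = (gauge K (u : Eu n))⁻¹ ^ (n - 1) * ((√(2 * Real.pi))⁻¹ ^ n * Real.exp (-(gauge K (u : Eu n))⁻¹ ^ 2 / 2)) *
          ((gauge K (u : Eu n))⁻¹ * (f (nu K (rad K u)) * ‖gr K (rad K u)‖)) := by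
        have : gd n (rad K u) = (√(2 * Real.pi))⁻¹ ^ n * Real.exp (-(gauge K (u : Eu n))⁻¹ ^ 2 / 2) := gd_smul_sphere u _
        rw [this]
        obtain ⟨m, rfl⟩ : ∃ m, n = m + 1 := ⟨n - 1, by omega⟩
        rw [Nat.add_sub_cancel, pow_succ (gauge K (u : Eu _))⁻¹ m]
        ring
      rw [e]
      refine hc.congr fun t => ?_
      rw [slope_def_field]
      simp only [Function.comp_apply, Kt_zero h, sub_zero]
  refine key.congr' ?_
  filter_upwards [ev0, ev1] with t ht0 ht1
  have hCB := (hKt t ht0 ht1).1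
  rw [integral_div, integral_sub (psii hCB) (psii h), ← hCB.gauss_polar hn, ← h.gauss_polar hn]

end var
end

open MeasureTheory Metric Set Filter
open scoped RealInnerProductSpace Topology Pointwise NNReal ENNReal

noncomputable section
section skm
variable {n : ℕ} {K : Set (Eu n)}

/-- the normalization constant -/
def kap (m : ℕ) : ℝ≥0 := Measure.addHaarScalarFactor (volume : Measure (EuclideanSpace ℝ (Fin m))) μH[m]

lemma kap_def (m : ℕ) : (μHE[m] : Measure (Eu n)) = kap m • μH[(m : ℝ)] := rfl

lemma kap_ne (m : ℕ) : kap m ≠ 0 := Measure.addHaarScalarFactor_volume_hausdorffMeasure_ne_zero m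

lemma kap_le (m : ℕ) : kap m ≤ 1 := by
  set Q : Set (Fin m → ℝ) := Icc (fun _ => (0:ℝ)) (fun _ => 1) with hQ
  have hQ1 : volume Q = 1 := by rw [hQ, Real.volume_Icc_pi]; simp
  have hQm : MeasurableSet Q := measurableSet_Icc
  set A : Set (Eu m) := WithLp.ofLp ⁻¹' Q with hA
  have hpm := PiLp.volume_preserving_ofLp (Fin m)
  have hv : (volume : Measure (Eu m)) A = 1 := by
    rw [hA, hpm.measure_preimage hQm.nullMeasurableSet, hQ1]
  have hl : LipschitzWith 1 (WithLp.ofLp : Eu m → (Fin m → ℝ)) := PiLp.lipschitzWith_ofLp 2 (fun _ : Fin m => ℝ)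
  have h1 := hl.hausdorffMeasure_image_le (d := m) (by positivity) A
  have himg : (WithLp.ofLp : Eu m → (Fin m → ℝ)) '' A = Q := by
    rw [hA, image_preimage_eq]
    exact (WithLp.ofLp_surjective 2)
  have hH : (μH[(m:ℝ)] : Measure (Fin m → ℝ)) = volume := by
    have := hausdorffMeasure_pi_real (ι := Fin m)
    rwa [Fintype.card_fin] at this
  rw [himg, hH, hQ1, ENNReal.coe_one, ENNReal.one_rpow, one_mul] at h1
  have h2 : (volume : Measure (Eu m)) A = (kap m : ℝ≥0∞) * μH[(m:ℝ)] A := by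
    rw [← EuclideanSpace.euclideanHausdorffMeasure_eq_volume, kap_def, Measure.smul_apply, ENNReal.smul_def, smul_eq_mul]
  rw [hv] at h2
  by_contra hk
  have hk' : (1 : ℝ≥0∞) < kap m := by exact_mod_cast not_le.1 hk
  have : (kap m : ℝ≥0∞) * 1 ≤ kap m * μH[(m:ℝ)] A := by gcongr
  rw [← h2, mul_one] at this
  exact absurd this (not_le.2 hk')

lemma SK_apply {η : Set (Eu n)} (hη : MeasurableSet η) :
    SK K η = ∫⁻ x in (nu K ⁻¹' η) ∩ frontier K, ENNReal.ofReal (gd n x) ∂μHE[n-1] := by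
  rw [SK, Measure.map_apply nu_meas hη, withDensity_apply _ (nu_meas hη), Measure.restrict_restrict (nu_meas hη)]

lemma CB.HE_fin (h : CB K) (hn : 1 ≤ n) : (μHE[n-1] : Measure (Eu n)) (frontier K) < ⊤ := by
  haveI : Fact (CB K) := ⟨h⟩
  obtain ⟨C, hC⟩ := h.gauge_lip
  have : (μHE[n-1] : Measure (Eu n)) (frontier K) = (μHE[n-1] : Measure (Eu n)).restrict (frontier K) univ := by simp
  rw [this, h.surf_eq hn, withDensity_apply _ MeasurableSet.univ, Measure.restrict_univ]
  calc _ ≤ ∫⁻ x, (C : ℝ≥0∞) ∂coneM K := by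
        refine lintegral_mono fun x => ?_
        have := norm_fderiv_le_of_lipschitz ℝ hC (x₀ := x)
        rw [← ofReal_norm, ← ENNReal.ofReal_coe_nnreal]
        exact ENNReal.ofReal_le_ofReal this
    _ < ⊤ := by
        rw [lintegral_const]
        exact ENNReal.mul_lt_top ENNReal.coe_lt_top (measure_lt_top _ _)

lemma gd_le (x : Eu n) : gd n x ≤ (Real.sqrt (2 * Real.pi))⁻¹ ^ n := by
  unfold gd
  have : Real.exp (-‖x‖ ^ 2 / 2) ≤ 1 := Real.exp_le_one_iff.2 (by have := sq_nonneg ‖x‖; linarith)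
  have h2 : 0 ≤ (Real.sqrt (2 * Real.pi))⁻¹ ^ n := by positivity
  nlinarith

lemma CB.SK_fin (h : CB K) (hn : 1 ≤ n) : IsFiniteMeasure (SK K) := by
  refine ⟨?_⟩
  rw [SK_apply MeasurableSet.univ, preimage_univ, univ_inter]
  calc _ ≤ ∫⁻ x in frontier K, ENNReal.ofReal ((Real.sqrt (2 * Real.pi))⁻¹ ^ n) ∂μHE[n-1] :=
        lintegral_mono fun x => ENNReal.ofReal_le_ofReal (gd_le x)
    _ < ⊤ := by
        rw [setLIntegral_const]
        exact ENNReal.mul_lt_top ENNReal.ofReal_lt_top (h.HE_fin hn)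

lemma CB.SK_sphere (h : CB K) (hn : 1 ≤ n) : SK K (sphere (0 : Eu n) 1)ᶜ = 0 := by
  rw [SK_apply isClosed_sphere.measurableSet.compl]
  refine setLIntegral_measure_zero _ _ (measure_mono_null ?_ (h.HE_nonreg hn))
  rintro x ⟨hx1, hx2⟩
  refine ⟨hx2, fun hd => hx1 ?_⟩
  simpa using h.nu_norm hx2 hd

lemma CB.gaussSurf_eq (h : CB K) (hn : 1 ≤ n) {η : Set (Eu n)} (hs : η ⊆ sphere 0 1) (hη : MeasurableSet η) :
    (kap (n-1) : ℝ) * gaussSurf n K η = (SK K η).toReal := by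
  have hcast : ((n - 1 : ℕ) : ℝ) = (n : ℝ) - 1 := by push_cast [hn]; ring
  have hnull : (μH[(n:ℝ)-1] : Measure (Eu n)) (frontier K ∩ {x | DifferentiableAt ℝ (gauge K) x}ᶜ) = 0 := by
    have := h.HE_nonreg hn
    rw [kap_def, Measure.smul_apply, ENNReal.smul_def, smul_eq_mul, mul_eq_zero] at this
    rw [← hcast]
    refine this.resolve_left ?_
    exact_mod_cast kap_ne _
  have hset : {x | x ∈ frontier K ∧ ∃ v ∈ η, ⟪x, v⟫ = suppFun K v} =ᵐ[μH[(n:ℝ)-1]] ((nu K ⁻¹' η) ∩ frontier K : Set (Eu n)) := by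
    have h0 : ∀ᵐ x ∂(μH[(n:ℝ)-1] : Measure (Eu n)), x ∉ (frontier K ∩ {x | DifferentiableAt ℝ (gauge K) x}ᶜ) :=
      measure_eq_zero_iff_ae_notMem.1 hnull
    filter_upwards [h0] with x hx
    apply propext
    constructor
    · rintro ⟨hf, v, hv, e⟩
      have hd : DifferentiableAt ℝ (gauge K) x := by
        by_contra hd; exact hx ⟨hf, hd⟩
      have := h.nu_unique hf hd (by simpa using hs hv) e
      refine ⟨?_, hf⟩
      show nu K x ∈ η
      rwa [← this]
    · rintro ⟨hv, hf⟩
      have hd : DifferentiableAt ℝ (gauge K) x := by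
        by_contra hd; exact hx ⟨hf, hd⟩
      exact ⟨hf, _, hv, by rw [h.inner_nu hf hd, h.supp_nu hf hd]⟩
  unfold gaussSurf
  rw [setIntegral_congr_set hset, SK_apply hη, ← integral_toReal]
  · have : ∀ x : Eu n, (ENNReal.ofReal (gd n x)).toReal = (Real.sqrt (2 * Real.pi))⁻¹ ^ n * Real.exp (-‖x‖ ^ 2 / 2) :=
      fun x => ENNReal.toReal_ofReal (gd_pos x).le
    simp only [this]
    rw [kap_def, Measure.restrict_smul, integral_smul_nnreal_measure, integral_const_mul, hcast]
    rfl
  · exact (gd_cont.measurable.ennreal_ofReal).aemeasurable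
  · simp

lemma gauge_neg' (hs : K = -K) (x : Eu n) : gauge K (-x) = gauge K x :=
  gauge_neg (fun y hy => by rw [hs]; simpa using hy) x

lemma nu_neg (hs : K = -K) (x : Eu n) : nu K (-x) = - nu K x := by
  have hg : gr K (-x) = - gr K x := by
    unfold gr
    have h1 : (fun y => gauge K (-y)) = gauge K := funext (gauge_neg' hs)
    have h2 : fderiv ℝ (fun y => gauge K (-y)) x = - fderiv ℝ (gauge K) (-x) := by
      have := fderiv_comp_smul (𝕜 := ℝ) (f := gauge K) (x := x) (-1)
      simpa using this
    rw [h1] at h2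
    rw [h2, map_neg, neg_neg]
  rw [nu, hg, norm_neg, smul_neg, nu]

lemma SK_neg (hs : K = -K) {η : Set (Eu n)} (hη : MeasurableSet η) : SK K (-η) = SK K η := by
  rw [SK_apply hη.neg, SK_apply hη]
  have hmp : MeasurePreserving (fun x : Eu n => -x) μHE[n-1] μHE[n-1] :=
    (IsometryEquiv.neg (Eu n)).measurePreserving_euclideanHausdorffMeasure (n-1)
  have hfr : (frontier K) = -frontier K := by
    have := (Homeomorph.neg (Eu n)).preimage_frontier K
    have h2 : (Homeomorph.neg (Eu n)) ⁻¹' K = K := by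
      conv_rhs => rw [hs]
      rfl
    rw [h2] at this
    exact this.symm
  have hset : (nu K ⁻¹' (-η)) ∩ frontier K = (fun x : Eu n => -x) ⁻¹' ((nu K ⁻¹' η) ∩ frontier K) := by
    ext x
    have h1 : x ∈ frontier K ↔ -x ∈ frontier K := by
      conv_lhs => rw [hfr]
      exact Set.mem_neg
    simp only [mem_inter_iff, mem_preimage, Set.mem_neg, nu_neg hs, h1]
  rw [hset, ← hmp.setLIntegral_comp_preimage ((nu_meas hη).inter CB.frontier_meas)
    gd_cont.measurable.ennreal_ofReal]
  refine lintegral_congr fun x => ?_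
  simp only [gd, norm_neg]

end skm
end

open MeasureTheory Metric Set Filter
open scoped RealInnerProductSpace Topology Pointwise NNReal ENNReal

noncomputable section
section uni
variable {n : ℕ} {K L M : Set (Eu n)}

lemma gaussVol_mono (hK : MeasurableSet K) (hL : MeasurableSet L) (h : K ⊆ L) : gaussVol n K ≤ gaussVol n L := by
  rw [gaussVol_eq hK, gaussVol_eq hL]
  exact ENNReal.toReal_mono (measure_ne_top _ _) (measure_mono h)

lemma gaussVol_lt_one (hn : 1 ≤ n) (hK : IsCompact K) : gaussVol n K < 1 := by
  have hm := hK.measurableSet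
  rw [gaussVol_eq hm]
  by_contra hcon
  have h1 : gm n K = 1 := by
    refine le_antisymm prob_le_one ?_
    rw [← ENNReal.toReal_one] at hcon
    exact (ENNReal.toReal_le_toReal ENNReal.one_ne_top (measure_ne_top _ _)).1 (not_lt.1 hcon)
  have h2 : gm n Kᶜ = 0 := (prob_compl_eq_zero_iff hm).2 h1
  have h3 := gm_open_pos hK.isClosed.isOpen_compl h2
  rw [compl_empty_iff] at h3
  haveI : Nonempty (Fin n) := ⟨⟨0, hn⟩⟩
  exact noncompact_univ (Eu n) (h3 ▸ hK)

lemma intg_cont {ν : Measure (Eu n)} [IsFiniteMeasure ν] (hν : ν (sphere (0 : Eu n) 1)ᶜ = 0) {f : Eu n → ℝ}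
    (hf : Continuous f) : Integrable f ν := by
  obtain ⟨C, -, hC⟩ := bdd_sphere hf
  refine Integrable.of_bound hf.aestronglyMeasurable C ?_
  have h0 : ∀ᵐ x ∂ν, x ∉ (sphere (0 : Eu n) 1)ᶜ := measure_eq_zero_iff_ae_notMem.1 hν
  filter_upwards [h0] with x hx
  exact hC x (by simpa using hx)

lemma phi_of_half (hn : 1 ≤ n) (hK : IsCompact K) (h : 1 / 2 ≤ gaussVol n K) : ∃ p, 0 ≤ p ∧ Phi p = gaussVol n K := by
  obtain ⟨p, hp⟩ := Phi_surj (by linarith) (gaussVol_lt_one hn hK)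
  refine ⟨p, ?_, hp⟩
  rw [← Phi_strictMono.le_iff_le, Phi_zero, hp]
  exact h

lemma CB.comb (hK : CB K) (hL : CB L) {s t : ℝ} (hs : 0 < s) (ht : 0 < t) : CB (s • K + t • L) := by
  refine ⟨(hK.conv.smul s).add (hL.conv.smul t), (hK.comp.smul s).add (hL.comp.smul t), ?_⟩
  have h1 : s • K ⊆ s • K + t • L := by
    intro x hx
    exact ⟨x, hx, 0, ⟨0, hL.zero_mem, smul_zero _⟩, add_zero _⟩
  refine interior_mono h1 ?_
  rw [interior_smul₀ hs.ne']
  exact ⟨0, hK.int0, smul_zero _⟩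

theorem CB.lemU (h : CB K) (hn : 1 ≤ n) (hK : 1 / 2 ≤ gaussVol n K) (hM : CB M) (hMv : 1 / 2 ≤ gaussVol n M) :
    gaussVol n M - gaussVol n K ≤ ∫ v, (suppFun M v - suppFun K v) ∂SK K := by
  set f : Eu n → ℝ := fun v => suppFun M v - suppFun K v with hfd
  have hf : Continuous f := (suppFun_cont hM.comp hM.ne).sub (suppFun_cont h.comp h.ne)
  refine ge_of_tendsto (h.variation hn hf) ?_
  have ev1 : ∀ᶠ s in 𝓝[>] (0:ℝ), s < 1 := mem_nhdsWithin_of_mem_nhds (Iio_mem_nhds one_pos)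
  obtain ⟨C, hC, hKt⟩ := h.Kt_bounds hf
  have ev2 : ∀ᶠ t in 𝓝[>] (0:ℝ), C * t ≤ 1 / 2 := by
    have : Tendsto (fun t : ℝ => C * t) (𝓝[>] 0) (𝓝 0) := by
      have := ((continuous_const_mul C).tendsto 0).mono_left (nhdsWithin_le_nhds (s := Ioi (0:ℝ)))
      simpa using this
    exact (this.eventually_lt_const (by norm_num : (0:ℝ) < 1 / 2)).mono fun _ h => h.le
  obtain ⟨p, hp0, hp⟩ := phi_of_half hn h.comp hK
  obtain ⟨q, hq0, hq⟩ := phi_of_half hn hM.comp hMv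
  filter_upwards [self_mem_nhdsWithin, ev1, ev2] with s hs0 hs1 hs2
  have hs0 : 0 < s := hs0
  have hcb := (hKt s hs0 hs2).1
  have hsub : (1 - s) • K + s • M ⊆ Kt K f s := by
    rintro _ ⟨_, ⟨x, hx, rfl⟩, _, ⟨y, hy, rfl⟩, rfl⟩ v hv
    simp only [inner_add_left, real_inner_smul_left, hfd]
    have a1 := mul_le_mul_of_nonneg_left (le_suppFun h.comp hx v) (by linarith : (0:ℝ) ≤ 1 - s)
    have a2 := mul_le_mul_of_nonneg_left (le_suppFun hM.comp hy v) hs0.le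
    linarith
  have h1 := ehrhard_set h.comp hM.comp h.ne hM.ne (by linarith : (0:ℝ) < 1 - s) hs0 (by ring) hp.le hq.le
  have h2 := gaussVol_mono ((h.comp.smul (1-s)).add (hM.comp.smul s)).measurableSet hcb.comp.measurableSet hsub
  have h3 := Phi_strictConcave.concaveOn.2 hp0 hq0 (by linarith : (0:ℝ) ≤ 1 - s) hs0.le (by ring)
  simp only [smul_eq_mul, hp, hq] at h3
  rw [le_div_iff₀ hs0]
  linarith

theorem uniq_body (hn : 1 ≤ n) (hK : CB K) (hL : CB L) (hKv : 1 / 2 < gaussVol n K) (hLv : 1 / 2 < gaussVol n L)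
    (hS : SK K = SK L) : K = L := by
  set M := (1/2 : ℝ) • K + (1/2 : ℝ) • L with hMd
  have hM : CB M := hK.comb hL (by norm_num) (by norm_num)
  have hhalf : (0:ℝ) < 1 / 2 := by norm_num
  obtain ⟨p, hp0, hp⟩ := phi_of_half hn hK.comp hKv.le
  obtain ⟨q, hq0, hq⟩ := phi_of_half hn hL.comp hLv.le
  have hE := ehrhard_set hK.comp hL.comp hK.ne hL.ne hhalf hhalf (by norm_num) hp.le hq.le
  rw [← hMd] at hE
  have hcon := Phi_strictConcave.concaveOn.2 hp0 hq0 hhalf.le hhalf.le (by norm_num)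
  simp only [smul_eq_mul, hp, hq] at hcon
  have hMv : 1 / 2 ≤ gaussVol n M := by linarith
  have u1 := hK.lemU hn hKv.le hM hMv
  have u2 := hL.lemU hn hLv.le hM hMv
  rw [← hS] at u2
  haveI := hK.SK_fin hn
  have hcM := suppFun_cont hM.comp hM.ne
  have hcK := suppFun_cont hK.comp hK.ne
  have hcL := suppFun_cont hL.comp hL.ne
  have hsum : ∫ v, (suppFun M v - suppFun K v) ∂SK K + ∫ v, (suppFun M v - suppFun L v) ∂SK K = 0 := by
    have i1 : Integrable (fun v => suppFun M v - suppFun K v) (SK K) := intg_cont (hK.SK_sphere hn) (hcM.sub hcK)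
    have i2 : Integrable (fun v => suppFun M v - suppFun L v) (SK K) := intg_cont (hK.SK_sphere hn) (hcM.sub hcL)
    rw [← integral_add i1 i2]
    rw [← integral_zero (Eu n) ℝ (μ := SK K)]
    refine integral_congr_ae (Eventually.of_forall fun v => ?_)
    simp only [hMd, suppFun_smul_comb hK.comp hL.comp hK.ne hL.ne hhalf.le hhalf.le]
    ring
  have hle : 2 * gaussVol n M ≤ gaussVol n K + gaussVol n L := by linarith
  have hpq : p = q := by
    by_contra hne
    have := Phi_strictConcave.2 hp0 hq0 hne hhalf hhalf (by norm_num)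
    simp only [smul_eq_mul, hp, hq] at this
    linarith
  have hKL : gaussVol n L = gaussVol n K := by rw [← hp, ← hq, hpq]
  have hMK : gaussVol n M = gaussVol n K := by
    refine le_antisymm (by linarith) (by linarith)
  have hdense : ∀ {A : Set (Eu n)}, CB A → A ⊆ closure (interior A) := by
    intro A hA
    rw [hA.conv.closure_interior_eq_closure_of_nonempty_interior ⟨0, hA.int0⟩]
    exact subset_closure
  refine Subset.antisymm ?_ ?_
  · exact gauss_strict hK.comp hL.comp hK.ne hL.ne (hdense hK) (by linarith) hKL hMK
  · refine gauss_strict hL.comp hK.comp hL.ne hK.ne (hdense hL) (by linarith) hKL.symm ?_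
    rw [add_comm, ← hMd, hMK, hKL]

end uni
end

open MeasureTheory Metric Set Filter
open scoped RealInnerProductSpace Topology Pointwise NNReal ENNReal

noncomputable section
section tail
variable {n : ℕ}

lemma gauss_exp_int {a : ℝ} (ha : a < 1) : Integrable (fun x : Eu n => Real.exp (a * ‖x‖ ^ 2 / 2)) (gm n) := by
  unfold gm
  rw [integrable_withDensity_iff_integrable_smul' (gd_cont.measurable.ennreal_ofReal) (by simp)]
  have hs : 0 < Real.sqrt (1 - a) := Real.sqrt_pos.2 (by linarith)
  have h1 := (gd_integrable n).comp_smul hs.ne'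
  refine h1.congr (Eventually.of_forall fun x => ?_)
  simp only [smul_eq_mul]
  rw [ENNReal.toReal_ofReal (gd_pos x).le, gd, gd, mul_assoc, ← Real.exp_add, norm_smul, mul_pow, Real.norm_eq_abs, sq_abs,
    Real.sq_sqrt (by linarith)]
  ring_nf

lemma Phi_tail (x : ℝ) (hx : 0 ≤ x) : Phi x + ph (x + 1) ≤ 1 := by
  have h1 : Phi (x + 1) < 1 := Phi_lt_one _
  obtain ⟨c, hc, he⟩ := exists_hasDerivAt_eq_slope Phi ph (by linarith : x < x + 1) Phi_cont.continuousOn (fun y _ => Phi_hasDerivAt y)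
  have h2 : ph (x + 1) ≤ ph c := by
    unfold ph
    have : c ^ 2 ≤ (x + 1) ^ 2 := by
      have := hc.1; have := hc.2
      exact pow_le_pow_left₀ (by linarith) (by linarith) 2
    gcongr
  have e : x + 1 - x = 1 := by ring
  rw [e, div_one] at he
  linarith

lemma ball_tail {q : ℝ} (hq0 : 0 < q) (hq : q < 1) : ∃ R > 0, Phi (q * R) ≤ gaussVol n (closedBall 0 R) := by
  obtain ⟨a', ha1, ha2⟩ := exists_between hq
  set a := a' ^ 2 with had
  have ha' : 0 < a' := hq0.trans ha1
  have ha : a < 1 := by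
    have : a' * a' < 1 * 1 := mul_lt_mul'' ha2 ha2 ha'.le ha'.le
    rw [had, sq]; linarith
  have hIntg := gauss_exp_int (n := n) ha
  set C := ∫ x : Eu n, Real.exp (a * ‖x‖ ^ 2 / 2) ∂(gm n) with hC
  have hCpos : 0 ≤ C := integral_nonneg fun x => (Real.exp_pos _).le
  have key : ∀ R : ℝ, 0 < R → 1 - gaussVol n (closedBall 0 R) ≤ C * Real.exp (-(a * R ^ 2 / 2)) := by
    intro R hR
    have hm := mul_meas_ge_le_integral_of_nonneg (Eventually.of_forall fun x => (Real.exp_pos _).le) hIntg (Real.exp (a * R ^ 2 / 2))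
    have hsub : (closedBall (0 : Eu n) R)ᶜ ⊆ {x : Eu n | Real.exp (a * R ^ 2 / 2) ≤ Real.exp (a * ‖x‖ ^ 2 / 2)} := by
      intro x hx
      have hx : R < ‖x‖ := by simpa using hx
      simp only [mem_ofPred_eq]
      have : 0 ≤ a := sq_nonneg _
      gcongr
    have h1 : (gm n).real (closedBall (0 : Eu n) R)ᶜ ≤ (gm n).real {x : Eu n | Real.exp (a * R ^ 2 / 2) ≤ Real.exp (a * ‖x‖ ^ 2 / 2)} :=
      measureReal_mono hsub
    have h2 : (gm n).real (closedBall (0 : Eu n) R)ᶜ = 1 - gaussVol n (closedBall 0 R) := by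
      rw [probReal_compl_eq_one_sub isClosed_closedBall.measurableSet, gaussVol_eq isClosed_closedBall.measurableSet]
      rfl
    rw [← h2, Real.exp_neg, ← div_eq_mul_inv, le_div_iff₀ (Real.exp_pos _)]
    calc _ ≤ _ := mul_le_mul_of_nonneg_right h1 (Real.exp_pos _).le
      _ = _ := mul_comm _ _
      _ ≤ _ := hm
  have hs := sqrt2pi_pos
  have hlim : Tendsto (fun R : ℝ => Real.exp (a * R ^ 2 / 2 - (q * R + 1) ^ 2 / 2)) atTop atTop := by
    refine Real.tendsto_exp_atTop.comp ?_
    have e : (fun R : ℝ => a * R ^ 2 / 2 - (q * R + 1) ^ 2 / 2) = fun R => R * ((a - q ^ 2) / 2 * R + (-q)) + (-1/2) := by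
      funext R; ring
    rw [e]
    have hp : 0 < (a - q ^ 2) / 2 := by
      have : q * q < a' * a' := mul_lt_mul'' ha1 ha1 hq0.le hq0.le
      rw [had, sq, sq]; linarith
    refine tendsto_atTop_add_const_right _ _ ?_
    refine tendsto_id.atTop_mul_atTop₀ ?_
    exact tendsto_atTop_add_const_right _ _ (tendsto_id.const_mul_atTop hp)
  obtain ⟨R, hR0, hR1⟩ := ((eventually_gt_atTop (0:ℝ)).and (hlim.eventually_ge_atTop (C * Real.sqrt (2 * Real.pi)))).exists
  refine ⟨R, hR0, ?_⟩
  have t1 := Phi_tail (q * R) (by positivity)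
  have t2 := key R hR0
  have t3 : C * Real.exp (-(a * R ^ 2 / 2)) ≤ ph (q * R + 1) := by
    unfold ph
    have e : Real.exp (a * R ^ 2 / 2 - (q * R + 1) ^ 2 / 2) = Real.exp (-(q * R + 1) ^ 2 / 2) * Real.exp (a * R ^ 2 / 2) := by
      rw [← Real.exp_add]; congr 1; ring
    rw [e] at hR1
    rw [Real.exp_neg, ← div_eq_mul_inv, div_le_iff₀ (Real.exp_pos _), mul_assoc, ← div_eq_inv_mul, le_div_iff₀ hs]
    exact hR1
  linarith

lemma width_pos {ν : Measure (Eu n)} [IsFiniteMeasure ν] (hn : 1 ≤ n) (hν : ν (sphere (0 : Eu n) 1)ᶜ = 0)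
    (hsub : ∀ v : Eu n, ‖v‖ = 1 → ν {x | ⟪x, v⟫ ≠ 0} ≠ 0) :
    ∃ c > 0, ∀ w : Eu n, c * ‖w‖ ≤ ∫ v, |⟪w, v⟫| ∂ν := by
  have hIntg : ∀ w : Eu n, Integrable (fun v => |⟪w, v⟫|) ν := fun w => intg_cont hν (by fun_prop)
  have hae : ∀ᵐ x ∂ν, ‖x‖ = 1 := by
    have h0 : ∀ᵐ x ∂ν, x ∉ (sphere (0 : Eu n) 1)ᶜ := measure_eq_zero_iff_ae_notMem.1 hν
    filter_upwards [h0] with x hx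
    simpa using hx
  have hcont : Continuous (fun w : Eu n => ∫ v, |⟪w, v⟫| ∂ν) := by
    refine continuous_iff_continuousAt.2 fun w0 => ?_
    refine continuousAt_of_dominated (bound := fun _ => ‖w0‖ + 1) ?_ ?_ (integrable_const _) ?_
    · exact Eventually.of_forall fun w => (hIntg w).aestronglyMeasurable
    · filter_upwards [ball_mem_nhds w0 one_pos] with w hw
      filter_upwards [hae] with v hv
      have h1 := abs_real_inner_le_norm w v
      rw [hv, mul_one] at h1
      have h2 : ‖w‖ ≤ ‖w0‖ + ‖w - w0‖ := by
        have := norm_add_le w0 (w - w0); simpa using this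
      have h3 : ‖w - w0‖ < 1 := by rw [← dist_eq_norm]; exact hw
      rw [Real.norm_eq_abs, abs_abs]
      linarith
    · exact Eventually.of_forall fun v => by fun_prop
  haveI : Nonempty (Fin n) := ⟨⟨0, hn⟩⟩
  have hne : (sphere (0 : Eu n) 1).Nonempty := NormedSpace.sphere_nonempty.2 zero_le_one
  obtain ⟨w0, hw0, hmin⟩ := (isCompact_sphere (0 : Eu n) 1).exists_isMinOn hne hcont.continuousOn
  have hw1 : ‖w0‖ = 1 := by simpa using hw0
  refine ⟨∫ v, |⟪w0, v⟫| ∂ν, ?_, fun w => ?_⟩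
  · refine lt_of_le_of_ne (integral_nonneg fun v => abs_nonneg _) fun he => ?_
    have := (integral_eq_zero_iff_of_nonneg (fun v => abs_nonneg _) (hIntg w0)).1 he.symm
    refine hsub w0 hw1 ?_
    rw [← ae_iff (p := fun x : Eu n => ⟪x, w0⟫ = 0)]
    filter_upwards [this] with v hv
    rw [real_inner_comm]
    exact abs_eq_zero.1 hv
  · by_cases hw : w = 0
    · simp [hw]
    · have hp : 0 < ‖w‖ := norm_pos_iff.2 hw
      have h1 : ∫ v, |⟪w0, v⟫| ∂ν ≤ ∫ v, |⟪‖w‖⁻¹ • w, v⟫| ∂ν :=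
        hmin (show ‖w‖⁻¹ • w ∈ sphere (0 : Eu n) 1 by simp [norm_smul, hp.ne'])
      have h2 : ∫ v, |⟪‖w‖⁻¹ • w, v⟫| ∂ν = ‖w‖⁻¹ * ∫ v, |⟪w, v⟫| ∂ν := by
        rw [← integral_const_mul]
        refine integral_congr_ae (Eventually.of_forall fun v => ?_)
        simp only [real_inner_smul_left, abs_mul, abs_inv, abs_norm]
      rw [h2, ← div_eq_inv_mul, le_div_iff₀ hp] at h1
      exact h1

end tail
end

open MeasureTheory Metric Set Filter
open scoped RealInnerProductSpace Topology Pointwise NNReal ENNReal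

noncomputable section
section cpt
variable {n : ℕ}
open TopologicalSpace

lemma nc_close {K L : NonemptyCompacts (Eu n)} {ε : ℝ} (h : dist K L < ε) {x : Eu n} (hx : x ∈ (K : Set (Eu n))) :
    ∃ y ∈ (L : Set (Eu n)), dist x y < ε := by
  rw [NonemptyCompacts.dist_eq] at h
  exact exists_dist_lt_of_hausdorffDist_lt hx h
    (hausdorffEDist_ne_top_of_nonempty_of_bounded K.nonempty L.nonempty K.isCompact.isBounded L.isCompact.isBounded)

lemma nc_mem {K : NonemptyCompacts (Eu n)} {x : Eu n} (h : ∀ ε > 0, ∃ y ∈ (K : Set (Eu n)), dist x y < ε) :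
    x ∈ (K : Set (Eu n)) := by
  have := Metric.mem_closure_iff.2 h
  rwa [K.isCompact.isClosed.closure_eq] at this

lemma nc_closed_conv : IsClosed {K : NonemptyCompacts (Eu n) | Convex ℝ (K : Set (Eu n))} := by
  refine isClosed_of_closure_subset fun K hK => ?_
  rw [Metric.mem_closure_iff] at hK
  intro x hx y hy a b ha hb hab
  refine nc_mem fun ε hε => ?_
  obtain ⟨L, hL, hd⟩ := hK (ε / 2) (by positivity)
  obtain ⟨x', hx', dx⟩ := nc_close hd hx
  obtain ⟨y', hy', dy⟩ := nc_close hd hy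
  obtain ⟨z, hz, dz⟩ := nc_close (by rwa [dist_comm] at hd) (hL hx' hy' ha hb hab)
  refine ⟨z, hz, ?_⟩
  have h1 : dist (a • x + b • y) (a • x' + b • y') ≤ ε / 2 := by
    rw [dist_eq_norm]
    have e : a • x + b • y - (a • x' + b • y') = a • (x - x') + b • (y - y') := by module
    rw [e]
    calc _ ≤ ‖a • (x - x')‖ + ‖b • (y - y')‖ := norm_add_le _ _
      _ = a * dist x x' + b * dist y y' := by
          rw [norm_smul, norm_smul, Real.norm_of_nonneg ha, Real.norm_of_nonneg hb, dist_eq_norm, dist_eq_norm]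
      _ ≤ a * (ε / 2) + b * (ε / 2) := by gcongr
      _ = ε / 2 := by rw [← add_mul, hab, one_mul]
  calc _ ≤ _ := dist_triangle _ (a • x' + b • y') _
    _ < ε / 2 + ε / 2 := by linarith
    _ = ε := by ring

lemma nc_closed_sym : IsClosed {K : NonemptyCompacts (Eu n) | ∀ x ∈ (K : Set (Eu n)), -x ∈ (K : Set (Eu n))} := by
  refine isClosed_of_closure_subset fun K hK => ?_
  rw [Metric.mem_closure_iff] at hK
  intro x hx
  refine nc_mem fun ε hε => ?_
  obtain ⟨L, hL, hd⟩ := hK (ε / 2) (by positivity)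
  obtain ⟨x', hx', dx⟩ := nc_close hd hx
  obtain ⟨z, hz, dz⟩ := nc_close (by rwa [dist_comm] at hd) (hL _ hx')
  refine ⟨z, hz, ?_⟩
  calc _ ≤ _ := dist_triangle _ (-x') _
    _ < ε / 2 + ε / 2 := by rw [dist_neg_neg]; linarith
    _ = ε := by ring

lemma nc_usc : UpperSemicontinuous (fun K : NonemptyCompacts (Eu n) => gaussVol n K) := by
  intro K c hc
  have hKm := K.isCompact.measurableSet
  simp only [gaussVol_eq hKm] at hc
  have ht := tendsto_measure_cthickening_of_isCompact (μ := gm n) K.isCompact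
  have ht' := (ENNReal.tendsto_toReal (measure_ne_top (gm n) (K : Set (Eu n)))).comp ht
  have hev := (ht'.eventually_lt_const hc)
  rw [Metric.eventually_nhds_iff] at hev
  obtain ⟨ε, hε, hb⟩ := hev
  have h1 : (gm n (cthickening (ε / 2) (K : Set (Eu n)))).toReal < c := hb (by rw [Real.dist_0_eq_abs, abs_of_pos (by positivity)]; linarith)
  filter_upwards [ball_mem_nhds K (show 0 < ε / 2 by positivity)] with L hL
  have hsub : (L : Set (Eu n)) ⊆ cthickening (ε / 2) (K : Set (Eu n)) := by
    intro x hx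
    obtain ⟨y, hy, hd⟩ := nc_close (mem_ball.1 hL) hx
    exact mem_cthickening_of_dist_le x y _ _ hy hd.le
  rw [gaussVol_eq L.isCompact.measurableSet]
  exact lt_of_le_of_lt (ENNReal.toReal_mono (measure_ne_top _ _) (measure_mono hsub)) h1

lemma nc_supp {K L : NonemptyCompacts (Eu n)} {v : Eu n} (hv : ‖v‖ = 1) :
    suppFun (K : Set (Eu n)) v ≤ suppFun (L : Set (Eu n)) v + dist K L := by
  refine le_of_forall_pos_lt_add fun ε hε => ?_
  obtain ⟨x, hx, he⟩ := suppFun_attained K.isCompact K.nonempty v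
  obtain ⟨y, hy, hd⟩ := nc_close (show dist K L < dist K L + ε by linarith) hx
  have h1 := le_suppFun L.isCompact hy v
  have h2 := real_inner_le_norm (x - y) v
  rw [hv, mul_one, inner_sub_left, ← dist_eq_norm] at h2
  linarith

lemma nc_int_cont {ν : Measure (Eu n)} [IsFiniteMeasure ν] (hν : ν (sphere (0 : Eu n) 1)ᶜ = 0) :
    Continuous (fun K : NonemptyCompacts (Eu n) => ∫ v, suppFun (K : Set (Eu n)) v ∂ν) := by
  have hae : ∀ᵐ x ∂ν, ‖x‖ = 1 := by
    have h0 : ∀ᵐ x ∂ν, x ∉ (sphere (0 : Eu n) 1)ᶜ := measure_eq_zero_iff_ae_notMem.1 hν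
    filter_upwards [h0] with x hx
    simpa using hx
  have hi : ∀ K : NonemptyCompacts (Eu n), Integrable (suppFun (K : Set (Eu n))) ν := fun K =>
    intg_cont hν (suppFun_cont K.isCompact K.nonempty)
  have key : ∀ K L : NonemptyCompacts (Eu n), ∫ v, suppFun (K : Set (Eu n)) v ∂ν ≤ ∫ v, suppFun (L : Set (Eu n)) v ∂ν + ν.real univ * dist K L := by
    intro K L
    have : ∫ v, suppFun (K : Set (Eu n)) v ∂ν ≤ ∫ v, (suppFun (L : Set (Eu n)) v + dist K L) ∂ν := by
      refine integral_mono_ae (hi K) ((hi L).add (integrable_const _)) ?_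
      filter_upwards [hae] with v hv
      exact nc_supp hv
    rwa [integral_add (hi L) (integrable_const _), integral_const, smul_eq_mul] at this
  refine LipschitzWith.continuous (K := Real.toNNReal (ν.real univ)) (LipschitzWith.of_dist_le_mul fun K L => ?_)
  rw [Real.coe_toNNReal _ measureReal_nonneg, Real.dist_eq, abs_le]
  have a1 := key K L
  have a2 := key L K
  rw [dist_comm L K] at a2
  constructor <;> linarith

/-- functional -/
def FF (ν : Measure (Eu n)) (K : Set (Eu n)) : ℝ := gaussVol n K - ∫ v, suppFun K v ∂ν

lemma exists_max_ball {ν : Measure (Eu n)} [IsFiniteMeasure ν] (hν : ν (sphere (0 : Eu n) 1)ᶜ = 0) {R : ℝ} (hR : 0 ≤ R)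
    (hv : 1 / 2 ≤ gaussVol n (closedBall 0 R)) :
    ∃ K : Set (Eu n), (IsCompact K ∧ K.Nonempty ∧ Convex ℝ K ∧ (∀ x ∈ K, -x ∈ K) ∧ 1 / 2 ≤ gaussVol n K) ∧
      ∀ L : Set (Eu n), IsCompact L → L.Nonempty → Convex ℝ L → (∀ x ∈ L, -x ∈ L) → L ⊆ closedBall 0 R →
        1 / 2 ≤ gaussVol n L → FF ν L ≤ FF ν K := by
  set A : Set (NonemptyCompacts (Eu n)) := {K | (K : Set (Eu n)) ⊆ closedBall 0 R} ∩
    ({K | Convex ℝ (K : Set (Eu n))} ∩ {K | ∀ x ∈ (K : Set (Eu n)), -x ∈ (K : Set (Eu n))} ∩ {K | 1 / 2 ≤ gaussVol n K}) with hA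
  have hcl : IsClosed {K : NonemptyCompacts (Eu n) | 1 / 2 ≤ gaussVol n K} := nc_usc.isClosed_preimage (1 / 2)
  have hAc : IsCompact A := (NonemptyCompacts.isCompact_subsets_of_isCompact (isCompact_closedBall 0 R)).inter_right
    ((nc_closed_conv.inter nc_closed_sym).inter hcl)
  have hAn : A.Nonempty := by
    refine ⟨⟨⟨closedBall 0 R, isCompact_closedBall 0 R⟩, nonempty_closedBall.2 hR⟩, fun _ h => h, ⟨convex_closedBall _ _, ?_⟩, hv⟩
    intro x hx
    have hx' : ‖x‖ ≤ R := by simpa using hx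
    show -x ∈ closedBall (0 : Eu n) R
    simpa using hx'
  have husc : UpperSemicontinuous (fun K : NonemptyCompacts (Eu n) => FF ν K) := by
    have := nc_usc.add (nc_int_cont hν).neg.upperSemicontinuous
    have e : (fun K : NonemptyCompacts (Eu n) => FF ν K) =
        fun K : NonemptyCompacts (Eu n) => gaussVol n K + (-∫ v, suppFun (K : Set (Eu n)) v ∂ν) := by
      funext K; simp [FF, sub_eq_add_neg]
    rw [e]; exact this
  obtain ⟨K, hK, hmax⟩ := (husc.upperSemicontinuousOn A).exists_isMaxOn hAn hAc
  refine ⟨K, ⟨K.isCompact, K.nonempty, hK.2.1.1, hK.2.1.2, hK.2.2⟩, fun L h1 h2 h3 h4 h5 h6 => ?_⟩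
  exact hmax (show (⟨⟨L, h1⟩, h2⟩ : NonemptyCompacts (Eu n)) ∈ A from ⟨h5, ⟨h3, h4⟩, h6⟩)

end cpt
end

open MeasureTheory Metric Set Filter
open scoped RealInnerProductSpace Topology Pointwise NNReal ENNReal

noncomputable section
section exi
variable {n : ℕ}

structure Adm {n : ℕ} (L : Set (Eu n)) : Prop where
  comp : IsCompact L
  ne : L.Nonempty
  conv : Convex ℝ L
  sym : ∀ x ∈ L, -x ∈ L
  vol : 1 / 2 ≤ gaussVol n L

lemma Adm.ball {R : ℝ} (hR : 0 ≤ R) (hv : 1 / 2 ≤ gaussVol n (closedBall 0 R)) : Adm (closedBall (0 : Eu n) R) := by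
  refine ⟨isCompact_closedBall 0 R, nonempty_closedBall.2 hR, convex_closedBall _ _, fun x hx => ?_, hv⟩
  have hx' : ‖x‖ ≤ R := by simpa using hx
  simpa using hx'

lemma Adm.zero {L : Set (Eu n)} (h : Adm L) : (0 : Eu n) ∈ L := by
  obtain ⟨x, hx⟩ := h.ne
  have := h.conv hx (h.sym x hx) (by norm_num : (0:ℝ) ≤ 1/2) (by norm_num : (0:ℝ) ≤ 1/2) (by norm_num)
  simpa using this

lemma Adm.supp_nonneg {L : Set (Eu n)} (h : Adm L) (v : Eu n) : 0 ≤ suppFun L v := by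
  have := le_suppFun h.comp h.zero v
  simpa using this

lemma Adm.abs_le {L : Set (Eu n)} (h : Adm L) {x : Eu n} (hx : x ∈ L) (v : Eu n) : |⟪x, v⟫| ≤ suppFun L v := by
  rw [abs_le']
  refine ⟨le_suppFun h.comp hx v, ?_⟩
  have := le_suppFun h.comp (h.sym x hx) v
  rwa [inner_neg_left] at this

lemma exists_max {ν : Measure (Eu n)} [IsFiniteMeasure ν] (hn : 1 ≤ n) (hν : ν (sphere (0 : Eu n) 1)ᶜ = 0)
    (hsub : ∀ v : Eu n, ‖v‖ = 1 → ν {x | ⟪x, v⟫ ≠ 0} ≠ 0) :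
    ∃ K : Set (Eu n), Adm K ∧ ∀ L, Adm L → FF ν L ≤ FF ν K := by
  obtain ⟨c, hc, hw⟩ := width_pos hn hν hsub
  obtain ⟨R0, hR0, hb⟩ := ball_tail (n := n) (q := 1/2) (by norm_num) (by norm_num)
  have hv0 : 1 / 2 ≤ gaussVol n (closedBall (0 : Eu n) R0) := by
    rw [← Phi_zero]
    refine le_trans (Phi_strictMono.monotone ?_) hb
    positivity
  set F0 := FF ν (closedBall (0 : Eu n) R0) with hF0
  set R := max R0 ((1 - F0) / c) with hRd
  have hRR : R0 ≤ R := le_max_left _ _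
  have hRc : 1 - F0 ≤ c * R := by
    have : (1 - F0) / c ≤ R := le_max_right _ _
    rw [div_le_iff₀ hc] at this
    linarith
  have hsubb : closedBall (0 : Eu n) R0 ⊆ closedBall 0 R := closedBall_subset_closedBall hRR
  have hvR : 1 / 2 ≤ gaussVol n (closedBall (0 : Eu n) R) :=
    hv0.trans (gaussVol_mono measurableSet_closedBall measurableSet_closedBall hsubb)
  obtain ⟨K, ⟨k1, k2, k3, k4, k5⟩, hmax⟩ := exists_max_ball hν (hR0.le.trans hRR) hvR
  refine ⟨K, ⟨k1, k2, k3, k4, k5⟩, fun L hL => ?_⟩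
  by_cases hLR : L ⊆ closedBall 0 R
  · exact hmax L hL.comp hL.ne hL.conv hL.sym hLR hL.vol
  · obtain ⟨x, hx, hxR⟩ := not_subset.1 hLR
    have hxn : R < ‖x‖ := by simpa using hxR
    have hB := Adm.ball hR0.le hv0
    have h0 := hmax _ hB.comp hB.ne hB.conv hB.sym hsubb hv0
    refine le_trans ?_ h0
    have h1 : ∫ v, |⟪x, v⟫| ∂ν ≤ ∫ v, suppFun L v ∂ν :=
      integral_mono (intg_cont hν (by fun_prop)) (intg_cont hν (suppFun_cont hL.comp hL.ne)) (fun v => hL.abs_le hx v)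
    have h2 := gaussVol_lt_one hn hL.comp
    have h3 := hw x
    have h4 : c * R ≤ c * ‖x‖ := by gcongr
    show gaussVol n L - ∫ v, suppFun L v ∂ν ≤ F0
    linarith

lemma Adm.cb {K : Set (Eu n)} (h : Adm K) : CB K := by
  refine ⟨h.conv, h.comp, ?_⟩
  have hne : (interior K).Nonempty := by
    by_contra hcon
    rw [not_nonempty_iff_eq_empty] at hcon
    have h0 : (volume : Measure (Eu n)) K = 0 := by
      refine measure_mono_null ?_ (h.conv.addHaar_frontier volume)
      rw [frontier, hcon, sdiff_empty]
      exact subset_closure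
    have : gaussVol n K = 0 := by
      unfold gaussVol
      rw [Measure.restrict_eq_zero.2 h0]; simp
    have := h.vol
    linarith
  obtain ⟨x, hx⟩ := hne
  have hs : -x ∈ interior K := by
    have he : -K = K := by
      ext y; constructor
      · intro hy; have := h.sym _ hy; simpa using this
      · intro hy; exact h.sym _ hy
    have : interior K = -interior K := by
      conv_lhs => rw [← he]
      exact ((Homeomorph.neg (Eu n)).preimage_interior K).symm
    rw [this]; simpa using hx
  have := h.conv.interior hx hs (by norm_num : (0:ℝ) ≤ 1/2) (by norm_num : (0:ℝ) ≤ 1/2) (by norm_num)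
  simpa using this

lemma Adm.eq_neg {K : Set (Eu n)} (h : Adm K) : K = -K := by
  ext y; constructor
  · intro hy; exact h.sym _ hy
  · intro hy; have := h.sym _ hy; simpa using this

lemma max_half {ν : Measure (Eu n)} [IsFiniteMeasure ν] (hn : 1 ≤ n) (hν : ν (sphere (0 : Eu n) 1)ᶜ = 0)
    (hm : (ν univ).toReal < 1 / Real.sqrt (2 * Real.pi))
    {K : Set (Eu n)} (hK : Adm K) (hmax : ∀ L, Adm L → FF ν L ≤ FF ν K) : 1 / 2 < gaussVol n K := by
  by_contra hcon
  have hv : gaussVol n K = 1 / 2 := le_antisymm (not_lt.1 hcon) hK.vol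
  set m := (ν univ).toReal with hmd
  have hm0 : 0 ≤ m := ENNReal.toReal_nonneg
  have hpi := sqrt2pi_pos
  obtain ⟨q, hq1, hq2⟩ : ∃ q, Real.sqrt (2 * Real.pi) * m < q ∧ q < 1 := by
    apply exists_between
    rw [lt_div_iff₀ hpi] at hm
    linarith
  have hq0 : 0 < q := lt_of_le_of_lt (by positivity) hq1
  obtain ⟨R, hR, hb⟩ := ball_tail (n := n) hq0 hq2
  set B := closedBall (0 : Eu n) R with hB
  have hBv : 1 / 2 ≤ gaussVol n B := by
    rw [← Phi_zero]
    refine le_trans (Phi_strictMono.monotone ?_) hb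
    positivity
  have hBA : Adm B := Adm.ball hR.le hBv
  -- derivative
  have hder : HasDerivAt (fun t : ℝ => Phi (t * (q * R)) - t * (R * m)) (ph 0 * (q * R) - R * m) 0 := by
    have h1 : HasDerivAt (fun t : ℝ => t * (q * R)) (q * R) 0 := by simpa using (hasDerivAt_id (0:ℝ)).mul_const (q * R)
    have h3 : HasDerivAt (fun t : ℝ => t * (R * m)) (R * m) 0 := by simpa using (hasDerivAt_id (0:ℝ)).mul_const (R * m)
    have h2 : HasDerivAt Phi (ph 0) (0 * (q * R)) := by rw [zero_mul]; exact Phi_hasDerivAt 0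
    exact (h2.comp (0:ℝ) h1).sub h3
  have hpos : 0 < ph 0 * (q * R) - R * m := by
    have e : ph 0 = (Real.sqrt (2 * Real.pi))⁻¹ := by simp [ph]
    have : m < (Real.sqrt (2 * Real.pi))⁻¹ * q := by
      rw [inv_mul_eq_div, lt_div_iff₀ hpi]; linarith
    rw [e]
    have := mul_lt_mul_of_pos_left this hR
    linarith
  obtain ⟨t, ht0, ht1, htp⟩ : ∃ t : ℝ, 0 < t ∧ t < 1 ∧ 1 / 2 + t * (R * m) < Phi (t * (q * R)) := by
    have ht := hder.tendsto_slope_zero_right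
    have ev := ht.eventually (lt_mem_nhds hpos)
    have ev0 : ∀ᶠ t in 𝓝[>] (0:ℝ), 0 < t := self_mem_nhdsWithin
    have ev1 : ∀ᶠ t in 𝓝[>] (0:ℝ), t < 1 := nhdsWithin_le_nhds (gt_mem_nhds one_pos)
    obtain ⟨t, a, b, c⟩ := (ev.and (ev0.and ev1)).exists
    refine ⟨t, b, c, ?_⟩
    simp only [zero_add, zero_mul, Phi_zero, sub_zero, smul_eq_mul] at a
    have := (mul_pos_iff_of_pos_left (inv_pos.2 b)).1 a
    linarith
  set L := (1 - t) • K + t • B with hL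
  have hs : 0 < 1 - t := by linarith
  have hLv : Phi (t * (q * R)) ≤ gaussVol n L := by
    have := ehrhard_set hK.comp hBA.comp hK.ne hBA.ne hs ht0 (by ring) (p := 0) (q := q * R) (by rw [Phi_zero, hv]) hb
    simpa using this
  have hLA : Adm L := by
    refine ⟨(hK.comp.smul _).add (hBA.comp.smul _), hK.ne.smul_set.add hBA.ne.smul_set,
      (hK.conv.smul _).add (hBA.conv.smul _), ?_, ?_⟩
    · rintro _ ⟨_, ⟨a, ha, rfl⟩, _, ⟨b, hb', rfl⟩, rfl⟩
      refine ⟨_, ⟨-a, hK.sym a ha, rfl⟩, _, ⟨-b, hBA.sym b hb', rfl⟩, ?_⟩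
      simp only [smul_neg]; abel
    · have : 0 ≤ t * (R * m) := by positivity
      linarith
  have hle := hmax L hLA
  have hiK := intg_cont hν (suppFun_cont hK.comp hK.ne)
  have hiB := intg_cont hν (suppFun_cont hBA.comp hBA.ne)
  have hIntg : ∫ v, suppFun L v ∂ν = (1 - t) * ∫ v, suppFun K v ∂ν + t * ∫ v, suppFun B v ∂ν := by
    rw [← integral_const_mul, ← integral_const_mul, ← integral_add (hiK.const_mul _) (hiB.const_mul _)]
    refine integral_congr_ae (Eventually.of_forall fun v => ?_)
    exact suppFun_smul_comb hK.comp hBA.comp hK.ne hBA.ne hs.le ht0.le v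
  have hK0 : 0 ≤ ∫ v, suppFun K v ∂ν := integral_nonneg fun v => hK.supp_nonneg v
  have hae : ∀ᵐ x ∂ν, ‖x‖ = 1 := by
    have h0 : ∀ᵐ x ∂ν, x ∉ (sphere (0 : Eu n) 1)ᶜ := measure_eq_zero_iff_ae_notMem.1 hν
    filter_upwards [h0] with x hx
    simpa using hx
  have hBi : ∫ v, suppFun B v ∂ν ≤ R * m := by
    have : ∫ v, suppFun B v ∂ν ≤ ∫ v, R ∂ν := by
      refine integral_mono_ae hiB (integrable_const _) ?_
      filter_upwards [hae] with v hv1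
      refine suppFun_le hBA.comp hBA.ne fun y hy => ?_
      have hy' : ‖y‖ ≤ R := by simpa [hB] using hy
      have := real_inner_le_norm y v
      rw [hv1, mul_one] at this
      linarith
    rw [integral_const, smul_eq_mul] at this
    calc _ ≤ _ := this
      _ = R * m := by rw [mul_comm]; rfl
  have hBi' := mul_le_mul_of_nonneg_left hBi ht0.le
  have hK0' : 0 ≤ t * ∫ v, suppFun K v ∂ν := mul_nonneg ht0.le hK0
  unfold FF at hle
  rw [hIntg, hv] at hle
  linarith

lemma euler_le {ν : Measure (Eu n)} [IsFiniteMeasure ν] (hn : 1 ≤ n) (hν : ν (sphere (0 : Eu n) 1)ᶜ = 0)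
    {K : Set (Eu n)} (hK : Adm K) (hv : 1 / 2 < gaussVol n K) (hmax : ∀ L, Adm L → FF ν L ≤ FF ν K)
    {f : Eu n → ℝ} (hf : Continuous f) (hfe : ∀ v, f (-v) = f v) :
    ∫ v, f v ∂SK K ≤ ∫ v, f v ∂ν := by
  have h := hK.cb
  have hvar := h.variation hn hf
  obtain ⟨C, hC, hKt⟩ := h.Kt_bounds hf
  have ev0 : ∀ᶠ t in 𝓝[>] (0:ℝ), 0 < t := self_mem_nhdsWithin
  have hid : Tendsto (fun t : ℝ => t) (𝓝[>] 0) (𝓝 0) := nhdsWithin_le_nhds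
  have ev1 : ∀ᶠ t in 𝓝[>] (0:ℝ), C * t ≤ 1 / 2 := by
    have : Tendsto (fun t : ℝ => C * t) (𝓝[>] 0) (𝓝 (C * 0)) := hid.const_mul C
    rw [mul_zero] at this
    filter_upwards [this.eventually (gt_mem_nhds (by norm_num : (0:ℝ) < 1/2))] with t ht using ht.le
  have ev2 : ∀ᶠ t in 𝓝[>] (0:ℝ), 1 / 2 - gaussVol n K <
      t * ((gaussVol n (Kt K f t) - gaussVol n K) / t) := by
    have := hid.mul hvar
    rw [zero_mul] at this
    exact this.eventually (lt_mem_nhds (by linarith))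
  have hae : ∀ᵐ x ∂ν, ‖x‖ = 1 := by
    have h0 : ∀ᵐ x ∂ν, x ∉ (sphere (0 : Eu n) 1)ᶜ := measure_eq_zero_iff_ae_notMem.1 hν
    filter_upwards [h0] with x hx
    simpa using hx
  have hsK : ∀ v, suppFun K (-v) = suppFun K v := by
    have : ∀ v, suppFun K (-v) ≤ suppFun K v := fun v => by
      refine suppFun_le hK.comp hK.ne fun y hy => ?_
      rw [inner_neg_right, ← inner_neg_left]
      exact le_suppFun hK.comp (hK.sym y hy) v
    intro v
    refine le_antisymm (this v) ?_
    have := this (-v); rwa [neg_neg] at this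
  refine le_of_tendsto hvar ?_
  filter_upwards [ev0, ev1, ev2] with t ht0 ht1 ht2
  rw [mul_div_cancel₀ _ ht0.ne'] at ht2
  have hcb := (hKt t ht0 ht1).1
  have hA : Adm (Kt K f t) := by
    refine ⟨hcb.comp, hcb.ne, hcb.conv, fun x hx v hv1 => ?_, by linarith⟩
    have := hx (-v) (by rwa [norm_neg])
    simp only [hsK, hfe, inner_neg_right] at this
    rwa [inner_neg_left]
  have hle := hmax _ hA
  have hiK := intg_cont hν (suppFun_cont hK.comp hK.ne)
  have hif := intg_cont hν hf
  have hi : ∫ v, suppFun (Kt K f t) v ∂ν ≤ ∫ v, suppFun K v ∂ν + t * ∫ v, f v ∂ν := by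
    rw [← integral_const_mul, ← integral_add hiK (hif.const_mul _)]
    refine integral_mono_ae (intg_cont hν (suppFun_cont hA.comp hA.ne)) (hiK.add (hif.const_mul _)) ?_
    filter_upwards [hae] with v hv1
    exact suppFun_le hA.comp hA.ne fun y hy => hy v hv1
  rw [div_le_iff₀ ht0]
  unfold FF at hle
  linarith

lemma int_sym {ν : Measure (Eu n)} [IsFiniteMeasure ν] (hν : ν (sphere (0 : Eu n) 1)ᶜ = 0)
    (he : ∀ η : Set (Eu n), MeasurableSet η → ν (-η) = ν η) {f : Eu n → ℝ} (hf : Continuous f) :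
    ∫ v, (f v + f (-v)) ∂ν = 2 * ∫ v, f v ∂ν := by
  have hm : Measure.map (fun x : Eu n => -x) ν = ν := by
    ext η hη
    rw [Measure.map_apply measurable_neg hη]
    exact he η hη
  have e : ∫ v, f (-v) ∂ν = ∫ v, f v ∂ν := by
    conv_rhs => rw [← hm]
    rw [integral_map measurable_neg.aemeasurable hf.aestronglyMeasurable]
  rw [integral_add (intg_cont hν hf) (intg_cont hν (by fun_prop)), e]; ring

theorem exists_body {ν : Measure (Eu n)} [IsFiniteMeasure ν] (hn : 1 ≤ n) (hν : ν (sphere (0 : Eu n) 1)ᶜ = 0)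
    (he : ∀ η : Set (Eu n), MeasurableSet η → ν (-η) = ν η)
    (hsub : ∀ v : Eu n, ‖v‖ = 1 → ν {x | ⟪x, v⟫ ≠ 0} ≠ 0)
    (hm : (ν univ).toReal < 1 / Real.sqrt (2 * Real.pi)) :
    ∃ K : Set (Eu n), CB K ∧ K = -K ∧ 1 / 2 < gaussVol n K ∧ SK K = ν := by
  obtain ⟨K, hK, hmax⟩ := exists_max hn hν hsub
  have hv := max_half hn hν hm hK hmax
  have h := hK.cb
  refine ⟨K, h, hK.eq_neg, hv, ?_⟩
  haveI := h.SK_fin hn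
  refine ext_of_forall_integral_eq_of_IsFiniteMeasure fun f => ?_
  have hf : Continuous (fun v => f v) := f.continuous
  have hg : Continuous (fun v => f v + f (-v)) := by fun_prop
  have a1 := euler_le hn hν hK hv hmax hg (fun v => by rw [neg_neg, add_comm])
  have a2 := euler_le hn hν hK hv hmax (f := fun v => -(f v + f (-v))) hg.neg (fun v => by rw [neg_neg, add_comm])
  rw [integral_neg, integral_neg] at a2
  have b1 := int_sym (h.SK_sphere hn) (fun η hη => SK_neg hK.eq_neg hη) hf
  have b2 := int_sym hν he hf
  linarith

theorem main_thm
    (n : ℕ) (hn : 2 ≤ n)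
    (μ : Measure (Eu n)) [IsFiniteMeasure μ]
    (hsph : μ (sphere (0 : Eu n) 1)ᶜ = 0)
    (heven : ∀ η : Set (Eu n), MeasurableSet η → μ (-η) = μ η)
    (hsub : ∀ v : Eu n, ‖v‖ = 1 → μ {x | ⟪x, v⟫ ≠ 0} ≠ 0)
    (hmass : (μ univ).toReal < 1 / Real.sqrt (2 * Real.pi)) :
    ∃! K : Set (Eu n),
      (IsConvexBody K ∧ K = -K ∧ (0 : Eu n) ∈ interior K ∧ 1 / 2 < gaussVol n K) ∧
        ∀ η ⊆ sphere (0 : Eu n) 1, MeasurableSet η → gaussSurf n K η = (μ η).toReal := by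
  have hn1 : 1 ≤ n := by omega
  set k := kap (n-1) with hk
  have hk0 : k ≠ 0 := kap_ne _
  have hk0' : (k : ℝ) ≠ 0 := by exact_mod_cast hk0
  have hke : (k : ℝ≥0∞) ≠ 0 := by exact_mod_cast hk0
  have hk1 : (k : ℝ) ≤ 1 := by exact_mod_cast kap_le _
  set ν : Measure (Eu n) := k • μ with hνd
  have hap : ∀ s, ν s = (k : ℝ≥0∞) * μ s := fun s => rfl
  have hνs : ν (sphere (0 : Eu n) 1)ᶜ = 0 := by rw [hap, hsph, mul_zero]
  obtain ⟨K, hK, hKs, hKv, hKS⟩ := exists_body (ν := ν) hn1 hνs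
    (fun η hη => by rw [hap, hap, heven η hη])
    (fun v hv => by rw [hap]; exact mul_ne_zero hke (hsub v hv))
    (by
      rw [hap, ENNReal.toReal_mul, ENNReal.coe_toReal]
      refine lt_of_le_of_lt ?_ hmass
      exact mul_le_of_le_one_left ENNReal.toReal_nonneg hk1)
  refine ⟨K, ⟨⟨⟨hK.conv, hK.comp, ⟨0, hK.int0⟩⟩, hKs, hK.int0, hKv⟩, fun η hη hm => ?_⟩, ?_⟩
  · have := hK.gaussSurf_eq hn1 hη hm
    rw [hKS, hap, ENNReal.toReal_mul, ENNReal.coe_toReal] at this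
    exact mul_left_cancel₀ hk0' this
  · rintro L ⟨⟨⟨l1, l2, -⟩, -, l0, lv⟩, hLS⟩
    have hL : CB L := ⟨l1, l2, l0⟩
    refine uniq_body hn1 hL hK lv hKv ?_
    rw [hKS]
    haveI := hL.SK_fin hn1
    have hS0 := hL.SK_sphere hn1
    have hmS : MeasurableSet (sphere (0 : Eu n) 1) := isClosed_sphere.measurableSet
    ext η hη
    have hz1 : SK L (η \ sphere (0 : Eu n) 1) = 0 := measure_mono_null (fun x hx => hx.2) hS0
    have hz2 : ν (η \ sphere (0 : Eu n) 1) = 0 := measure_mono_null (fun x hx => hx.2) hνs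
    rw [← measure_inter_add_sdiff (μ := SK L) η hmS, ← measure_inter_add_sdiff (μ := ν) η hmS,
      hz1, hz2, add_zero, add_zero]
    have e := hL.gaussSurf_eq hn1 (η := η ∩ sphere 0 1) inter_subset_right (hη.inter hmS)
    rw [hLS _ inter_subset_right (hη.inter hmS)] at e
    refine (ENNReal.toReal_eq_toReal_iff' (measure_ne_top _ _) (measure_ne_top _ _)).1 ?_
    rw [← e, hap, ENNReal.toReal_mul, ENNReal.coe_toReal]

end exi
end

/-- The even Gaussian Minkowski problem: if `μ` is a finite even Borel measure on the
sphere, not concentrated in any great subsphere, with total mass `< 1/√(2π)`, then there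
is a unique origin-symmetric convex body `K` with `γₙ(K) > 1/2` and `S_{γₙ,K} = μ`. -/
theorem gaussian_minkowski_existence_uniqueness
    (n : ℕ) (hn : 2 ≤ n)
    (μ : Measure (Eu n)) [IsFiniteMeasure μ]
    (hsph : μ (sphere (0 : Eu n) 1)ᶜ = 0)
    (heven : ∀ η : Set (Eu n), MeasurableSet η → μ (-η) = μ η)
    (hsub : ∀ v : Eu n, ‖v‖ = 1 → μ {x | ⟪x, v⟫ ≠ 0} ≠ 0)
    (hmass : (μ univ).toReal < 1 / Real.sqrt (2 * Real.pi)) :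
    ∃! K : Set (Eu n),
      (IsConvexBody K ∧ K = -K ∧ (0 : Eu n) ∈ interior K ∧ 1 / 2 < gaussVol n K) ∧
        ∀ η ⊆ sphere (0 : Eu n) 1, MeasurableSet η → gaussSurf n K η = (μ η).toReal := by
  exact main_thm n hn μ hsph heven hsub hmass
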